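/- (Biane's limit-shape theorem.) Let c ∈ [0,∞) and let N(n) be a sequence of positive integers with √n/N(n) → c as n → ∞. Then for every ε > 0, lim_{n→∞} ℙ_{N(n)}^n{ λ ∈ 𝕐_{N(n)}^n : |L_λ(X) − Ω_c(X)| ≤ ε for all X ∈ ℝ } = 1. -/

import Mathlib

open MeasureTheory Real Filter Topology
open scoped Classical

noncomputable section

/-- Row lengths of a partition of `n`, `1`-indexed and weakly decreasing
(`rowLen lam i` is the length `λᵢ` of the `i`-th row; it is `0` for `i` beyond
the number of parts). -/
def rowLen {n : ℕ} (lam : Nat.Partition n) (i : ℕ) : ℕ :=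
  ((lam.parts.sort (· ≤ ·)).reverse.getD (i - 1) 0)

/-- Column lengths, i.e. the conjugate partition `λ′ⱼ = #{i : λᵢ ≥ j}`. -/
def colLen {n : ℕ} (lam : Nat.Partition n) (j : ℕ) : ℕ :=
  ((Finset.Icc 1 n).filter (fun i => j ≤ rowLen lam i)).card

/-- The cells `(i, j)` of the Young diagram of `lam`, with `1 ≤ i` and `1 ≤ j ≤ λᵢ`. -/
def cellsOf {n : ℕ} (lam : Nat.Partition n) : Finset (ℕ × ℕ) :=
  (Finset.Icc 1 n ×ˢ Finset.Icc 1 n).filter (fun p => p.2 ≤ rowLen lam p.1)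

/-- The hook length `h_{i,j} = (λᵢ − j) + (λ′ⱼ − i) + 1` of the cell `(i,j)`. -/
def hookLen {n : ℕ} (lam : Nat.Partition n) (i j : ℕ) : ℕ :=
  (rowLen lam i - j) + (colLen lam j - i) + 1

/-- `𝕐_N^n`: Young diagrams with `n` cells and at most `N` rows. -/
def YNN (n N : ℕ) : Finset (Nat.Partition n) :=
  Finset.univ.filter (fun lam => lam.parts.card ≤ N)

/-- `dim E_λ = n! · ∏ (N + c_{i,j}) / (∏ h_{i,j})²`, the dimension of the isotypic
component of `(ℂ^N)^{⊗n}` indexed by `λ` (here the content is `c_{i,j} = j − i`). -/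
def dimE (n N : ℕ) (lam : Nat.Partition n) : ℝ :=
  (n.factorial : ℝ) * (∏ p ∈ cellsOf lam, ((N : ℝ) + (p.2 : ℝ) - (p.1 : ℝ))) /
    (∏ p ∈ cellsOf lam, (hookLen lam p.1 p.2 : ℝ))^2

/-- The probability measure `ℙ_N^n(λ) = dim E_λ / N^n` on `𝕐_N^n`. -/
def PNN (n N : ℕ) (lam : Nat.Partition n) : ℝ := dimE n N lam / (N : ℝ)^n

/-- The rescaled profile `L_λ` of a Young diagram `λ` with `n` cells: the
diagram (each cell `(i,j)` being a unit box), scaled by `1/√(2n)` and rotated by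
45° via `X = (x−y)/√2`, `Y = (x+y)/√2`, has region `{(X,Y) : |X| ≤ Y ≤ L_λ(X)}`;
equivalently `L_λ(X)` is the larger of `|X|` and the supremum of `Y` over the
rotated scaled diagram on the vertical line at `X`. -/
def Lprofile (n : ℕ) (lam : Nat.Partition n) (X : ℝ) : ℝ :=
  max |X| (sSup {Y : ℝ | ∃ x y : ℝ,
    (∃ i j : ℕ, 1 ≤ i ∧ 1 ≤ j ∧ j ≤ rowLen lam i ∧
      ((j:ℝ)-1)/Real.sqrt (2*n) ≤ x ∧ x ≤ (j:ℝ)/Real.sqrt (2*n) ∧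
      ((i:ℝ)-1)/Real.sqrt (2*n) ≤ y ∧ y ≤ (i:ℝ)/Real.sqrt (2*n)) ∧
    X = (x - y)/Real.sqrt 2 ∧ Y = (x + y)/Real.sqrt 2})

/-- The function `h(c,s)` defining the curved part of the limit shape, for
`2s ∈ [c−2, c+2]` (with the continuous extension at `c = 0`). -/
def hshape (c s : ℝ) : ℝ :=
  if c = 0 then (2/π) * (s * Real.arcsin s + Real.sqrt (1 - s^2))
  else (2/π) * (s * Real.arcsin ((2*s+c)/(2*Real.sqrt (1+2*s*c)))
      + (1/(2*c)) * Real.arccos ((2+2*s*c-c^2)/(2*Real.sqrt (1+2*s*c)))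
      + (1/4) * Real.sqrt (4-(2*s-c)^2))

/-- Biane's limit shape `Ω_c`. -/
def Omega (c : ℝ) (s : ℝ) : ℝ :=
  if c ≤ 1 then (if c - 2 ≤ 2*s ∧ 2*s ≤ c + 2 then hshape c s else |s|)
  else if -(1/c) ≤ 2*s ∧ 2*s ≤ c - 2 then s + 1/c
  else if c - 2 ≤ 2*s ∧ 2*s ≤ c + 2 then hshape c s else |s|

namespace BLS
open Finset

def rr {N : ℕ} (X : Fin N → ℝ) (i : Fin N) : ℝ :=
  ∏ j ∈ univ.erase i, ((X i - X j + 1) / (X i - X j))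

def geo (x : ℝ) : PowerSeries ℝ := PowerSeries.mk (fun k => x ^ k)

lemma geo_mul (x : ℝ) : geo x * (1 - PowerSeries.C x * PowerSeries.X) = 1 := by
  ext k
  rw [mul_sub, map_sub, mul_one]
  cases k with
  | zero => simp [geo]
  | succ k =>
    have : geo x * (PowerSeries.C x * PowerSeries.X) = (geo x * PowerSeries.C x) * PowerSeries.X := by ring
    rw [this, PowerSeries.coeff_succ_mul_X]
    simp [geo, PowerSeries.coeff_mul_C, PowerSeries.coeff_one, pow_succ]

def PS {N : ℕ} (X : Fin N → ℝ) : PowerSeries ℝ := ∏ j, (1 + PowerSeries.X * geo (X j))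

lemma lagr {N : ℕ} (X : Fin N → ℝ) (hX : Function.Injective X) (z : ℝ) :
    ∏ j, (z - X j + 1) - ∏ j, (z - X j) = ∑ i, rr X i * ∏ j ∈ univ.erase i, (z - X j) := by
  classical
  let P : Polynomial ℝ := ∏ j, (Polynomial.X - Polynomial.C (X j - 1)) - ∏ j, (Polynomial.X - Polynomial.C (X j))
  let R : Polynomial ℝ := ∑ i, Polynomial.C (rr X i) * ∏ j ∈ univ.erase i, (Polynomial.X - Polynomial.C (X j))
  have hN : (univ : Finset (Fin N)).card = N := by simp
  have hmon1 : (∏ j, (Polynomial.X - Polynomial.C (X j - 1)) : Polynomial ℝ).Monic :=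
    Polynomial.monic_prod_of_monic _ _ (fun i _ => Polynomial.monic_X_sub_C _)
  have hmon2 : (∏ j, (Polynomial.X - Polynomial.C (X j)) : Polynomial ℝ).Monic :=
    Polynomial.monic_prod_of_monic _ _ (fun i _ => Polynomial.monic_X_sub_C _)
  have hd1 : (∏ j, (Polynomial.X - Polynomial.C (X j - 1)) : Polynomial ℝ).degree = N := by
    rw [Polynomial.degree_prod]; simp only [Polynomial.degree_X_sub_C]; simp
  have hd2 : (∏ j, (Polynomial.X - Polynomial.C (X j)) : Polynomial ℝ).degree = N := by
    rw [Polynomial.degree_prod]; simp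
  have hPR : P = R := by
    apply Polynomial.eq_of_degrees_lt_of_eval_index_eq (s := univ) (v := X) hX.injOn
    · rw [hN, ← hd1]
      exact Polynomial.degree_sub_lt_left (by rw [hd1, hd2]) hmon1.ne_zero (by rw [hmon1.leadingCoeff, hmon2.leadingCoeff])
    · rw [hN]
      apply lt_of_le_of_lt (Polynomial.degree_sum_le _ _)
      rw [Finset.sup_lt_iff (by exact WithBot.bot_lt_coe N)]
      intro i _
      rw [← Polynomial.smul_eq_C_mul]
      apply lt_of_le_of_lt (Polynomial.degree_smul_le _ _)
      rw [Polynomial.degree_prod]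
      have : (univ.erase i).card < N := by
        rw [card_erase_of_mem (mem_univ _), hN]; have := i.2; omega
      simp only [Polynomial.degree_X_sub_C, sum_const, nsmul_eq_mul, mul_one]
      exact_mod_cast this
    · intro i _
      simp only [P, R, Polynomial.eval_sub, Polynomial.eval_prod, Polynomial.eval_finsetSum,
        Polynomial.eval_mul, Polynomial.eval_C, Polynomial.eval_X]
      rw [Finset.prod_eq_zero (s := univ) (f := fun j => X i - X j) (mem_univ i) (sub_self _)]
      rw [Finset.sum_eq_single i]
      · rw [rr, ← Finset.prod_mul_distrib, sub_zero, ← Finset.mul_prod_erase univ _ (mem_univ i)]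
        have : X i - (X i - 1) = 1 := by ring
        rw [this, one_mul]
        apply Finset.prod_congr rfl
        intro j hj
        have hne : X i - X j ≠ 0 := by
          intro h; exact (Finset.ne_of_mem_erase hj) (hX (by linarith)).symm
        field_simp; ring
      · intro b _ hb
        rw [Finset.prod_eq_zero (i := i) (by simp [hb.symm]) (sub_self _), mul_zero]
      · simp
  have := congrArg (Polynomial.eval z) hPR
  simp only [P, R, Polynomial.eval_sub, Polynomial.eval_prod, Polynomial.eval_finsetSum,
        Polynomial.eval_mul, Polynomial.eval_C, Polynomial.eval_X] at this
  rw [← this]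
  congr 1
  apply Finset.prod_congr rfl; intros; ring

lemma lagr_w {N : ℕ} (X : Fin N → ℝ) (hX : Function.Injective X) :
    (∏ j, (1 - Polynomial.C (X j - 1) * Polynomial.X) - ∏ j, (1 - Polynomial.C (X j) * Polynomial.X) : Polynomial ℝ)
     = ∑ i, Polynomial.C (rr X i) * Polynomial.X * ∏ j ∈ univ.erase i, (1 - Polynomial.C (X j) * Polynomial.X) := by
  apply Polynomial.eq_of_infinite_eval_eq
  apply Set.Infinite.mono (s := {0}ᶜ) _ (Set.Finite.infinite_compl (Set.finite_singleton 0))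
  intro w hw
  have hw : w ≠ 0 := hw
  have h := lagr X hX (1 / w)
  simp only [Set.mem_ofPred_eq, Polynomial.eval_sub, Polynomial.eval_prod, Polynomial.eval_finsetSum,
        Polynomial.eval_mul, Polynomial.eval_C, Polynomial.eval_X, Polynomial.eval_one]
  have e1 : ∏ j, (1 - (X j - 1) * w) = w ^ N * ∏ j, (1 / w - X j + 1) := by
    have : w ^ N = ∏ _j : Fin N, w := by simp
    rw [this, ← Finset.prod_mul_distrib]
    apply Finset.prod_congr rfl; intros; field_simp; ring
  have e2 : ∏ j, (1 - (X j) * w) = w ^ N * ∏ j, (1 / w - X j) := by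
    have : w ^ N = ∏ _j : Fin N, w := by simp
    rw [this, ← Finset.prod_mul_distrib]
    apply Finset.prod_congr rfl; intros; field_simp
  rw [e1, e2, ← mul_sub, h, Finset.mul_sum]
  apply Finset.sum_congr rfl
  intro i _
  have : w ^ N = w * ∏ _j ∈ univ.erase i, w := by
    rw [Finset.mul_prod_erase univ (fun _ => w) (mem_univ i)]; simp
  rw [this]
  have : ∏ j ∈ univ.erase i, (1 - X j * w) = (∏ _j ∈ univ.erase i, w) * ∏ j ∈ univ.erase i, (1 / w - X j) := by
    rw [← Finset.prod_mul_distrib]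
    apply Finset.prod_congr rfl; intros; field_simp
  rw [this]; ring

lemma PS_eq {N : ℕ} (X : Fin N → ℝ) (hX : Function.Injective X) :
    PS X = 1 + ∑ i, PowerSeries.C (rr X i) * PowerSeries.X * geo (X i) := by
  have h := congrArg (fun p : Polynomial ℝ => (Polynomial.coeToPowerSeries.ringHom p)) (lagr_w X hX)
  simp only [map_sub, map_prod, map_mul, map_sum, map_one, Polynomial.coeToPowerSeries.ringHom_apply,
    Polynomial.coe_C, Polynomial.coe_X] at h
  have hg : (∏ j, geo (X j)) * ∏ j, (1 - PowerSeries.C (X j) * PowerSeries.X) = 1 := by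
    rw [← Finset.prod_mul_distrib]
    exact Finset.prod_eq_one (fun j _ => geo_mul _)
  have h1 : PS X = (∏ j, geo (X j)) * ∏ j, (1 - (PowerSeries.C (X j) - 1) * PowerSeries.X) := by
    rw [PS, ← Finset.prod_mul_distrib]
    apply Finset.prod_congr rfl; intro j _
    have := geo_mul (X j)
    linear_combination -this
  have h2 : ∀ i, (∏ j, geo (X j)) * (PowerSeries.C (rr X i) * PowerSeries.X * ∏ j ∈ univ.erase i, (1 - PowerSeries.C (X j) * PowerSeries.X))
      = PowerSeries.C (rr X i) * PowerSeries.X * geo (X i) := by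
    intro i
    rw [← Finset.mul_prod_erase univ _ (mem_univ i)]
    have : (∏ j ∈ univ.erase i, geo (X j)) * ∏ j ∈ univ.erase i, (1 - PowerSeries.C (X j) * PowerSeries.X) = 1 := by
      rw [← Finset.prod_mul_distrib]
      exact Finset.prod_eq_one (fun j _ => geo_mul _)
    linear_combination (PowerSeries.C (rr X i) * PowerSeries.X * geo (X i)) * this
  have h3 := congrArg (fun p => (∏ j, geo (X j)) * p) h
  simp only [Finset.mul_sum, h2, mul_sub] at h3
  rw [hg] at h3
  rw [← h3, h1]
  simp [mul_sub]

lemma rr_moment {N : ℕ} (X : Fin N → ℝ) (hX : Function.Injective X) (k : ℕ) :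
    ∑ i, rr X i * X i ^ k = PowerSeries.coeff (k+1) (PS X) := by
  rw [PS_eq X hX, map_add, map_sum]
  simp only [PowerSeries.coeff_one, Nat.add_eq_zero_iff, one_ne_zero, and_false, if_false, zero_add]
  apply Finset.sum_congr rfl
  intro i _
  rw [mul_assoc, PowerSeries.coeff_C_mul, PowerSeries.coeff_succ_X_mul, geo, PowerSeries.coeff_mk]

lemma PS_coeff0 {N : ℕ} (X : Fin N → ℝ) : PowerSeries.coeff 0 (PS X) = 1 := by
  rw [PS]; simp

lemma PS_coeff12 (N : ℕ) (X : Fin N → ℝ) : PowerSeries.coeff 1 (PS X) = N ∧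
    PowerSeries.coeff 2 (PS X) = ∑ j, X j + N * (N - 1) / 2 := by
  induction N with
  | zero => simp [PS, PowerSeries.coeff_one]
  | succ N ih =>
    have hsplit : PS X = PS (fun j : Fin N => X j.succ) + PowerSeries.X * (PS (fun j : Fin N => X j.succ) * geo (X 0)) := by
      rw [PS, Fin.prod_univ_succ, PS]; ring
    obtain ⟨h1, h2⟩ := ih (fun j : Fin N => X j.succ)
    have h0 := PS_coeff0 (fun j : Fin N => X j.succ)
    constructor
    · rw [hsplit, map_add, h1, PowerSeries.coeff_succ_X_mul, PowerSeries.coeff_mul]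
      simp [h0, geo] at *
    · rw [hsplit, map_add, h2, PowerSeries.coeff_succ_X_mul, PowerSeries.coeff_mul, Fin.sum_univ_succ]
      rw [Finset.Nat.antidiagonal_succ]
      simp only [Finset.Nat.antidiagonal_zero, sum_cons, map_singleton, sum_singleton, h0]
      simp [geo, h1]
      ring

lemma rr_sum {N : ℕ} (X : Fin N → ℝ) (hX : Function.Injective X) : ∑ i, rr X i = N := by
  have := rr_moment X hX 0
  simpa [(PS_coeff12 N X).1] using this

lemma rr_sum1 {N : ℕ} (X : Fin N → ℝ) (hX : Function.Injective X) :
    ∑ i, rr X i * X i = ∑ j, X j + N * (N - 1) / 2 := by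
  have := rr_moment X hX 1
  simpa [(PS_coeff12 N X).2] using this

def vv (s : ℕ) (x : ℝ) : ℝ := ((x + 1) ^ s - (x - 1) ^ s) / 2

lemma geo_step (x : ℝ) : 1 + PowerSeries.X * geo (x+1) =
    (1 + PowerSeries.X * geo x) * (1 + PowerSeries.X * PowerSeries.mk (fun s => vv s x)) := by
  have hV : (PowerSeries.mk (fun s => vv s x)) = PowerSeries.C (1/2) * (geo (x+1) - geo (x-1)) := by
    ext s; simp [vv, geo, PowerSeries.coeff_C_mul]; ring
  have h2 : (PowerSeries.C (1/2 : ℝ)) * 2 = 1 := by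
    have : (2 : PowerSeries ℝ) = PowerSeries.C 2 := (map_ofNat PowerSeries.C 2).symm
    rw [this, ← map_mul]; norm_num
  have g0 := geo_mul x
  have g1 := geo_mul (x+1)
  have g2 := geo_mul (x-1)
  rw [hV]
  simp only [map_add, map_sub, map_one] at g1 g2
  set c := PowerSeries.C (1/2 : ℝ)
  set a := PowerSeries.C x
  set w : PowerSeries ℝ := PowerSeries.X
  set G0 := geo x
  set G1 := geo (x+1)
  set G2 := geo (x-1)
  -- 1 + w G1 = (1-xw) G1 ; 1 + w G0 = (1-(x-1)w) G0 ; 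
  have e1 : 1 + w * G1 = (1 - a*w) * G1 := by linear_combination -g1
  have e0 : 1 + w * G0 = (1 - (a-1)*w) * G0 := by linear_combination -g0
  have e2 : 1 + w * (c * (G1 - G2)) = (1 - a*w)^2 * G1 * G2 := by
    have : G1 - G2 = 2 * w * G1 * G2 := by linear_combination -G1 * g2 + G2 * g1
    rw [this]
    linear_combination w^2*G1*G2*h2 - G2 * (1-(a-1)*w) * g1  - g2
  rw [e1, e0, e2]
  linear_combination (-(1-a*w)^2*G1*G0) * g2 - (1-a*w)*G1*g0

lemma PS_update {N : ℕ} (X : Fin N → ℝ) (i : Fin N) :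
    PS (Function.update X i (X i + 1)) = PS X * (1 + PowerSeries.X * PowerSeries.mk (fun s => vv s (X i))) := by
  rw [PS, PS, ← Finset.mul_prod_erase univ _ (mem_univ i), ← Finset.mul_prod_erase univ (fun j => 1 + PowerSeries.X * geo (X j)) (mem_univ i)]
  have : ∏ j ∈ univ.erase i, (1 + PowerSeries.X * geo (Function.update X i (X i + 1) j)) = ∏ j ∈ univ.erase i, (1 + PowerSeries.X * geo (X j)) := by
    apply Finset.prod_congr rfl
    intro j hj
    rw [Function.update_of_ne (Finset.ne_of_mem_erase hj)]
  rw [this, Function.update_self, geo_step]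
  ring

/-- k-th moment of the growth distribution. -/
def aa {N : ℕ} (X : Fin N → ℝ) (k : ℕ) : ℝ := (∑ i, rr X i * X i ^ k) / N

lemma aa_update {N : ℕ} (hN : 0 < N) (X : Fin N → ℝ) (hX : Function.Injective X) (i : Fin N)
    (hX' : Function.Injective (Function.update X i (X i + 1))) (k : ℕ) :
    aa (Function.update X i (X i + 1)) (k+1) = aa X (k+1) + vv (k+1) (X i) / N
      + ∑ p ∈ antidiagonal k, aa X p.1 * vv p.2 (X i) := by
  have hN' : (N : ℝ) ≠ 0 := by positivity
  have key : PowerSeries.coeff (k+1) (PS X * PowerSeries.mk (fun s => vv s (X i))) = vv (k+1) (X i) +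
     ∑ p ∈ antidiagonal k, N * aa X p.1 * vv p.2 (X i) := by
    rw [PowerSeries.coeff_mul, Finset.Nat.antidiagonal_succ, sum_cons, PS_coeff0, sum_map]
    simp only [PowerSeries.coeff_mk, one_mul]
    congr 1
    apply Finset.sum_congr rfl
    intro p _
    simp only [Function.Embedding.coe_prodMap, Prod.map, Function.Embedding.coeFn_mk, Function.Embedding.refl_apply]
    rw [aa, mul_div_cancel₀ _ hN', rr_moment X hX]
  rw [aa, rr_moment _ hX', PS_update, mul_add, mul_one, map_add, ← rr_moment X hX]
  have : PS X * (PowerSeries.X * PowerSeries.mk (fun s => vv s (X i))) = PowerSeries.X * (PS X * PowerSeries.mk (fun s => vv s (X i))) := by ring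
  rw [this, PowerSeries.coeff_succ_X_mul, key, aa, add_div, add_div, Finset.sum_div, add_assoc]
  congr 2
  rw [Finset.sum_div]
  apply Finset.sum_congr rfl
  intro p _
  field_simp

lemma aa_zero {N : ℕ} (hN : 0 < N) (X : Fin N → ℝ) (hX : Function.Injective X) : aa X 0 = 1 := by
  have hN' : (N : ℝ) ≠ 0 := by positivity
  simp [aa, rr_sum X hX, hN']

end BLS

namespace BLS
open Finset

def XX {N : ℕ} (l : Fin N → ℕ) (i : Fin N) : ℝ := (l i : ℝ) - (i : ℕ)

def SS (N n : ℕ) : Finset (Fin N → ℕ) :=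
  (Fintype.piFinset (fun _ => Finset.range (n+1))).filter (fun l => Antitone l ∧ ∑ i, l i = n)

lemma mem_SS {N n : ℕ} {l : Fin N → ℕ} : l ∈ SS N n ↔ Antitone l ∧ ∑ i, l i = n := by
  simp only [SS, mem_filter, Fintype.mem_piFinset, mem_range, and_iff_right_iff_imp]
  rintro ⟨_, h⟩ i
  have := Finset.single_le_sum (f := l) (fun _ _ => Nat.zero_le _) (mem_univ i)
  omega

def dl {N : ℕ} (X : Fin N → ℝ) : ℝ := ∏ a, ∏ b, if a < b then X a - X b else 1

lemma dl_ne {N : ℕ} {X : Fin N → ℝ} (h : dl X ≠ 0) {a b : Fin N} (hab : a < b) : X a ≠ X b := by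
  intro he
  apply h
  apply Finset.prod_eq_zero (mem_univ a)
  apply Finset.prod_eq_zero (mem_univ b)
  simp [hab, he]

lemma dl_split {N : ℕ} (X : Fin N → ℝ) (i : Fin N) :
    dl X = (∏ a ∈ univ.erase i, ∏ b ∈ univ.erase i, if a < b then X a - X b else 1) *
      (∏ j ∈ univ.erase i, if i < j then (1:ℝ) else -1) * ∏ j ∈ univ.erase i, (X i - X j) := by
  rw [dl, ← Finset.mul_prod_erase univ _ (mem_univ i)]
  have : ∀ a, (∏ b, if a < b then X a - X b else 1) = (if a < i then X a - X i else 1) *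
     ∏ b ∈ univ.erase i, if a < b then X a - X b else 1 := by
    intro a; rw [← Finset.mul_prod_erase univ _ (mem_univ i)]
  simp only [this]
  rw [Finset.prod_mul_distrib]
  simp only [lt_irrefl, if_false, one_mul]
  have e : (∏ j ∈ univ.erase i, if i < j then X i - X j else 1) * (∏ j ∈ univ.erase i, if j < i then X j - X i else 1)
    = (∏ j ∈ univ.erase i, if i < j then (1:ℝ) else -1) * ∏ j ∈ univ.erase i, (X i - X j) := by
    rw [← Finset.prod_mul_distrib, ← Finset.prod_mul_distrib]
    apply Finset.prod_congr rfl
    intro j hj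
    have hne := Finset.ne_of_mem_erase hj
    rcases lt_or_gt_of_ne hne with h | h
    · simp [h, h.not_gt]
    · simp [h, h.not_gt]
  linear_combination (∏ a ∈ univ.erase i, ∏ b ∈ univ.erase i, if a < b then X a - X b else 1) * e

lemma dl_update {N : ℕ} (X : Fin N → ℝ) (i : Fin N) (y : ℝ) :
    dl (Function.update X i y) * ∏ j ∈ univ.erase i, (X i - X j) = dl X * ∏ j ∈ univ.erase i, (y - X j) := by
  rw [dl_split X i, dl_split (Function.update X i y) i]
  have h1 : (∏ a ∈ univ.erase i, ∏ b ∈ univ.erase i, if a < b then Function.update X i y a - Function.update X i y b else 1)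
     = (∏ a ∈ univ.erase i, ∏ b ∈ univ.erase i, if a < b then X a - X b else 1) := by
    apply Finset.prod_congr rfl; intro a ha
    apply Finset.prod_congr rfl; intro b hb
    rw [Function.update_of_ne (Finset.ne_of_mem_erase ha), Function.update_of_ne (Finset.ne_of_mem_erase hb)]
  have h2 : ∏ j ∈ univ.erase i, (Function.update X i y i - Function.update X i y j) = ∏ j ∈ univ.erase i, (y - X j) := by
    apply Finset.prod_congr rfl; intro a ha
    rw [Function.update_of_ne (Finset.ne_of_mem_erase ha), Function.update_self]
  rw [h1, h2]; ring

lemma prod_ne {N : ℕ} {X : Fin N → ℝ} (hX : Function.Injective X) (i : Fin N) :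
    ∏ j ∈ univ.erase i, (X i - X j) ≠ 0 := by
  rw [Finset.prod_ne_zero_iff]
  intro j hj h
  exact (Finset.ne_of_mem_erase hj) (hX (by linarith)).symm

lemma dl_up {N : ℕ} {X : Fin N → ℝ} (hX : Function.Injective X) (i : Fin N) :
    dl (Function.update X i (X i + 1)) = dl X * rr X i := by
  have h := dl_update X i (X i + 1)
  have h0 := prod_ne hX i
  rw [rr, Finset.prod_div_distrib, ← mul_div_assoc, eq_div_iff h0, h]
  congr 1
  apply Finset.prod_congr rfl; intros; ring

lemma dl_down {N : ℕ} {X : Fin N → ℝ} (hX : Function.Injective X) (i : Fin N) :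
    dl (Function.update X i (X i - 1)) = dl X * rr (fun j => - X j) i := by
  have h := dl_update X i (X i - 1)
  have h0 := prod_ne hX i
  rw [rr]
  have : ∏ j ∈ univ.erase i, ((-X i - -X j + 1) / (-X i - -X j)) = ∏ j ∈ univ.erase i, ((X i - 1 - X j) / (X i - X j)) := by
    apply Finset.prod_congr rfl; intro j hj
    have hne : X i - X j ≠ 0 := fun h => (Finset.ne_of_mem_erase hj) (hX (by linarith)).symm
    have hne' : -X i - -X j ≠ 0 := by intro h; apply hne; linarith
    rw [div_eq_div_iff hne' hne]; ring
  rw [this, Finset.prod_div_distrib, ← mul_div_assoc, eq_div_iff h0, h]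

def upd {N : ℕ} (l : Fin N → ℕ) (i : Fin N) : Fin N → ℕ := Function.update l i (l i + 1)

lemma XX_upd {N : ℕ} (l : Fin N → ℕ) (i : Fin N) : XX (upd l i) = Function.update (XX l) i (XX l i + 1) := by
  ext j
  by_cases h : j = i
  · subst h; simp [XX, upd]; ring
  · simp [XX, upd, h]

lemma XX_anti {N : ℕ} {l : Fin N → ℕ} (hl : Antitone l) {a b : Fin N} (h : a < b) : XX l b + 1 ≤ XX l a := by
  have h1 : (l b : ℝ) ≤ l a := by exact_mod_cast hl h.le
  have h2 : ((a : ℕ) : ℝ) + 1 ≤ (b : ℕ) := by exact_mod_cast h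
  simp only [XX]; linarith

lemma XX_inj {N : ℕ} {l : Fin N → ℕ} (hl : Antitone l) : Function.Injective (XX l) := by
  intro a b hab
  rcases lt_trichotomy a b with h | h | h
  · have := XX_anti hl h; linarith
  · exact h
  · have := XX_anti hl h; linarith

lemma upd_anti {N : ℕ} {l : Fin N → ℕ} (hl : Antitone l) (i : Fin N) (h : dl (XX (upd l i)) ≠ 0) :
    Antitone (upd l i) := by
  intro a b hab
  rcases hab.eq_or_lt with rfl | hab
  · exact le_rfl
  by_cases hb : b = i
  · subst hb
    have ha : a ≠ b := hab.ne
    simp only [upd, Function.update_self, Function.update_of_ne ha]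
    by_contra hcon
    have h1 : (a : ℕ) < b := hab
    let j : Fin N := ⟨b - 1, by omega⟩
    have hjb : j < b := by show (b : ℕ) - 1 < b; omega
    have haj : a ≤ j := by show (a : ℕ) ≤ b - 1; omega
    have h2 := hl haj
    have h3 := hl hjb.le
    have h4 : l j = l b := by omega
    apply dl_ne h hjb
    simp only [XX, upd, Function.update_self, Function.update_of_ne hjb.ne, h4, j]
    have : ((b : ℕ) - 1 : ℕ) + 1 = (b : ℕ) := by omega
    have : (((b : ℕ) - 1 : ℕ) : ℝ) + 1 = (b : ℕ) := by exact_mod_cast this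
    push_cast; linarith
  · by_cases ha : a = i
    · subst ha
      simp only [upd, Function.update_self, Function.update_of_ne hb]
      have := hl hab.le; omega
    · simp only [upd, Function.update_of_ne hb, Function.update_of_ne ha]
      exact hl hab.le

def lf {N : ℕ} (l : Fin N → ℕ) : ℝ := ∏ i, ((l i + (N - 1 - i)).factorial : ℝ)
def sf (N : ℕ) : ℝ := ∏ i : Fin N, ((i : ℕ).factorial : ℝ)

def WW (N n : ℕ) (l : Fin N → ℕ) : ℝ :=
  (n.factorial : ℝ) / (N : ℝ)^n * dl (XX l) ^ 2 / (lf l * sf N)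

lemma WW_nonneg (N n : ℕ) (l : Fin N → ℕ) : 0 ≤ WW N n l := by
  have : 0 ≤ lf l := Finset.prod_nonneg (fun _ _ => by positivity)
  have : 0 ≤ sf N := Finset.prod_nonneg (fun _ _ => by positivity)
  unfold WW; positivity

def EE (N n : ℕ) (F : (Fin N → ℕ) → ℝ) : ℝ := ∑ l ∈ SS N n, WW N n l * F l

def QQ {N : ℕ} (l : Fin N → ℕ) (f : Fin N → ℝ) : ℝ := (∑ i, rr (XX l) i * f i) / N

lemma lf_pos {N : ℕ} (l : Fin N → ℕ) : 0 < lf l := Finset.prod_pos (fun _ _ => by positivity)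
lemma sf_pos (N : ℕ) : 0 < sf N := Finset.prod_pos (fun _ _ => by positivity)

lemma lf_upd {N : ℕ} (l : Fin N → ℕ) (i : Fin N) :
    lf (upd l i) = (XX l i + N) * lf l := by
  rw [lf, lf, ← Finset.mul_prod_erase univ _ (mem_univ i),
    ← Finset.mul_prod_erase univ (fun i : Fin N => ((l i + (N - 1 - i)).factorial : ℝ)) (mem_univ i), ← mul_assoc]
  congr 1
  · simp only [upd, Function.update_self]
    have : l i + 1 + (N - 1 - i) = (l i + (N - 1 - i)) + 1 := by ring
    rw [this, Nat.factorial_succ]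
    have h2 : (l i + (N - 1 - i)) + 1 + i = l i + N := by have := i.2; omega
    have h3 : (((l i + (N - 1 - i)) + 1 : ℕ) : ℝ) = XX l i + N := by
      have : (((l i + (N - 1 - i)) + 1 : ℕ) : ℝ) + (i : ℕ) = l i + N := by exact_mod_cast h2
      simp only [XX]; linarith
    rw [Nat.cast_mul, h3]
  · apply Finset.prod_congr rfl; intro j hj
    simp only [upd, Function.update_of_ne (Finset.ne_of_mem_erase hj)]

lemma sum_XX {N n : ℕ} {l : Fin N → ℕ} (h : ∑ i, l i = n) : ∑ i, XX l i = n - N * (N - 1) / 2 := by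
  simp only [XX, Finset.sum_sub_distrib]
  have h1 : ∑ i, (l i : ℝ) = n := by rw [← h]; push_cast; rfl
  have h2 : ∑ i : Fin N, ((i : ℕ) : ℝ) = N * (N - 1) / 2 := by
    rw [Fin.sum_univ_eq_sum_range (fun i => (i : ℝ)) N]
    clear h h1 l
    induction N with
    | zero => simp
    | succ N ih => rw [Finset.sum_range_succ, ih]; push_cast; ring
  rw [h1, h2]

lemma down_sum {N n : ℕ} {l : Fin N → ℕ} (hl : Antitone l) (h : ∑ i, l i = n) :
    ∑ i, rr (fun j => - XX l j) i * (XX l i + N - 1) = n := by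
  have hinj : Function.Injective (fun j => - XX l j) := by
    intro a b hab; exact XX_inj hl (neg_injective hab)
  have h1 := rr_sum _ hinj
  have h2 := rr_sum1 _ hinj
  have h3 := sum_XX h
  have : ∑ i, rr (fun j => - XX l j) i * (XX l i + N - 1) =
     - ∑ i, rr (fun j => - XX l j) i * (- XX l i) + (N - 1) * ∑ i, rr (fun j => - XX l j) i := by
    rw [Finset.mul_sum, ← Finset.sum_neg_distrib, ← Finset.sum_add_distrib]
    apply Finset.sum_congr rfl; intros; ring
  rw [this, h1, h2, Finset.sum_neg_distrib, h3]; ring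

def TT (N n : ℕ) (L : Fin N → ℕ) (i : Fin N) : ℝ :=
  (n.factorial : ℝ) / (N : ℝ)^(n+1) * dl (XX L) * dl (Function.update (XX L) i (XX L i - 1)) * (XX L i + N - 1) / (lf L * sf N)

lemma WW_succ {N n : ℕ} {L : Fin N → ℕ} (hL : L ∈ SS N (n+1)) :
    WW N (n+1) L = ∑ i, TT N n L i := by
  obtain ⟨ha, hs⟩ := mem_SS.1 hL
  have h := down_sum ha hs
  simp only [TT, dl_down (XX_inj ha)]
  have : ∀ i, (n.factorial : ℝ) / (N : ℝ)^(n+1) * dl (XX L) * (dl (XX L) * rr (fun j => - XX L j) i) * (XX L i + N - 1) / (lf L * sf N)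
    = (n.factorial : ℝ) / (N : ℝ)^(n+1) * dl (XX L)^2 / (lf L * sf N) * (rr (fun j => - XX L j) i * (XX L i + N - 1)) := by
    intro i; ring
  simp only [this]
  rw [← Finset.mul_sum, h, WW, Nat.factorial_succ]
  push_cast; ring

lemma EE_succ {N : ℕ} (n : ℕ) (F : (Fin N → ℕ) → ℝ) :
    EE N (n+1) F = EE N n (fun l => QQ l (fun i => F (upd l i))) := by
  have h1 : EE N (n+1) F = ∑ i, ∑ L ∈ SS N (n+1), TT N n L i * F L := by
    rw [Finset.sum_comm, EE]
    apply Finset.sum_congr rfl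
    intro L hL
    rw [WW_succ hL, Finset.sum_mul]
  have h2 : EE N n (fun l => QQ l (fun i => F (upd l i))) = ∑ i, ∑ l ∈ SS N n,
      WW N n l * (rr (XX l) i * F (upd l i) / N) := by
    rw [Finset.sum_comm, EE]
    apply Finset.sum_congr rfl
    intro L hL
    rw [QQ, Finset.sum_div, Finset.mul_sum]
  rw [h1, h2]
  apply Finset.sum_congr rfl
  intro i _
  symm
  have key : ∀ l ∈ SS N n, WW N n l * (rr (XX l) i * F (upd l i) / N) = TT N n (upd l i) i * F (upd l i) := by
    intro l hl
    obtain ⟨ha, hs⟩ := mem_SS.1 hl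
    have hu : Function.update (XX (upd l i)) i (XX (upd l i) i - 1) = XX l := by
      rw [XX_upd]; simp
    rw [TT, hu, XX_upd, dl_up (XX_inj ha), lf_upd, Function.update_self, WW]
    have hpos : 0 < XX l i + N := by
      have : ((i:ℕ):ℝ) < N := by exact_mod_cast i.2
      simp only [XX]; have : (0:ℝ) ≤ l i := by positivity
      linarith
    have h1 := lf_pos l
    have h2 := sf_pos N
    have hN : (0:ℝ) < N := by have := i.2; exact_mod_cast (by omega : 0 < N)
    field_simp
    ring
  apply Finset.sum_bij_ne_zero (fun l _ _ => upd l i)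
  · intro l hl hne
    obtain ⟨ha, hs⟩ := mem_SS.1 hl
    rw [key l hl] at hne
    have hd : dl (XX (upd l i)) ≠ 0 := by
      intro h0; apply hne; simp [TT, h0]
    rw [mem_SS]
    refine ⟨upd_anti ha i hd, ?_⟩
    rw [upd, Finset.sum_update_of_mem (mem_univ i), ← hs, ← Finset.sum_erase_add univ l (mem_univ i), Finset.sdiff_singleton_eq_erase]
    ring
  · intro l hl _ l' hl' _ h
    ext j
    have := congrFun h j
    by_cases hj : j = i
    · subst hj; simpa [upd] using this
    · simpa [upd, hj] using this
  · intro L hL hne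
    obtain ⟨ha, hs⟩ := mem_SS.1 hL
    have hd : dl (Function.update (XX L) i (XX L i - 1)) ≠ 0 := by
      intro h0; apply hne; simp [TT, h0]
    have hz : XX L i + N - 1 ≠ 0 := by
      intro h0; apply hne; simp [TT, h0]
    have hsucc : ∀ b : Fin N, i < b → L b < L i := by
      intro b hib
      have hib' : (i:ℕ) < b := hib
      let j : Fin N := ⟨i + 1, by omega⟩
      have hij : i < j := by show (i:ℕ) < i + 1; omega
      have hjb : j ≤ b := hib'
      have h1 := ha hij.le
      have h2 := ha hjb
      by_contra hcon
      have h3 : L i = L j := by omega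
      apply dl_ne hd hij
      simp only [Function.update_self, Function.update_of_ne hij.ne', XX, h3, j]
      push_cast; ring
    have hpos : 1 ≤ L i := by
      by_cases hi : (i : ℕ) + 1 < N
      · have := hsucc ⟨i+1, hi⟩ (by show (i:ℕ) < i + 1; omega)
        omega
      · by_contra hcon
        apply hz
        have h0 : L i = 0 := by omega
        have h1 : (i:ℕ) + 1 = N := by have := i.2; omega
        have h2 : ((i:ℕ):ℝ) + 1 = N := by exact_mod_cast h1
        simp only [XX, h0]; push_cast; linarith
    let l : Fin N → ℕ := Function.update L i (L i - 1)
    have hul : upd l i = L := by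
      ext j
      by_cases hj : j = i
      · subst hj; simp [upd, l]; omega
      · simp [upd, l, hj]
    have hl : l ∈ SS N n := by
      rw [mem_SS]
      constructor
      · intro a b hab
        rcases hab.eq_or_lt with rfl | hab
        · exact le_rfl
        by_cases hai : a = i
        · subst hai
          simp only [l, Function.update_self, Function.update_of_ne hab.ne']
          have := hsucc b hab; omega
        · by_cases hbi : b = i
          · subst hbi
            simp only [l, Function.update_self, Function.update_of_ne hai]
            have := ha hab.le; omega
          · simp only [l, Function.update_of_ne hai, Function.update_of_ne hbi]
            exact ha hab.le
      · have := Finset.sum_erase_add univ L (mem_univ i)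
        rw [Finset.sum_update_of_mem (mem_univ i), Finset.sdiff_singleton_eq_erase]
        omega
    refine ⟨l, hl, ?_, hul⟩
    rw [key l hl, hul]; exact hne
  · intro l hl _
    exact key l hl

lemma SS_zero (N : ℕ) : SS N 0 = {0} := by
  ext l
  rw [mem_SS, mem_singleton]
  constructor
  · rintro ⟨_, h⟩
    ext i
    exact (Finset.sum_eq_zero_iff.1 h) i (mem_univ i)
  · rintro rfl
    exact ⟨fun _ _ _ => le_rfl, by simp⟩

lemma dl_zero (N : ℕ) : dl (XX (0 : Fin N → ℕ)) = sf N := by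
  rw [dl, Finset.prod_comm, sf]
  apply Finset.prod_congr rfl
  intro b _
  rw [← Finset.prod_filter]
  have hb := b.2
  have : ∏ a : Fin N with a < b, (XX (0 : Fin N → ℕ) a - XX (0 : Fin N → ℕ) b) = ∏ k ∈ range b, ((k + 1 : ℕ) : ℝ) := by
    refine Finset.prod_bij' (fun (a : Fin N) _ => (b : ℕ) - 1 - a) (fun (k : ℕ) hk => (⟨(b : ℕ) - 1 - k, by omega⟩ : Fin N)) ?_ ?_ ?_ ?_ ?_
    · intro a ha; simp at ha ⊢; have : (a:ℕ) < b := ha; omega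
    · intro k hk; simp at hk ⊢; show _ < (b : ℕ); simp; omega
    · intro a ha; simp at ha; have : (a:ℕ) < b := ha; ext; simp; omega
    · intro k hk; simp at hk ⊢; omega
    · intro a ha; simp at ha; have h : (a:ℕ) < b := ha
      have h2 : (b : ℕ) - 1 - a + 1 + a = b := by omega
      have h3 : (((b : ℕ) - 1 - a + 1 : ℕ) : ℝ) + (a : ℕ) = (b : ℕ) := by exact_mod_cast h2
      simp only [XX, Pi.zero_apply, Nat.cast_zero]
      linarith
  rw [this]
  rw [← Nat.cast_prod, Finset.prod_range_add_one_eq_factorial]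

lemma lf_zero (N : ℕ) : lf (0 : Fin N → ℕ) = sf N := by
  rw [lf, sf, ← Equiv.prod_comp Fin.revPerm]
  apply Finset.prod_congr rfl
  intro i _
  simp [Fin.rev]
  congr 1
  have := i.2; omega

lemma EE_zero (N : ℕ) (F : (Fin N → ℕ) → ℝ) : EE N 0 F = F 0 := by
  have := sf_pos N
  rw [EE, SS_zero, sum_singleton, WW, dl_zero, lf_zero]
  field_simp; simp

lemma rr_nonneg {N : ℕ} {l : Fin N → ℕ} (hl : Antitone l) (i : Fin N) : 0 ≤ rr (XX l) i := by
  apply Finset.prod_nonneg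
  intro j hj
  have hne := Finset.ne_of_mem_erase hj
  rcases lt_or_gt_of_ne hne with h | h
  · have := XX_anti hl h
    apply div_nonneg_of_nonpos <;> linarith
  · have := XX_anti hl h
    apply div_nonneg <;> linarith

lemma upd_anti_of_rr {N : ℕ} {l : Fin N → ℕ} (hl : Antitone l) (i : Fin N) (h : rr (XX l) i ≠ 0) :
    Antitone (upd l i) := by
  apply upd_anti hl
  rw [XX_upd, dl_up (XX_inj hl)]
  apply mul_ne_zero _ h
  rw [dl]
  simp only [Finset.prod_ne_zero_iff]
  intro a _ b _
  split_ifs with hab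
  · have := XX_anti hl hab; intro h; linarith
  · exact one_ne_zero

end BLS

namespace BLS
open Finset

def sl {n : ℕ} (lam : Nat.Partition n) : List ℕ := (lam.parts.sort (· ≤ ·)).reverse

lemma rowLen_eq {n : ℕ} (lam : Nat.Partition n) (i : ℕ) : rowLen lam i = (sl lam).getD (i-1) 0 := rfl

lemma sl_coe {n : ℕ} (lam : Nat.Partition n) : ((sl lam : List ℕ) : Multiset ℕ) = lam.parts := by
  rw [sl, Multiset.coe_reverse, Multiset.sort_eq]

lemma sl_len {n : ℕ} (lam : Nat.Partition n) : (sl lam).length = lam.parts.card := by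
  rw [← sl_coe, Multiset.coe_card]

lemma sl_sorted {n : ℕ} (lam : Nat.Partition n) : (sl lam).Pairwise (· ≥ ·) := by
  rw [sl, List.pairwise_reverse]
  exact Multiset.pairwise_sort lam.parts (· ≤ ·)

lemma sl_pos {n : ℕ} (lam : Nat.Partition n) {x : ℕ} (hx : x ∈ sl lam) : 0 < x := by
  apply lam.parts_pos
  rw [← sl_coe]; exact hx

lemma card_le {n : ℕ} (lam : Nat.Partition n) : lam.parts.card ≤ n := by
  have h := Multiset.card_nsmul_le_sum (s := lam.parts) (a := 1) (fun x hx => lam.parts_pos hx)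
  rw [lam.parts_sum] at h
  simpa using h

lemma rowLen_anti {n : ℕ} (lam : Nat.Partition n) {i j : ℕ} (hij : i ≤ j) : rowLen lam j ≤ rowLen lam i := by
  rw [rowLen_eq, rowLen_eq]
  by_cases hj : j - 1 < (sl lam).length
  · have hi : i - 1 < (sl lam).length := by omega
    rw [List.getD_eq_getElem _ _ hj, List.getD_eq_getElem _ _ hi]
    rcases (show i - 1 ≤ j - 1 by omega).eq_or_lt with h | h
    · simp [h]
    · exact (List.pairwise_iff_getElem.1 (sl_sorted lam)) _ _ hi hj h
  · rw [List.getD_eq_default _ _ (by omega)]; exact Nat.zero_le _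

lemma rowLen_pos_le {n : ℕ} (lam : Nat.Partition n) {i : ℕ} (h : 0 < rowLen lam i) : i ≤ lam.parts.card := by
  by_contra hc
  rw [rowLen_eq, List.getD_eq_default _ _ (by rw [sl_len]; omega)] at h
  omega

lemma rowLen_le {n : ℕ} (lam : Nat.Partition n) (i : ℕ) : rowLen lam i ≤ n := by
  rw [rowLen_eq]
  by_cases hj : i - 1 < (sl lam).length
  · rw [List.getD_eq_getElem _ _ hj]
    have : (sl lam)[i-1] ∈ lam.parts := by rw [← sl_coe]; exact List.getElem_mem hj
    have := Multiset.le_sum_of_mem this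
    rwa [lam.parts_sum] at this
  · rw [List.getD_eq_default _ _ (by omega)]; exact Nat.zero_le _

lemma col_iff {n : ℕ} (lam : Nat.Partition n) {i j : ℕ} (hi : 1 ≤ i) (hj : 1 ≤ j) :
    j ≤ rowLen lam i ↔ i ≤ colLen lam j := by
  constructor
  · intro h
    have hin : i ≤ n := (rowLen_pos_le lam (by omega : 0 < rowLen lam i)).trans (card_le lam)
    have : Icc 1 i ⊆ ((Finset.Icc 1 n).filter (fun i => j ≤ rowLen lam i)) := by
      intro k hk
      simp only [mem_Icc, mem_filter] at hk ⊢
      exact ⟨⟨hk.1, by omega⟩, h.trans (rowLen_anti lam hk.2)⟩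
    have := Finset.card_le_card this
    rw [Nat.card_Icc] at this
    rw [colLen]; omega
  · intro h
    by_contra hc
    have : ((Finset.Icc 1 n).filter (fun i => j ≤ rowLen lam i)) ⊆ Icc 1 (i-1) := by
      intro k hk
      simp only [mem_Icc, mem_filter] at hk ⊢
      refine ⟨hk.1.1, ?_⟩
      by_contra hki
      have := rowLen_anti lam (show i ≤ k by omega)
      omega
    have := Finset.card_le_card this
    rw [Nat.card_Icc] at this
    rw [colLen] at h; omega

def rows {n : ℕ} (N : ℕ) (lam : Nat.Partition n) : Fin N → ℕ := fun i => rowLen lam (i + 1)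

lemma rows_anti {n : ℕ} (N : ℕ) (lam : Nat.Partition n) : Antitone (rows N lam) := by
  intro a b hab
  exact rowLen_anti lam (by have : (a:ℕ) ≤ b := hab; omega)

lemma ofFn_rows {n N : ℕ} (lam : Nat.Partition n) (h : lam.parts.card ≤ N) :
    List.ofFn (rows N lam) = sl lam ++ List.replicate (N - (sl lam).length) 0 := by
  have hl : (sl lam).length ≤ N := by rw [sl_len]; exact h
  apply List.ext_getElem
  · simp; omega
  · intro i h1 h2
    simp only [List.getElem_ofFn, rows, rowLen_eq, Nat.add_sub_cancel]
    by_cases hi : i < (sl lam).length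
    · rw [List.getD_eq_getElem _ _ hi, List.getElem_append_left hi]
    · rw [List.getD_eq_default _ _ (by omega), List.getElem_append_right (by omega)]
      simp

lemma rows_mem {n N : ℕ} {lam : Nat.Partition n} (h : lam.parts.card ≤ N) : rows N lam ∈ SS N n := by
  rw [mem_SS]
  refine ⟨rows_anti N lam, ?_⟩
  rw [← List.sum_ofFn, ofFn_rows lam h]
  rw [List.sum_append, ← Multiset.sum_coe, sl_coe, lam.parts_sum]
  simp

lemma rows_inj {n N : ℕ} {lam mu : Nat.Partition n} (h : lam.parts.card ≤ N) (h' : mu.parts.card ≤ N)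
    (he : rows N lam = rows N mu) : lam = mu := by
  have key : ∀ nu : Nat.Partition n, nu.parts.card ≤ N →
      nu.parts = (((List.ofFn (rows N nu)).filter (fun x => decide (x ≠ 0)) : List ℕ) : Multiset ℕ) := by
    intro nu hnu
    rw [ofFn_rows nu hnu, List.filter_append, ← sl_coe]
    have h1 : (sl nu).filter (fun x => decide (x ≠ 0)) = sl nu := by
      rw [List.filter_eq_self]
      intro a ha
      have := sl_pos nu ha
      simp; omega
    have h2 : (List.replicate (N - (sl nu).length) 0).filter (fun x => decide (x ≠ 0)) = [] := by
      rw [List.filter_eq_nil_iff]; intro a ha; simp at ha; simp [ha]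
    rw [h1, h2, List.append_nil]
  apply Nat.Partition.ext
  rw [key lam h, key mu h', he]

lemma rows_surj {n N : ℕ} {l : Fin N → ℕ} (hl : l ∈ SS N n) : ∃ lam : Nat.Partition n, lam.parts.card ≤ N ∧ rows N lam = l := by
  obtain ⟨ha, hs⟩ := mem_SS.1 hl
  have hs' : ((List.ofFn l : List ℕ) : Multiset ℕ).sum = n := by
    rw [Multiset.sum_coe, List.sum_ofFn, hs]
  let lam := Nat.Partition.ofSums n (List.ofFn l : List ℕ) hs'
  have hp : lam.parts = Multiset.filter (fun x => x ≠ 0) (List.ofFn l : List ℕ) := rfl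
  have hc : lam.parts.card ≤ N := by
    rw [hp]
    refine (Multiset.card_le_card (Multiset.filter_le _ _)).trans ?_
    simp
  refine ⟨lam, hc, ?_⟩
  apply List.ofFn_injective
  have hperm : List.Perm (List.ofFn (rows N lam)) (List.ofFn l) := by
    rw [ofFn_rows lam hc, ← Multiset.coe_eq_coe, ← Multiset.coe_add, sl_coe, hp]
    conv_rhs => rw [← Multiset.filter_add_not (fun x => x ≠ 0) (List.ofFn l : Multiset ℕ)]
    congr 1
    have h0 : Multiset.filter (fun a => ¬ a ≠ 0) (↑(List.ofFn l) : Multiset ℕ) =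
       Multiset.replicate (Multiset.card (Multiset.filter (fun a => ¬ a ≠ 0) (↑(List.ofFn l) : Multiset ℕ))) 0 := by
      rw [Multiset.eq_replicate_card]
      intro b hb
      have := (Multiset.mem_filter.1 hb).2
      simpa using this
    rw [h0, Multiset.coe_replicate]
    congr 1
    have h3 := congrArg Multiset.card (Multiset.filter_add_not (fun x => x ≠ 0) (List.ofFn l : Multiset ℕ))
    rw [Multiset.card_add, ← hp, ← sl_len] at h3
    simp only [Multiset.coe_card, List.length_ofFn] at h3
    omega
  have sorted : ∀ f : Fin N → ℕ, Antitone f → (List.ofFn f).Pairwise (· ≥ ·) := by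
    intro f hf
    rw [List.pairwise_ofFn]
    intro i j hij
    exact hf hij.le
  exact hperm.eq_of_pairwise (fun a b _ _ h1 h2 => le_antisymm h2 h1) (sorted _ (rows_anti N lam)) (sorted _ ha)

lemma hook_row {n N : ℕ} (lam : Nat.Partition n) (h : lam.parts.card ≤ N) (i : Fin N) :
    (∏ j ∈ Icc 1 (rows N lam i), hookLen lam (i+1) j) *
      ∏ k ∈ Ioi i, ((rows N lam i - rows N lam k) + ((k:ℕ) - i)) = (rows N lam i + (N - 1 - i)).factorial := by
  set l := rows N lam with hl
  have hanti : Antitone l := rows_anti N lam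
  have hiff : ∀ k : Fin N, ∀ j, 1 ≤ j → (j ≤ l k ↔ (k:ℕ) + 1 ≤ colLen lam j) := by
    intro k j hj
    exact col_iff lam (by omega) hj
  have hcolle : ∀ j, 1 ≤ j → colLen lam j ≤ N := by
    intro j hj
    by_contra hc
    have := (col_iff lam (show 1 ≤ N + 1 by omega) hj).2 (by omega)
    have := rowLen_pos_le lam (show 0 < rowLen lam (N+1) by omega)
    omega
  have hcolanti : ∀ j j', 1 ≤ j → j ≤ j' → colLen lam j' ≤ colLen lam j := by
    intro j j' h1 h2
    apply Finset.card_le_card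
    intro x hx
    simp only [mem_filter] at hx ⊢
    exact ⟨hx.1, h2.trans hx.2⟩
  let A := (Icc 1 (l i)).image (fun j => hookLen lam (i+1) j)
  let B := (Ioi i).image (fun k : Fin N => (l i - l k) + ((k:ℕ) - i))
  have injA : Set.InjOn (fun j => hookLen lam (i+1) j) (Icc 1 (l i) : Finset ℕ) := by
    intro a ha b hb hab
    simp only [coe_Icc, Set.mem_Icc] at ha hb
    simp only [hookLen] at hab
    have ea : rowLen lam (i+1) = l i := rfl
    rw [ea] at hab
    have h1 := (hiff i a ha.1).1 ha.2
    have h2 := (hiff i b hb.1).1 hb.2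
    rcases lt_trichotomy a b with h | h | h
    · have := hcolanti a b ha.1 h.le; omega
    · exact h
    · have := hcolanti b a hb.1 h.le; omega
  have injB : Set.InjOn (fun k : Fin N => (l i - l k) + ((k:ℕ) - i)) (Ioi i : Finset (Fin N)) := by
    intro a ha b hb hab
    simp only [coe_Ioi, Set.mem_Ioi] at ha hb
    have h1 := hanti ha.le
    have h2 := hanti hb.le
    have h3 : (i:ℕ) < a := ha
    have h4 : (i:ℕ) < b := hb
    simp only at hab
    rcases lt_trichotomy a b with h | h | h
    · have := hanti h.le; have h5 : (a:ℕ) < b := h; omega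
    · exact h
    · have := hanti h.le; have h5 : (b:ℕ) < a := h; omega
  have disj : Disjoint A B := by
    rw [Finset.disjoint_left]
    intro x hxA hxB
    simp only [A, B, mem_image, mem_Icc, mem_Ioi] at hxA hxB
    obtain ⟨j, ⟨hj1, hj2⟩, hj⟩ := hxA
    obtain ⟨k, hk1, hk⟩ := hxB
    have h1 := (hiff i j hj1).1 hj2
    have ea : rowLen lam (i+1) = l i := rfl
    rw [hookLen, ea] at hj
    have h2 := hanti hk1.le
    have h3 : (i:ℕ) < k := hk1
    by_cases hjk : j ≤ l k
    · have := (hiff k j hj1).1 hjk; omega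
    · have : ¬ ((k:ℕ) + 1 ≤ colLen lam j) := fun h => hjk ((hiff k j hj1).2 h)
      omega
  have hU : A ∪ B = Icc 1 (l i + (N - 1 - i)) := by
    apply Finset.eq_of_subset_of_card_le
    · intro x hx
      rw [mem_union] at hx
      simp only [A, B, mem_image, mem_Icc, mem_Ioi] at hx ⊢
      rcases hx with ⟨j, ⟨hj1, hj2⟩, hj⟩ | ⟨k, hk1, hk⟩
      · have h1 := (hiff i j hj1).1 hj2
        have ea : rowLen lam (i+1) = l i := rfl
        rw [hookLen, ea] at hj
        have := hcolle j hj1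
        omega
      · have h3 : (i:ℕ) < k := hk1
        have := k.2
        omega
    · rw [Finset.card_union_of_disjoint disj, Finset.card_image_of_injOn injA, Finset.card_image_of_injOn injB]
      simp
  have hfac : ∀ m : ℕ, ∏ x ∈ Icc 1 m, x = m.factorial := by
    intro m
    induction m with
    | zero => simp
    | succ m ih => rw [Finset.prod_Icc_succ_top (by omega), ih, Nat.factorial_succ]; ring
  rw [← hfac, ← hU, Finset.prod_union disj, Finset.prod_image injA, Finset.prod_image injB]

lemma prod_cells {n N : ℕ} (lam : Nat.Partition n) (h : lam.parts.card ≤ N) (g : ℕ → ℕ → ℝ) :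
    ∏ p ∈ cellsOf lam, g p.1 p.2 = ∏ i : Fin N, ∏ j ∈ Icc 1 (rows N lam i), g (i+1) j := by
  rw [Finset.prod_sigma']
  symm
  refine Finset.prod_bij (fun x _ => ((x.1 : ℕ) + 1, x.2)) ?_ ?_ ?_ ?_
  · rintro ⟨i, j⟩ hx
    simp only [mem_sigma, mem_univ, true_and, mem_Icc] at hx
    simp only [cellsOf, mem_filter, mem_product, mem_Icc]
    have h1 : j ≤ rowLen lam (i+1) := hx.2
    have h2 := rowLen_le lam (i+1)
    have h3 := rowLen_pos_le lam (show 0 < rowLen lam (i+1) by omega)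
    have h4 := card_le lam
    omega
  · rintro ⟨i, j⟩ _ ⟨i', j'⟩ _ heq
    simp only [Prod.mk.injEq] at heq
    obtain ⟨h1, h2⟩ := heq
    have : i = i' := by ext; omega
    subst this; subst h2; rfl
  · rintro ⟨a, b⟩ hab
    simp only [cellsOf, mem_filter, mem_product, mem_Icc] at hab
    have h3 := rowLen_pos_le lam (show 0 < rowLen lam a by omega)
    have ea : a - 1 + 1 = a := by omega
    refine ⟨⟨⟨a - 1, by omega⟩, b⟩, ?_, ?_⟩
    · simp only [mem_sigma, mem_univ, true_and, mem_Icc, rows]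
      rw [ea]; exact ⟨hab.1.2.1, hab.2⟩
    · simp only [ea]
  · rintro ⟨i, j⟩ _; rfl

lemma sum_cells {n N : ℕ} (lam : Nat.Partition n) (h : lam.parts.card ≤ N) (g : ℕ → ℕ → ℝ) :
    ∑ p ∈ cellsOf lam, g p.1 p.2 = ∑ i : Fin N, ∑ j ∈ Icc 1 (rows N lam i), g (i+1) j := by
  have := prod_cells lam h (fun a b => Real.exp (g a b))
  simp only [← Real.exp_sum] at this
  exact Real.exp_injective this

lemma dl_rows {N : ℕ} (l : Fin N → ℕ) (hl : Antitone l) :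
    dl (XX l) = ∏ i, ∏ k ∈ Ioi i, (((l i - l k) + ((k:ℕ) - i) : ℕ) : ℝ) := by
  rw [dl]
  apply Finset.prod_congr rfl
  intro i _
  rw [← Finset.prod_filter]
  have : univ.filter (fun b => i < b) = Ioi i := by ext; simp
  rw [this]
  apply Finset.prod_congr rfl
  intro k hk
  have hk : i < k := by simpa using hk
  have h1 := hl hk.le
  have h3 : (i:ℕ) < k := hk
  rw [Nat.cast_add, Nat.cast_sub h1, Nat.cast_sub h3.le]
  simp only [XX]; ring

lemma PNN_eq {n N : ℕ} (lam : Nat.Partition n) (h : lam.parts.card ≤ N) :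
    PNN n N lam = WW N n (rows N lam) := by
  have h1 : (∏ p ∈ cellsOf lam, (hookLen lam p.1 p.2 : ℝ)) * dl (XX (rows N lam)) = lf (rows N lam) := by
    rw [prod_cells lam h (fun a b => (hookLen lam a b : ℝ)), dl_rows _ (rows_anti N lam), ← Finset.prod_mul_distrib, lf]
    apply Finset.prod_congr rfl
    intro i _
    rw [← hook_row lam h i]; push_cast; rfl
  have h2 : (∏ p ∈ cellsOf lam, ((N : ℝ) + (p.2 : ℝ) - (p.1 : ℝ))) * sf N = lf (rows N lam) := by
    rw [prod_cells lam h (fun a b => ((N : ℝ) + (b : ℝ) - (a : ℝ))), ← lf_zero, lf, lf, ← Finset.prod_mul_distrib]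
    apply Finset.prod_congr rfl
    intro i _
    have key : ∀ m b : ℕ, (∏ j ∈ Icc 1 m, ((b:ℝ) + j)) * (b.factorial : ℝ) = ((m + b).factorial : ℝ) := by
      intro m b
      induction m with
      | zero => simp
      | succ m ih =>
        rw [Finset.prod_Icc_succ_top (by omega), mul_right_comm, ih]
        have : m + 1 + b = (m + b) + 1 := by ring
        rw [this, Nat.factorial_succ]; push_cast; ring
    have hb : ((N - 1 - i : ℕ) : ℝ) = (N : ℝ) - ((i : ℕ) + 1 : ℕ) := by
      have hi : N - 1 - i + (i + 1) = N := by have := i.2; omega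
      have : ((N - 1 - i : ℕ) : ℝ) + ((i : ℕ) + 1 : ℕ) = N := by exact_mod_cast hi
      linarith
    rw [← key (rows N lam i) (N - 1 - i)]
    simp only [Pi.zero_apply, zero_add, hb]
    congr 1
    apply Finset.prod_congr rfl
    intros; ring
  have hsf := sf_pos N
  have hlf := lf_pos (rows N lam)
  have hd : dl (XX (rows N lam)) ≠ 0 := by
    intro h0; rw [h0, mul_zero] at h1; exact hlf.ne h1
  rw [PNN, dimE, WW]
  have e1 : (∏ p ∈ cellsOf lam, (hookLen lam p.1 p.2 : ℝ)) = lf (rows N lam) / dl (XX (rows N lam)) := by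
    rw [eq_div_iff hd, h1]
  have e2 : (∏ p ∈ cellsOf lam, ((N : ℝ) + (p.2 : ℝ) - (p.1 : ℝ))) = lf (rows N lam) / sf N := by
    rw [eq_div_iff hsf.ne', h2]
  rw [e1, e2]
  field_simp

lemma sum_PNN {n N : ℕ} (p : Nat.Partition n → Prop) (p' : (Fin N → ℕ) → Prop)
    (hp : ∀ lam : Nat.Partition n, lam.parts.card ≤ N → (p lam ↔ p' (rows N lam))) :
    ∑ lam ∈ (YNN n N).filter p, PNN n N lam = EE N n (fun l => if p' l then 1 else 0) := by
  rw [EE]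
  simp only [mul_ite, mul_one, mul_zero]
  rw [← Finset.sum_filter]
  refine Finset.sum_bij (fun lam _ => rows N lam) ?_ ?_ ?_ ?_
  · intro lam h
    simp only [mem_filter, YNN, mem_univ, true_and] at h
    rw [mem_filter]
    exact ⟨rows_mem h.1, (hp lam h.1).1 h.2⟩
  · intro lam h mu h' he
    simp only [mem_filter, YNN, mem_univ, true_and] at h h'
    exact rows_inj h.1 h'.1 he
  · intro l hl
    rw [mem_filter] at hl
    obtain ⟨lam, h1, h2⟩ := rows_surj hl.1
    refine ⟨lam, ?_, h2⟩
    simp only [mem_filter, YNN, mem_univ, true_and]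
    exact ⟨h1, (hp lam h1).2 (h2 ▸ hl.2)⟩
  · intro lam h
    simp only [mem_filter, YNN, mem_univ, true_and] at h
    exact PNN_eq lam h.1

end BLS

namespace BLS
open Finset

lemma QQ_mono {N : ℕ} {l : Fin N → ℕ} (hl : Antitone l) {f g : Fin N → ℝ} (h : ∀ i, f i ≤ g i) :
    QQ l f ≤ QQ l g := by
  unfold QQ
  apply div_le_div_of_nonneg_right _ (Nat.cast_nonneg N)
  exact Finset.sum_le_sum (fun i _ => mul_le_mul_of_nonneg_left (h i) (rr_nonneg hl i))

lemma QQ_add {N : ℕ} (l : Fin N → ℕ) (f g : Fin N → ℝ) :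
    QQ l (fun i => f i + g i) = QQ l f + QQ l g := by
  simp only [QQ, mul_add, Finset.sum_add_distrib, add_div]

lemma QQ_smul {N : ℕ} (l : Fin N → ℕ) (a : ℝ) (f : Fin N → ℝ) :
    QQ l (fun i => a * f i) = a * QQ l f := by
  simp only [QQ, mul_left_comm, ← Finset.mul_sum, mul_div_assoc]

lemma QQ_sub {N : ℕ} (l : Fin N → ℕ) (f g : Fin N → ℝ) :
    QQ l (fun i => f i - g i) = QQ l f - QQ l g := by
  simp only [QQ, mul_sub, Finset.sum_sub_distrib, sub_div]

lemma QQ_sum {N : ℕ} {ι : Type*} (s : Finset ι) (l : Fin N → ℕ) (f : ι → Fin N → ℝ) :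
    QQ l (fun i => ∑ j ∈ s, f j i) = ∑ j ∈ s, QQ l (f j) := by
  simp only [QQ, Finset.mul_sum, ← Finset.sum_div]
  rw [Finset.sum_comm]

lemma QQ_const {N : ℕ} (hN : 0 < N) {l : Fin N → ℕ} (hl : Antitone l) (a : ℝ) :
    QQ l (fun _ => a) = a := by
  have hN' : (N : ℝ) ≠ 0 := by positivity
  rw [QQ, ← Finset.sum_mul, rr_sum _ (XX_inj hl)]
  field_simp

lemma QQ_congr {N : ℕ} {l : Fin N → ℕ} {f g : Fin N → ℝ}
    (h : ∀ i, rr (XX l) i ≠ 0 → f i = g i) : QQ l f = QQ l g := by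
  unfold QQ
  congr 1
  apply Finset.sum_congr rfl
  intro i _
  by_cases hr : rr (XX l) i = 0
  · simp [hr]
  · rw [h i hr]

lemma QQ_abs {N : ℕ} {l : Fin N → ℕ} (hl : Antitone l) {f g : Fin N → ℝ} (h : ∀ i, |f i| ≤ g i) :
    |QQ l f| ≤ QQ l g := by
  rw [abs_le]
  constructor
  · have := QQ_mono hl (f := fun i => (-1) * g i) (g := f) (fun i => by have := neg_abs_le (f i); have := h i; linarith)
    rw [QQ_smul] at this; linarith
  · exact QQ_mono hl (fun i => (le_abs_self _).trans (h i))

lemma EE_mono {N n : ℕ} {F G : (Fin N → ℕ) → ℝ} (h : ∀ l, Antitone l → F l ≤ G l) :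
    EE N n F ≤ EE N n G :=
  Finset.sum_le_sum (fun l hl => mul_le_mul_of_nonneg_left (h l (mem_SS.1 hl).1) (WW_nonneg _ _ _))

lemma EE_congr {N n : ℕ} {F G : (Fin N → ℕ) → ℝ} (h : ∀ l, Antitone l → F l = G l) :
    EE N n F = EE N n G :=
  Finset.sum_congr rfl (fun l hl => by rw [h l (mem_SS.1 hl).1])

lemma EE_add {N n : ℕ} (F G : (Fin N → ℕ) → ℝ) :
    EE N n (fun l => F l + G l) = EE N n F + EE N n G := by
  simp only [EE, mul_add, Finset.sum_add_distrib]

lemma EE_smul {N n : ℕ} (a : ℝ) (F : (Fin N → ℕ) → ℝ) :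
    EE N n (fun l => a * F l) = a * EE N n F := by
  simp only [EE, mul_left_comm, ← Finset.mul_sum]

lemma EE_one {N : ℕ} (hN : 0 < N) (n : ℕ) : EE N n (fun _ => 1) = 1 := by
  induction n with
  | zero => rw [EE_zero]
  | succ n ih =>
    rw [EE_succ]
    refine Eq.trans ?_ ih
    exact EE_congr (fun l hl => QQ_const hN hl 1)

lemma EE_const {N : ℕ} (hN : 0 < N) (n : ℕ) (a : ℝ) : EE N n (fun _ => a) = a := by
  have := EE_smul (N := N) (n := n) a (fun _ => 1)
  rw [EE_one hN] at this; simpa using this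

lemma EE_nonneg {N n : ℕ} {F : (Fin N → ℕ) → ℝ} (h : ∀ l, Antitone l → 0 ≤ F l) :
    0 ≤ EE N n F :=
  Finset.sum_nonneg (fun l hl => mul_nonneg (WW_nonneg _ _ _) (h l (mem_SS.1 hl).1))

lemma EE_cs {N n : ℕ} (F G : (Fin N → ℕ) → ℝ) :
    (EE N n (fun l => F l * G l))^2 ≤ EE N n (fun l => F l ^ 2) * EE N n (fun l => G l ^ 2) := by
  unfold EE
  apply Finset.sum_sq_le_sum_mul_sum_of_sq_le_mul
  · intro l _; exact mul_nonneg (WW_nonneg _ _ _) (sq_nonneg _)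
  · intro l _; exact mul_nonneg (WW_nonneg _ _ _) (sq_nonneg _)
  · intro l _; apply le_of_eq; ring

/-- discrete Gronwall -/
lemma gron {n : ℕ} (u : ℕ → ℝ) (C : ℝ) (hC : 0 ≤ C) (h0 : 0 ≤ u 0) (hn : 1 ≤ n)
    (h : ∀ m < n, u (m+1) ≤ (1 + C / n) * u m) : ∀ m ≤ n, u m ≤ Real.exp C * u 0 := by
  have hn' : (0:ℝ) < n := by exact_mod_cast hn
  have key : ∀ m ≤ n, u m ≤ (1 + C/n)^m * u 0 := by
    intro m
    induction m with
    | zero => intro _; simp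
    | succ m ih =>
      intro hm
      calc u (m+1) ≤ (1 + C / n) * u m := h m (by omega)
        _ ≤ (1 + C/n) * ((1 + C/n)^m * u 0) := by
            apply mul_le_mul_of_nonneg_left (ih (by omega)); positivity
        _ = _ := by ring
  intro m hm
  refine (key m hm).trans (mul_le_mul_of_nonneg_right ?_ h0)
  calc (1 + C/n)^m ≤ (1 + C/n)^n := pow_le_pow_right₀ (by have : 0 ≤ C/n := by positivity
                                                          linarith) hm
    _ ≤ (Real.exp (C/n))^n := by
        apply pow_le_pow_left₀ (by positivity)
        have := Real.add_one_le_exp (C/n); linarith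
    _ = Real.exp C := by rw [← Real.exp_nat_mul]; congr 1; field_simp

/-- scaled difference -/
def vt (h : ℝ) (s : ℕ) (x : ℝ) : ℝ := ((x + h)^s - (x - h)^s) / (2 * h)

lemma vt_bd (h : ℝ) (h0 : 0 < h) (h1 : h ≤ 1) (x : ℝ) (s : ℕ) :
    |((x+h)^s + (x-h)^s)/2| ≤ (1+|x|)^s ∧ |vt h s x| ≤ s * (1+|x|)^s ∧
    |((x+h)^s + (x-h)^s)/2 - x^s| ≤ h * s^2 * (1+|x|)^s ∧
    |vt h s x - s * x^(s-1)| ≤ h * s^3 * (1+|x|)^s := by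
  set w := 1 + |x| with hw
  have hxw : |x| ≤ w := by linarith
  have hw1 : 1 ≤ w := by have := abs_nonneg x; linarith
  have hu : ∀ s : ℕ, |((x+h)^s + (x-h)^s)/2| ≤ w^s := by
    intro s
    have a1 : |x+h| ≤ w := by rw [hw]; refine (abs_add_le _ _).trans ?_; rw [abs_of_pos h0]; linarith
    have a2 : |x-h| ≤ w := by rw [hw]; refine (abs_sub _ _).trans ?_; rw [abs_of_pos h0]; linarith
    rw [abs_div, abs_of_pos (by norm_num : (0:ℝ) < 2)]
    have b1 : |(x+h)^s| ≤ w^s := by rw [abs_pow]; exact pow_le_pow_left₀ (abs_nonneg _) a1 s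
    have b2 : |(x-h)^s| ≤ w^s := by rw [abs_pow]; exact pow_le_pow_left₀ (abs_nonneg _) a2 s
    have := abs_add_le ((x+h)^s) ((x-h)^s)
    linarith
  refine ⟨hu s, ?_⟩
  have hv : ∀ s, vt h (s+1) x = x * vt h s x + ((x+h)^s + (x-h)^s)/2 := by
    intro s; simp only [vt]; field_simp; ring
  have huu : ∀ s, ((x+h)^(s+1) + (x-h)^(s+1))/2 = x * (((x+h)^s + (x-h)^s)/2) + h^2 * vt h s x := by
    intro s; simp only [vt]; field_simp; ring
  induction s with
  | zero => simp [vt]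
  | succ s ih =>
    obtain ⟨i1, i2, i3⟩ := ih
    have wp : 0 < w^s := by positivity
    have e1 : w^(s+1) = w * w^s := by ring
    have wle : w^s ≤ w * w^s := by nlinarith
    refine ⟨?_, ?_, ?_⟩
    · rw [hv]
      refine (abs_add_le _ _).trans ?_
      rw [abs_mul]
      have : |x| * |vt h s x| ≤ w * (s * w^s) := mul_le_mul hxw i1 (abs_nonneg _) (by linarith)
      have := hu s
      rw [e1]; push_cast; nlinarith
    · have : ((x+h)^(s+1) + (x-h)^(s+1))/2 - x^(s+1) = x * (((x+h)^s + (x-h)^s)/2 - x^s) + h^2 * vt h s x := by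
        rw [huu]; ring
      rw [this]
      refine (abs_add_le _ _).trans ?_
      rw [abs_mul, abs_mul, abs_of_nonneg (sq_nonneg h)]
      have t1 : |x| * |((x+h)^s + (x-h)^s)/2 - x^s| ≤ w * (h * s^2 * w^s) := mul_le_mul hxw i2 (abs_nonneg _) (by linarith)
      have t2 : h^2 * |vt h s x| ≤ h * (s * (w*w^s)) := by
        have : h^2 ≤ h := by nlinarith
        apply mul_le_mul this (i1.trans _) (abs_nonneg _) h0.le
        apply mul_le_mul_of_nonneg_left wle (by positivity)
      have t3 : 0 ≤ h * (w * w^s) := by positivity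
      have t4 : (0:ℝ) ≤ s := by positivity
      rw [e1]; push_cast; nlinarith
    · have : vt h (s+1) x - ((s+1 : ℕ):ℝ) * x^(s+1-1) = x * (vt h s x - s * x^(s-1)) + (((x+h)^s + (x-h)^s)/2 - x^s) := by
        rw [hv]
        cases s with
        | zero => simp
        | succ s => simp; ring
      rw [this]
      refine (abs_add_le _ _).trans ?_
      rw [abs_mul]
      have t1 : |x| * |vt h s x - s * x^(s-1)| ≤ w * (h * s^3 * w^s) := mul_le_mul hxw i3 (abs_nonneg _) (by linarith)
      have t2 : h * s^2 * w^s ≤ h * s^2 * (w*w^s) := mul_le_mul_of_nonneg_left wle (by positivity)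
      have t3 : 0 ≤ h * (w * w^s) := by positivity
      have t4 : (0:ℝ) ≤ s := by positivity
      have t5 : 0 ≤ h * (w * w^s) * (2 * s^2 + 3 * s + 1) := by positivity
      rw [e1]; push_cast; nlinarith

/-- scaled moments -/
def xi {N : ℕ} (n : ℕ) (l : Fin N → ℕ) (i : Fin N) : ℝ := XX l i / Real.sqrt n
def al {N : ℕ} (n : ℕ) (k : ℕ) (l : Fin N → ℕ) : ℝ := QQ l (fun i => xi n l i ^ k)
def MM {N : ℕ} (n : ℕ) (K : ℕ) (l : Fin N → ℕ) : ℝ := QQ l (fun i => (1 + |xi n l i|) ^ K)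

lemma MM_one_le {N : ℕ} (hN : 0 < N) (n K : ℕ) {l : Fin N → ℕ} (hl : Antitone l) : 1 ≤ MM n K l := by
  rw [← QQ_const hN hl 1]
  apply QQ_mono hl
  intro i
  exact one_le_pow₀ (by have := abs_nonneg (xi n l i); linarith)

lemma MM_mono {N : ℕ} (n : ℕ) {K L : ℕ} (h : K ≤ L) {l : Fin N → ℕ} (hl : Antitone l) :
    MM n K l ≤ MM n L l := by
  apply QQ_mono hl
  intro i
  exact pow_le_pow_right₀ (by have := abs_nonneg (xi n l i); linarith) h

lemma MM_mul {N : ℕ} (hN : 0 < N) (n a b : ℕ) {l : Fin N → ℕ} (hl : Antitone l) :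
    MM n a l * MM n b l ≤ 2 * MM n (a+b) l := by
  have e : MM n a l * MM n b l = QQ l (fun i => QQ l (fun j => (1 + |xi n l i|)^a * (1+|xi n l j|)^b)) := by
    simp only [QQ_smul]
    simp only [mul_comm _ (QQ l _)]
    rw [QQ_smul, mul_comm]; rfl
  have e2 : 2 * MM n (a+b) l = QQ l (fun i => QQ l (fun j => (1 + |xi n l i|)^(a+b) + (1+|xi n l j|)^(a+b))) := by
    simp only [QQ_add, QQ_const hN hl]
    unfold MM; ring
  rw [e, e2]
  apply QQ_mono hl; intro i
  apply QQ_mono hl; intro j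
  have ha : 1 ≤ 1 + |xi n l i| := by have := abs_nonneg (xi n l i); linarith
  have hb : 1 ≤ 1 + |xi n l j| := by have := abs_nonneg (xi n l j); linarith
  generalize 1 + |xi n l i| = A at *
  generalize 1 + |xi n l j| = B at *
  rcases le_total A B with h | h
  · calc A^a * B^b ≤ B^a * B^b := by gcongr
      _ = B^(a+b) := by ring
      _ ≤ _ := by have : 0 ≤ A^(a+b) := by positivity
                  linarith
  · calc A^a * B^b ≤ A^a * A^b := by gcongr
      _ = A^(a+b) := by ring
      _ ≤ _ := by have : 0 ≤ B^(a+b) := by positivity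
                  linarith

lemma al_le {N : ℕ} (n k : ℕ) {l : Fin N → ℕ} (hl : Antitone l) : |al n k l| ≤ MM n k l := by
  apply QQ_abs hl
  intro i
  rw [abs_pow]
  exact pow_le_pow_left₀ (abs_nonneg _) (by linarith) k

lemma al_aa {N : ℕ} (n k : ℕ) (l : Fin N → ℕ) : al n k l = aa (XX l) k / (Real.sqrt n)^k := by
  simp only [al, QQ, aa, xi, div_pow]
  rw [div_right_comm]
  congr 1
  rw [Finset.sum_div]
  apply Finset.sum_congr rfl; intros; ring

lemma al_zero {N : ℕ} (hN : 0 < N) (n : ℕ) {l : Fin N → ℕ} (hl : Antitone l) : al n 0 l = 1 := by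
  simp only [al, pow_zero]; exact QQ_const hN hl 1

/-- increment of `al` -/
def DD {N : ℕ} (n k : ℕ) (l : Fin N → ℕ) (i : Fin N) : ℝ :=
  (Real.sqrt n / N) * vt (1 / Real.sqrt n) (k+1) (xi n l i) +
    ∑ p ∈ antidiagonal k, al n p.1 l * vt (1 / Real.sqrt n) p.2 (xi n l i)

lemma al_upd {N : ℕ} (hN : 0 < N) (n k : ℕ) (hn : 1 ≤ n) {l : Fin N → ℕ} (hl : Antitone l) (i : Fin N)
    (hr : rr (XX l) i ≠ 0) : al n (k+1) (upd l i) = al n (k+1) l + DD n k l i / n := by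
  have hl' := upd_anti_of_rr hl i hr
  have hX := XX_inj hl
  have hX' := XX_inj hl'
  rw [XX_upd] at hX'
  have := aa_update hN (XX l) hX i hX' k
  rw [al_aa, al_aa, XX_upd, this]
  have hs : 0 < Real.sqrt n := Real.sqrt_pos.2 (by exact_mod_cast hn)
  have hdn : ∀ x : ℝ, x / (n:ℝ) = x / Real.sqrt n ^ 2 := fun x => by rw [Real.sq_sqrt (by positivity)]
  have hN' : (N:ℝ) ≠ 0 := by positivity
  have hvt : ∀ s, vt (1 / Real.sqrt n) s (xi n l i) = Real.sqrt n * vv s (XX l i) / Real.sqrt n ^ s := by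
    intro s
    simp only [vt, vv, xi, ← add_div, ← sub_div, div_pow]
    field_simp
  unfold DD
  rw [add_div, add_div, add_assoc]
  congr 1
  rw [add_div]
  congr 1
  · rw [hvt]; rw [hdn]; field_simp
  · rw [Finset.sum_div, Finset.sum_div]
    apply Finset.sum_congr rfl
    rintro ⟨a, b⟩ hp
    rw [HasAntidiagonal.mem_antidiagonal] at hp
    simp only at hp ⊢
    rw [hvt, al_aa, ← hp]; rw [hdn]; field_simp; try ring

end BLS

namespace BLS
open Finset

lemma inv_sqrt_le {n : ℕ} (hn : 1 ≤ n) : 0 < 1 / Real.sqrt n ∧ 1 / Real.sqrt n ≤ 1 := by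
  have h1 : (1:ℝ) ≤ n := by exact_mod_cast hn
  have h2 : 1 ≤ Real.sqrt n := Real.one_le_sqrt.2 h1
  constructor
  · positivity
  · rw [div_le_one (by linarith)]; exact h2

lemma vt_le {N : ℕ} {n : ℕ} (hn : 1 ≤ n) (s : ℕ) (l : Fin N → ℕ) (i : Fin N) :
    |vt (1 / Real.sqrt n) s (xi n l i)| ≤ s * (1 + |xi n l i|)^s :=
  (vt_bd _ (inv_sqrt_le hn).1 (inv_sqrt_le hn).2 _ s).2.1

lemma QQvt_le {N : ℕ} {n : ℕ} (hn : 1 ≤ n) (s : ℕ) {l : Fin N → ℕ} (hl : Antitone l) :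
    |QQ l (fun i => vt (1 / Real.sqrt n) s (xi n l i))| ≤ s * MM n s l := by
  rw [MM, ← QQ_smul]
  exact QQ_abs hl (fun i => vt_le hn s l i)

lemma QQDD {N : ℕ} (n k : ℕ) (l : Fin N → ℕ) : QQ l (DD n k l) =
    (Real.sqrt n / N) * QQ l (fun i => vt (1 / Real.sqrt n) (k+1) (xi n l i)) +
    ∑ p ∈ antidiagonal k, al n p.1 l * QQ l (fun i => vt (1 / Real.sqrt n) p.2 (xi n l i)) := by
  unfold DD
  rw [QQ_add, QQ_smul, QQ_sum]
  simp only [QQ_smul]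

lemma QQDD_le {N : ℕ} (hN : 0 < N) {n : ℕ} (hn : 1 ≤ n) (k : ℕ) {l : Fin N → ℕ} (hl : Antitone l) {K0 : ℝ}
    (hK : Real.sqrt n / N ≤ K0) : QQ l (DD n k l) ≤ (K0 * (k+1) + 2 * k * (k+1)) * MM n (k+1) l := by
  rw [QQDD, add_mul]
  have hM := MM_one_le hN n (k+1) hl
  apply add_le_add
  · have h1 := (le_abs_self _).trans (QQvt_le hn (k+1) hl)
    push_cast at h1
    calc _ ≤ Real.sqrt n / N * ((k+1) * MM n (k+1) l) := mul_le_mul_of_nonneg_left h1 (by positivity)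
      _ ≤ K0 * ((k+1) * MM n (k+1) l) := mul_le_mul_of_nonneg_right hK (by positivity)
      _ = _ := by ring
  · calc _ ≤ ∑ p ∈ antidiagonal k, 2 * k * MM n (k+1) l := by
          apply Finset.sum_le_sum
          rintro ⟨p, q⟩ hp
          rw [HasAntidiagonal.mem_antidiagonal] at hp
          simp only at hp ⊢
          have a1 := al_le n p hl
          have a2 := QQvt_le hn q hl
          have a3 := MM_mul hN n p q hl
          have a4 := MM_mono n (show p + q ≤ k + 1 by omega) hl
          have a5 := MM_one_le hN n p hl
          have a6 := MM_one_le hN n q hl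
          have a7 : (q:ℝ) ≤ k := by exact_mod_cast (by omega : q ≤ k)
          calc _ ≤ |al n p l| * |QQ l (fun i => vt (1 / Real.sqrt n) q (xi n l i))| := by
                rw [← abs_mul]; exact le_abs_self _
            _ ≤ MM n p l * (q * MM n q l) := by gcongr
            _ = q * (MM n p l * MM n q l) := by ring
            _ ≤ k * (2 * MM n (k+1) l) := by
                apply mul_le_mul a7 _ (by positivity) (by positivity)
                linarith
            _ = _ := by ring
      _ = _ := by rw [Finset.sum_const, Finset.Nat.card_antidiagonal]; simp; ring

lemma MM_al {N : ℕ} (hN : 0 < N) (n k : ℕ) (hk : Even k) {l : Fin N → ℕ} (hl : Antitone l) :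
    MM n k l ≤ 2^k * (1 + al n k l) := by
  have : 2^k * (1 + al n k l) = QQ l (fun i => 2^k * (1 + xi n l i ^k)) := by
    rw [QQ_smul, QQ_add, QQ_const hN hl]; rfl
  rw [this]
  apply QQ_mono hl
  intro i
  rw [← hk.pow_abs (xi n l i)]
  have h0 := abs_nonneg (xi n l i)
  generalize |xi n l i| = x at *
  rcases le_total x 1 with h | h
  · calc (1+x)^k ≤ 2^k := pow_le_pow_left₀ (by linarith) (by linarith) k
      _ ≤ _ := by have : 0 ≤ (2:ℝ)^k * x^k := by positivity
                  linarith
  · calc (1+x)^k ≤ (2*x)^k := pow_le_pow_left₀ (by linarith) (by linarith) k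
      _ = 2^k * x^k := by ring
      _ ≤ _ := by have : 0 < (2:ℝ)^k := by positivity
                  linarith

lemma xi_zero {N : ℕ} (n : ℕ) {i : Fin N} (h : rr (XX (0 : Fin N → ℕ)) i ≠ 0) : xi n (0 : Fin N → ℕ) i = 0 := by
  have h2 := upd_anti_of_rr (l := (0 : Fin N → ℕ)) (fun _ _ _ => le_rfl) i h
  have h3 : (i : ℕ) = 0 := by
    by_contra hi
    have hlt : (⟨0, by have := i.2; omega⟩ : Fin N) < i := by
      show (0:ℕ) < i
      omega
    have := h2 hlt.le
    rw [upd, Function.update_self, Function.update_of_ne hlt.ne] at this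
    simp at this
  simp [xi, XX, h3]

lemma al_at_zero {N : ℕ} (n k : ℕ) : al n (k+1) (0 : Fin N → ℕ) = 0 := by
  rw [al, QQ_congr (g := fun _ => 0)]
  · simp [QQ]
  · intro i hi; rw [xi_zero n hi]; simp

lemma MM_bd (N : ℕ → ℕ) (hN : ∀ n, 0 < N n) (K0 : ℝ) (hK : ∀ n : ℕ, Real.sqrt n / N n ≤ K0) (K : ℕ) :
    ∃ C, ∀ n ≥ 1, ∀ m ≤ n, EE (N n) m (MM n K) ≤ C := by
  obtain ⟨k, hk⟩ : ∃ k, k = 2 * K + 1 := ⟨_, rfl⟩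
  have hev : Even (k+1) := by rw [hk]; exact ⟨K+1, by ring⟩
  have hK0 : 0 ≤ K0 := le_trans (by positivity) (hK 1)
  set A : ℝ := (K0 * (k+1) + 2 * k * (k+1)) with hA
  have hA0 : 0 ≤ A := by positivity
  refine ⟨2^(k+1) * Real.exp (A * 2^(k+1)), ?_⟩
  intro n hn m hm
  have hn' : (0:ℝ) < n := by exact_mod_cast hn
  have step : ∀ m < n, 1 + EE (N n) (m+1) (al n (k+1)) ≤
      (1 + (A * 2^(k+1))/n) * (1 + EE (N n) m (al n (k+1))) := by
    intro m _
    rw [EE_succ]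
    calc _ ≤ 1 + EE (N n) m (fun l => al n (k+1) l + (A * 2^(k+1)/n) * (1 + al n (k+1) l)) := by
          gcongr
          apply EE_mono
          intro l hl
          rw [QQ_congr (fun i hi => al_upd (hN n) n k hn hl i hi), QQ_add, QQ_const (hN n) hl]
          gcongr
          have : QQ l (fun i => DD n k l i / n) = QQ l (DD n k l) / n := by
            simp only [div_eq_inv_mul, QQ_smul]
          rw [this, div_mul_eq_mul_div, div_le_div_iff_of_pos_right hn']
          refine (QQDD_le (hN n) hn k hl (hK n)).trans ?_
          rw [mul_assoc A]
          exact mul_le_mul_of_nonneg_left (MM_al (hN n) n (k+1) hev hl) hA0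
      _ = _ := by
          rw [EE_add, EE_smul, EE_add, EE_one (hN n)]; ring
  have g := gron (fun m => 1 + EE (N n) m (al n (k+1))) (A * 2^(k+1)) (by positivity)
    (by simp only [EE_zero, al_at_zero]; norm_num) hn step m hm
  simp only [EE_zero, al_at_zero] at g
  calc EE (N n) m (MM n K) ≤ EE (N n) m (fun l => 2^(k+1) * (1 + al n (k+1) l)) := by
        apply EE_mono
        intro l hl
        exact (MM_mono n (by omega) hl).trans (MM_al (hN n) n (k+1) hev hl)
    _ = 2^(k+1) * (1 + EE (N n) m (al n (k+1))) := by rw [EE_smul, EE_add, EE_one (hN n)]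
    _ ≤ _ := by
        apply mul_le_mul_of_nonneg_left _ (by positivity)
        linarith

def Conv (N : ℕ → ℕ) (F : (n : ℕ) → (Fin (N n) → ℕ) → ℝ) (φ : Polynomial ℝ) : Prop :=
  ∃ δ : ℕ → ℝ, Tendsto δ atTop (𝓝 0) ∧ ∀ n ≥ 1, ∀ m ≤ n,
    EE (N n) m (fun l => (F n l - φ.eval ((m:ℝ)/n))^2) ≤ δ n

def Dom (N : ℕ → ℕ) (F : (n : ℕ) → (Fin (N n) → ℕ) → ℝ) : Prop :=
  ∃ C : ℝ, ∃ K : ℕ, 0 ≤ C ∧ ∀ n ≥ 1, ∀ l, Antitone l → |F n l| ≤ C * MM n K l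

lemma Dom.add {N : ℕ → ℕ} {F G : (n : ℕ) → (Fin (N n) → ℕ) → ℝ} (hF : Dom N F) (hG : Dom N G) :
    Dom N (fun n l => F n l + G n l) := by
  obtain ⟨C, K, hC, h⟩ := hF
  obtain ⟨C', K', hC', h'⟩ := hG
  refine ⟨C + C', K + K', by positivity, fun n hn l hl => ?_⟩
  have a1 := h n hn l hl
  have a2 := h' n hn l hl
  have a3 := MM_mono n (show K ≤ K + K' by omega) hl
  have a4 := MM_mono n (show K' ≤ K + K' by omega) hl
  refine (abs_add_le _ _).trans ?_
  nlinarith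

lemma Dom.mul {N : ℕ → ℕ} (hN : ∀ n, 0 < N n) {F G : (n : ℕ) → (Fin (N n) → ℕ) → ℝ} (hF : Dom N F) (hG : Dom N G) :
    Dom N (fun n l => F n l * G n l) := by
  obtain ⟨C, K, hC, h⟩ := hF
  obtain ⟨C', K', hC', h'⟩ := hG
  refine ⟨C * C' * 2, K + K', by positivity, fun n hn l hl => ?_⟩
  have a1 := h n hn l hl
  have a2 := h' n hn l hl
  have a3 := MM_mul (hN n) n K K' hl
  have a5 := MM_one_le (hN n) n K hl
  rw [abs_mul]
  calc _ ≤ (C * MM n K l) * (C' * MM n K' l) := by gcongr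
    _ = C * C' * (MM n K l * MM n K' l) := by ring
    _ ≤ C * C' * (2 * MM n (K+K') l) := by gcongr
    _ = _ := by ring

lemma Dom.const {N : ℕ → ℕ} (hN : ∀ n, 0 < N n) (a : ℕ → ℝ) (C : ℝ) (hC : ∀ n ≥ 1, |a n| ≤ C) :
    Dom N (fun n _ => a n) := by
  refine ⟨C, 0, (abs_nonneg _).trans (hC 1 le_rfl), fun n hn l hl => ?_⟩
  have := MM_one_le (hN n) n 0 hl
  have h1 := hC n hn
  have := abs_nonneg (a n)
  nlinarith

lemma Dom.sum {N : ℕ → ℕ} (hN : ∀ n, 0 < N n) {ι : Type*} (s : Finset ι) {F : ι → (n : ℕ) → (Fin (N n) → ℕ) → ℝ}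
    (hF : ∀ j ∈ s, Dom N (F j)) : Dom N (fun n l => ∑ j ∈ s, F j n l) := by
  induction s using Finset.induction_on with
  | empty => simpa using Dom.const hN (fun _ => 0) 0 (by simp)
  | insert a s ha ih =>
    simp only [Finset.sum_insert ha]
    exact Dom.add (hF a (by simp)) (ih (fun j hj => hF j (by simp [hj])))

lemma Dom.bd {N : ℕ → ℕ} (hN : ∀ n, 0 < N n) {K0 : ℝ} (hK : ∀ n : ℕ, Real.sqrt n / N n ≤ K0)
    {F : (n : ℕ) → (Fin (N n) → ℕ) → ℝ} (hF : Dom N F) :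
    ∃ C, 0 ≤ C ∧ ∀ n ≥ 1, ∀ m ≤ n, EE (N n) m (fun l => F n l) ≤ C := by
  obtain ⟨C, K, hC, h⟩ := hF
  obtain ⟨C', h'⟩ := MM_bd N hN K0 hK K
  refine ⟨C * max C' 0, by positivity, fun n hn m hm => ?_⟩
  calc _ ≤ EE (N n) m (fun l => C * MM n K l) := EE_mono (fun l hl => (le_abs_self _).trans (h n hn l hl))
    _ = C * EE (N n) m (MM n K) := by rw [EE_smul]
    _ ≤ _ := mul_le_mul_of_nonneg_left ((h' n hn m hm).trans (le_max_left _ _)) hC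

lemma Conv.add {N : ℕ → ℕ} {F G : (n : ℕ) → (Fin (N n) → ℕ) → ℝ} {φ ψ : Polynomial ℝ}
    (hF : Conv N F φ) (hG : Conv N G ψ) : Conv N (fun n l => F n l + G n l) (φ + ψ) := by
  obtain ⟨d, hd, h⟩ := hF
  obtain ⟨d', hd', h'⟩ := hG
  refine ⟨fun n => 2 * d n + 2 * d' n, by simpa using (hd.const_mul 2).add (hd'.const_mul 2), fun n hn m hm => ?_⟩
  refine le_trans ?_ (add_le_add (mul_le_mul_of_nonneg_left (h n hn m hm) zero_le_two)
    (mul_le_mul_of_nonneg_left (h' n hn m hm) zero_le_two))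
  rw [← EE_smul, ← EE_smul, ← EE_add]
  apply EE_mono
  intro l _
  rw [Polynomial.eval_add]
  nlinarith [sq_nonneg ((F n l - φ.eval ((m:ℝ)/n)) - (G n l - ψ.eval ((m:ℝ)/n)))]

lemma poly_bd (φ : Polynomial ℝ) : ∃ C, 0 ≤ C ∧ ∀ t ∈ Set.Icc (0:ℝ) 1, |φ.eval t| ≤ C := by
  obtain ⟨C, hC⟩ := isCompact_Icc.exists_bound_of_continuousOn (s := Set.Icc (0:ℝ) 1) φ.continuous.continuousOn
  exact ⟨C, (norm_nonneg _).trans (hC 0 (by simp)), hC⟩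

lemma frac_mem {n m : ℕ} (hm : m ≤ n) : (m:ℝ)/n ∈ Set.Icc (0:ℝ) 1 := by
  constructor
  · positivity
  · apply div_le_one_of_le₀ _ (by positivity)
    exact_mod_cast hm

lemma EE_sqrt {N m : ℕ} (F G : (Fin N → ℕ) → ℝ) {a b : ℝ} 
    (ha : EE N m (fun l => F l ^2) ≤ a) (hb : EE N m (fun l => G l ^ 2) ≤ b) :
    EE N m (fun l => F l * G l) ≤ Real.sqrt (a * b) := by
  apply Real.le_sqrt_of_sq_le
  refine (EE_cs F G).trans ?_
  have h1 : 0 ≤ EE N m (fun l => F l ^2) := EE_nonneg (fun _ _ => sq_nonneg _)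
  have h2 : 0 ≤ EE N m (fun l => G l ^2) := EE_nonneg (fun _ _ => sq_nonneg _)
  exact mul_le_mul ha hb h2 (h1.trans ha)

/-- product with a dominated function -/
lemma Conv.mul_zero {N : ℕ → ℕ} (hN : ∀ n, 0 < N n) {K0 : ℝ} (hK : ∀ n : ℕ, Real.sqrt n / N n ≤ K0)
    {F G : (n : ℕ) → (Fin (N n) → ℕ) → ℝ} {φ : Polynomial ℝ}
    (hF : Conv N F φ) (hFD : Dom N F) (hG : Dom N G) :
    ∃ δ : ℕ → ℝ, Tendsto δ atTop (𝓝 0) ∧ ∀ n ≥ 1, ∀ m ≤ n,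
    EE (N n) m (fun l => ((F n l - φ.eval ((m:ℝ)/n)) * G n l)^2) ≤ δ n := by
  obtain ⟨d, hd, h⟩ := hF
  obtain ⟨Cφ, hCφ, hφ⟩ := poly_bd φ
  have D1 : Dom N (fun n l => (F n l * F n l + Cφ * Cφ) * ((G n l * G n l) * (G n l * G n l))) := by
    apply Dom.mul hN
    · apply Dom.add (Dom.mul hN hFD hFD)
      exact Dom.const hN (fun _ => Cφ * Cφ) (|Cφ * Cφ|) (by simp)
    · exact Dom.mul hN (Dom.mul hN hG hG) (Dom.mul hN hG hG)
  obtain ⟨C, hC, hb⟩ := D1.bd hN hK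
  refine ⟨fun n => Real.sqrt (d n * (2 * C)), ?_, ?_⟩
  · have : Tendsto (fun n => Real.sqrt (d n * (2 * C))) atTop (𝓝 (Real.sqrt (0 * (2*C)))) :=
      (Real.continuous_sqrt.tendsto _).comp (hd.mul_const _)
    simpa using this
  · intro n hn m hm
    have e : (fun l => ((F n l - φ.eval ((m:ℝ)/n)) * G n l)^2) =
      fun l => (F n l - φ.eval ((m:ℝ)/n)) * ((F n l - φ.eval ((m:ℝ)/n)) * G n l ^2) := by
        funext l; ring
    rw [e]
    apply EE_sqrt _ _ (h n hn m hm)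
    refine le_trans ?_ (mul_le_mul_of_nonneg_left (hb n hn m hm) zero_le_two)
    rw [← EE_smul]
    apply EE_mono
    intro l hl
    have := hφ _ (frac_mem hm)
    generalize φ.eval ((m:ℝ)/n) = y at *
    have h1 : y^2 ≤ Cφ^2 := by rw [← sq_abs]; exact pow_le_pow_left₀ (abs_nonneg _) this 2
    have h2 : (F n l - y)^2 ≤ 2 * (F n l * F n l + Cφ * Cφ) := by nlinarith [sq_nonneg (F n l + y)]
    calc ((F n l - y) * G n l^2)^2 = (F n l - y)^2 * ((G n l * G n l) * (G n l * G n l)) := by ring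
      _ ≤ (2 * (F n l * F n l + Cφ * Cφ)) * ((G n l * G n l) * (G n l * G n l)) := by
        apply mul_le_mul_of_nonneg_right h2
        have := mul_self_nonneg (G n l); positivity
      _ = _ := by ring

lemma Conv.mul {N : ℕ → ℕ} (hN : ∀ n, 0 < N n) {K0 : ℝ} (hK : ∀ n : ℕ, Real.sqrt n / N n ≤ K0)
    {F G : (n : ℕ) → (Fin (N n) → ℕ) → ℝ} {φ ψ : Polynomial ℝ}
    (hF : Conv N F φ) (hFD : Dom N F) (hG : Conv N G ψ) (hGD : Dom N G) :
    Conv N (fun n l => F n l * G n l) (φ * ψ) := by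
  obtain ⟨d, hd, h⟩ := hF.mul_zero hN hK hFD hGD
  obtain ⟨d', hd', h'⟩ := hG
  obtain ⟨C, hC, hφ⟩ := poly_bd φ
  refine ⟨fun n => 2 * d n + (2 * C^2) * d' n, by simpa using (hd.const_mul 2).add (hd'.const_mul (2 * C^2)), fun n hn m hm => ?_⟩
  refine le_trans ?_ (add_le_add (mul_le_mul_of_nonneg_left (h n hn m hm) zero_le_two)
    (mul_le_mul_of_nonneg_left (h' n hn m hm) (by positivity)))
  rw [← EE_smul, ← EE_smul, ← EE_add]
  apply EE_mono
  intro l _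
  rw [Polynomial.eval_mul]
  have := hφ _ (frac_mem hm)
  generalize φ.eval ((m:ℝ)/n) = y at *
  generalize ψ.eval ((m:ℝ)/n) = z at *
  have h1 : y^2 ≤ C^2 := by rw [← sq_abs]; exact pow_le_pow_left₀ (abs_nonneg _) this 2
  have h2 : y^2 * (G n l - z)^2 ≤ C^2 * (G n l - z)^2 := by gcongr
  nlinarith [sq_nonneg ((F n l - y) * G n l - y * (G n l - z))]

lemma Conv.det {N : ℕ → ℕ} (hN : ∀ n, 0 < N n) {a : ℕ → ℝ} {b : ℝ} (h : Tendsto a atTop (𝓝 b)) :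
    Conv N (fun n _ => a n) (Polynomial.C b) := by
  refine ⟨fun n => (a n - b)^2, ?_, fun n hn m hm => ?_⟩
  · have : Tendsto (fun n => (a n - b)^2) atTop (𝓝 ((b-b)^2)) := (h.sub_const b).pow 2
    simpa using this
  · rw [Polynomial.eval_C, EE_const (hN n)]

lemma Conv.sum {N : ℕ → ℕ} (hN : ∀ n, 0 < N n) {ι : Type*} (s : Finset ι) {F : ι → (n : ℕ) → (Fin (N n) → ℕ) → ℝ}
    {φ : ι → Polynomial ℝ}
    (hF : ∀ j ∈ s, Conv N (F j) (φ j)) : Conv N (fun n l => ∑ j ∈ s, F j n l) (∑ j ∈ s, φ j) := by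
  induction s using Finset.induction_on with
  | empty => simpa using Conv.det hN (a := fun _ => 0) (b := 0) tendsto_const_nhds
  | insert a s ha ih =>
    simp only [Finset.sum_insert ha]
    exact Conv.add (hF a (by simp)) (ih (fun j hj => hF j (by simp [hj])))

lemma Conv.congr {N : ℕ → ℕ} {F G : (n : ℕ) → (Fin (N n) → ℕ) → ℝ} {φ : Polynomial ℝ}
    (hF : Conv N F φ) (h : ∀ n ≥ 1, ∀ l, Antitone l → F n l = G n l) : Conv N G φ := by
  obtain ⟨d, hd, h'⟩ := hF
  refine ⟨d, hd, fun n hn m hm => ?_⟩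
  rw [EE_congr (fun l hl => by rw [← h n hn l hl])]
  exact h' n hn m hm

/-- vanishing errors -/
lemma Conv.small {N : ℕ → ℕ} (hN : ∀ n, 0 < N n) {K0 : ℝ} (hK : ∀ n : ℕ, Real.sqrt n / N n ≤ K0)
    {F G : (n : ℕ) → (Fin (N n) → ℕ) → ℝ} (hG : Dom N G) (h : ∀ n ≥ 1, ∀ l, Antitone l → |F n l| ≤ (1 / Real.sqrt n) * G n l) :
    Conv N F 0 := by
  obtain ⟨C, hC, hb⟩ := (Dom.mul hN hG hG).bd hN hK
  refine ⟨fun n => (1/(n:ℝ)) * C, by simpa using tendsto_one_div_atTop_nhds_zero_nat.mul_const C, fun n hn m hm => ?_⟩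
  refine le_trans ?_ (mul_le_mul_of_nonneg_left (hb n hn m hm) (by positivity))
  rw [← EE_smul]
  apply EE_mono
  intro l hl
  rw [Polynomial.eval_zero, sub_zero, ← sq_abs]
  refine (pow_le_pow_left₀ (abs_nonneg _) (h n hn l hl) 2).trans ?_
  rw [mul_pow, div_pow, one_pow, Real.sq_sqrt (by positivity)]
  apply le_of_eq; ring

end BLS

namespace BLS
open Finset

lemma poly_taylor (f : Polynomial ℝ) : ∃ C, 0 ≤ C ∧ ∀ t h : ℝ, 0 ≤ t → 0 ≤ h → t + h ≤ 1 →
    |f.eval (t+h) - f.eval t - h * f.derivative.eval t| ≤ C * h^2 := by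
  induction f using Polynomial.induction_on with
  | C a => exact ⟨0, le_rfl, fun t h _ _ _ => by simp⟩
  | add p q hp hq =>
    obtain ⟨C, hC, h1⟩ := hp
    obtain ⟨C', hC', h2⟩ := hq
    refine ⟨C + C', by positivity, fun t h a b c => ?_⟩
    have := abs_add_le (p.eval (t+h) - p.eval t - h * p.derivative.eval t) (q.eval (t+h) - q.eval t - h * q.derivative.eval t)
    have h1 := h1 t h a b c
    have h2 := h2 t h a b c
    simp only [Polynomial.eval_add, Polynomial.derivative_add]
    rw [add_mul]
    refine le_trans (le_of_eq ?_) (this.trans (add_le_add h1 h2))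
    congr 1; ring
  | monomial n a hp =>
    obtain ⟨C, hC, h1⟩ := hp
    set f := Polynomial.C a * Polynomial.X^n with hf
    obtain ⟨D, hD, h2⟩ := poly_bd f.derivative
    have e : Polynomial.C a * Polynomial.X^(n+1) = f * Polynomial.X := by rw [hf, pow_succ, mul_assoc]
    refine ⟨C + D, by positivity, fun t h ha hb hc => ?_⟩
    rw [e]
    simp only [Polynomial.derivative_mul, Polynomial.derivative_X, Polynomial.eval_mul, Polynomial.eval_add, Polynomial.eval_X, mul_one]
    have h1 := h1 t h ha hb hc
    have h2 := h2 t ⟨ha, by linarith⟩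
    have e2 : f.eval (t+h) * (t+h) - f.eval t * t - h * (f.derivative.eval t * t + f.eval t) =
      (t+h) * (f.eval (t+h) - f.eval t - h * f.derivative.eval t) + h^2 * f.derivative.eval t := by ring
    rw [e2]
    refine (abs_add_le _ _).trans ?_
    rw [abs_mul, abs_mul, abs_of_nonneg (by linarith : 0 ≤ t + h), abs_of_nonneg (sq_nonneg h)]
    have : (t+h) * |f.eval (t+h) - f.eval t - h * f.derivative.eval t| ≤ 1 * (C * h^2) :=
      mul_le_mul hc h1 (abs_nonneg _) zero_le_one
    have : h^2 * |f.derivative.eval t| ≤ h^2 * D := mul_le_mul_of_nonneg_left h2 (sq_nonneg h)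
    linarith

lemma Conv.step {N : ℕ → ℕ} (hN : ∀ n, 0 < N n) {F : (n : ℕ) → (Fin (N n) → ℕ) → ℝ}
    {D : (n : ℕ) → (Fin (N n) → ℕ) → Fin (N n) → ℝ} {φ : Polynomial ℝ}
    (h0 : ∀ n ≥ 1, F n 0 = φ.eval 0)
    (hs : ∀ n ≥ 1, ∀ l, Antitone l → ∀ i, rr (XX l) i ≠ 0 → F n (upd l i) = F n l + D n l i / n)
    (hD : Conv N (fun n l => QQ l (D n l)) (Polynomial.derivative φ))
    (hB : ∃ C, ∀ n ≥ 1, ∀ m ≤ n, EE (N n) m (fun l => QQ l (fun i => D n l i ^2)) ≤ C) :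
    Conv N F φ := by
  obtain ⟨d, hd, hd2⟩ := hD
  obtain ⟨B, hB⟩ := hB
  obtain ⟨C, hC, hT⟩ := poly_taylor φ
  obtain ⟨P, hP, hP2⟩ := poly_bd (Polynomial.derivative φ)
  set ε : ℕ → ℝ := fun n => 2 * d n + 2 * C^2 * (1/(n:ℝ)) + (2 * B + 4 * P^2 + 4*C^2) * (1/(n:ℝ)) with hε
  have hlim : Tendsto ε atTop (𝓝 0) := by
    have h1 := tendsto_one_div_atTop_nhds_zero_nat (𝕜 := ℝ)
    have := ((hd.const_mul 2).add (h1.const_mul (2 * C^2))).add (h1.const_mul (2 * B + 4 * P^2 + 4*C^2))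
    rw [show (0:ℝ) = 2 * 0 + 2 * C^2 * 0 + (2 * B + 4 * P^2 + 4*C^2) * 0 by ring]
    exact this
  refine ⟨fun n => Real.exp 1 * ε n, by simpa using hlim.const_mul (Real.exp 1), fun n hn m hm => ?_⟩
  have hn' : (0:ℝ) < n := by exact_mod_cast hn
  have hn1 : (1:ℝ) ≤ n := by exact_mod_cast hn
  have hdn : 0 ≤ d n := le_trans (EE_nonneg (fun _ _ => sq_nonneg _)) (hd2 n hn 0 (by omega))
  have hBn : 0 ≤ B := by
    refine le_trans (EE_nonneg (fun l hl => ?_)) (hB n hn 0 (by omega))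
    rw [← QQ_const (hN n) hl 0]
    exact QQ_mono hl (fun i => sq_nonneg _)
  have hεn : 0 ≤ ε n := by rw [hε]; positivity
  have key : ∀ m < n, EE (N n) (m+1) (fun l => (F n l - φ.eval (((m+1 : ℕ):ℝ)/n))^2) ≤
      (1 + 1/(n:ℝ)) * EE (N n) m (fun l => (F n l - φ.eval ((m:ℝ)/n))^2) + (1/(n:ℝ)) * ε n := by
    intro m hmn
    set t : ℝ := (m:ℝ)/n with ht
    have ht' : ((m+1 : ℕ):ℝ)/n = t + 1/n := by push_cast; rw [ht]; ring
    have htm := frac_mem hmn.le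
    have htm' : t + 1/n ≤ 1 := by rw [← ht']; exact (frac_mem (by omega : m + 1 ≤ n)).2
    have hT := hT t (1/n) htm.1 (by positivity) htm'
    obtain ⟨r, hr⟩ : ∃ r, r = φ.eval (t+1/n) - φ.eval t - 1/n * (Polynomial.derivative φ).eval t := ⟨_, rfl⟩
    rw [← hr] at hT
    have hr2 : (n * r)^2 ≤ C^2 * (1/(n:ℝ)) := by
      have : |n * r| ≤ C * (1/n) := by
        rw [abs_mul, abs_of_pos hn']
        calc n * |r| ≤ n * (C * (1/n)^2) := by gcongr
          _ = C * (1/n) := by field_simp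
      calc (n*r)^2 = |n * r|^2 := (sq_abs _).symm
        _ ≤ (C * (1/n))^2 := pow_le_pow_left₀ (abs_nonneg _) this 2
        _ = C^2 * (1/n) * (1/n) := by ring
        _ ≤ C^2 * (1/n) * 1 := by
            apply mul_le_mul_of_nonneg_left _ (by positivity)
            rw [div_le_one hn']; exact hn1
        _ = _ := by ring
    have hP3 : ((Polynomial.derivative φ).eval t)^2 ≤ P^2 := by
      rw [← sq_abs]; exact pow_le_pow_left₀ (abs_nonneg _) (hP2 t htm) 2
    have hd3 := hd2 n hn m hmn.le
    have hB3 := hB n hn m hmn.le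
    rw [← ht] at hd3
    set y := (Polynomial.derivative φ).eval t
    set z := φ.eval t
    rw [ht', EE_succ]
    have hz : φ.eval (t+1/n) = z + 1/n * y + r := by rw [hr]; ring
    rw [hz]
    set R : ℝ := C^2 * (1/n) with hR
    have hR0 : 0 ≤ R := by positivity
    have hRC : R ≤ C^2 := by
      rw [hR]; have : 1/(n:ℝ) ≤ 1 := by rw [div_le_one hn']; exact hn1
      nlinarith [sq_nonneg C]
    calc _ ≤ EE (N n) m (fun l => (1 + 1/(n:ℝ)) * (F n l - z)^2 + ((1/(n:ℝ)) * (2 * (QQ l (D n l) - y)^2 + (2 * R))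
            + (1/(n:ℝ))^2 * (2 * QQ l (fun i => D n l i ^2) + (4 * P^2 + 4 * C^2)))) := by
          apply EE_mono
          intro l hl
          have e1 : QQ l (fun i => (F n (upd l i) - (z + 1/n*y + r))^2) =
              QQ l (fun i => (F n l - z)^2 + ((2 * (1/n) * (F n l - z)) * (D n l i - (y + n * r)) + (1/(n:ℝ))^2 * (D n l i - (y + n * r))^2)) := by
            apply QQ_congr
            intro i hi
            rw [hs n hn l hl i hi]; field_simp; ring
          rw [e1, QQ_add, QQ_add, QQ_const (hN n) hl, QQ_smul, QQ_smul, QQ_sub, QQ_const (hN n) hl]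
          have e2 : QQ l (fun i => (D n l i - (y + n*r))^2) ≤ 2 * QQ l (fun i => D n l i^2) + (4 * P^2 + 4 * C^2) := by
            rw [← QQ_smul, ← QQ_const (hN n) hl (4 * P^2 + 4*C^2), ← QQ_add]
            apply QQ_mono hl
            intro i
            nlinarith [sq_nonneg (D n l i + (y + n*r)), sq_nonneg (y - n * r)]
          have e3 : 2 * (1/(n:ℝ)) * (F n l - z) * (QQ l (D n l) - (y + n*r)) ≤
              (1/(n:ℝ)) * ((F n l - z)^2 + (2 * (QQ l (D n l) - y)^2 + 2 * R)) := by
            rw [mul_comm 2 (1/(n:ℝ)), mul_assoc, mul_assoc]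
            apply mul_le_mul_of_nonneg_left _ (by positivity)
            nlinarith [sq_nonneg ((F n l - z) - (QQ l (D n l) - (y + n*r))), sq_nonneg ((QQ l (D n l) - y) + n * r)]
          have e4 := mul_le_mul_of_nonneg_left e2 (by positivity : 0 ≤ (1/(n:ℝ))^2)
          change (F n l - z)^2 + (2 * (1/(n:ℝ)) * (F n l - z) * (QQ l (D n l) - (y + n*r)) + _) ≤ _
          linarith
      _ = (1 + 1/(n:ℝ)) * EE (N n) m (fun l => (F n l - z)^2) + ((1/(n:ℝ)) * (2 * EE (N n) m (fun l => (QQ l (D n l) - y)^2) + (2 * R))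
            + (1/(n:ℝ))^2 * (2 * EE (N n) m (fun l => QQ l (fun i => D n l i ^2)) + (4 * P^2 + 4 * C^2))) := by
          simp only [EE_add, EE_smul, EE_const (hN n)]
      _ ≤ _ := by
          have q : 0 < 1/(n:ℝ) := by positivity
          have : (1/(n:ℝ)) * (2 * EE (N n) m (fun l => (QQ l (D n l) - y)^2) + (2 * R))
            + (1/(n:ℝ))^2 * (2 * EE (N n) m (fun l => QQ l (fun i => D n l i ^2)) + (4 * P^2 + 4 * C^2)) ≤
              (1/(n:ℝ)) * (2 * d n + (2 * R)) + (1/(n:ℝ))^2 * (2 * B + (4 * P^2 + 4 * C^2)) := by gcongr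
          have e : (1/(n:ℝ)) * ε n = (1/(n:ℝ)) * (2 * d n + (2 * R)) + (1/(n:ℝ))^2 * (2 * B + (4 * P^2 + 4 * C^2)) := by
            rw [hε, hR]; ring
          rw [e]; linarith
  have g := gron (fun m => EE (N n) m (fun l => (F n l - φ.eval ((m:ℝ)/n))^2) + ε n) 1 zero_le_one
    (add_nonneg (EE_nonneg (fun _ _ => sq_nonneg _)) hεn) hn (fun m hm => by
      have := key m hm
      linarith) m hm
  simp only [EE_zero, h0 n hn, Nat.cast_zero, zero_div, sub_self] at g
  linarith

lemma Dom.al {N : ℕ → ℕ} (k : ℕ) : Dom N (fun n l => al n k l) :=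
  ⟨1, k, zero_le_one, fun n _ l hl => by rw [one_mul]; exact al_le n k hl⟩

lemma Dom.MM {N : ℕ → ℕ} (k : ℕ) : Dom N (fun n l => MM n k l) :=
  ⟨1, k, zero_le_one, fun n _ l hl => by
    rw [one_mul, abs_of_nonneg]
    unfold BLS.MM
    rw [← show QQ l (fun _ => 0) = 0 by simp [QQ]]
    exact QQ_mono hl (fun i => by positivity)⟩

lemma Dom.QQvt {N : ℕ → ℕ} (s : ℕ) : Dom N (fun n l => QQ l (fun i => vt (1 / Real.sqrt n) s (xi n l i))) :=
  ⟨s, s, by positivity, fun n hn l hl => QQvt_le hn s hl⟩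

lemma Conv.QQvt {N : ℕ → ℕ} (hN : ∀ n, 0 < N n) {K0 : ℝ} (hK : ∀ n : ℕ, Real.sqrt n / N n ≤ K0) (s : ℕ)
    (φ : Polynomial ℝ) (h : Conv N (fun n l => al n (s-1) l) φ) :
    Conv N (fun n l => QQ l (fun i => vt (1 / Real.sqrt n) s (xi n l i))) (Polynomial.C (s:ℝ) * φ) := by
  have h1 : Conv N (fun n l => QQ l (fun i => vt (1 / Real.sqrt n) s (xi n l i)) - s * al n (s-1) l) 0 := by
    apply Conv.small hN hK (G := fun n l => s^3 * MM n s l)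
    · exact Dom.mul hN (Dom.const hN (fun _ => (s:ℝ)^3) (|(s:ℝ)^3|) (by simp)) (Dom.MM s)
    · intro n hn l hl
      rw [al, ← QQ_smul, ← QQ_sub, MM, ← QQ_smul, ← QQ_smul]
      apply QQ_abs hl
      intro i
      have := (vt_bd _ (inv_sqrt_le hn).1 (inv_sqrt_le hn).2 (xi n l i) s).2.2.2
      linarith
  have h2 : Conv N (fun n l => (s:ℝ) * al n (s-1) l) (Polynomial.C (s:ℝ) * φ) :=
    Conv.mul hN hK (Conv.det hN (a := fun _ => (s:ℝ)) tendsto_const_nhds)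
      (Dom.const hN (fun _ => (s:ℝ)) (|(s:ℝ)|) (by simp)) h (Dom.al _)
  have := h1.add h2
  rw [zero_add] at this
  exact this.congr (fun n _ l _ => by simp)

lemma DD_abs {N : ℕ} (hN : 0 < N) {n : ℕ} (hn : 1 ≤ n) (k : ℕ) {l : Fin N → ℕ} (hl : Antitone l) {K0 : ℝ}
    (hK : Real.sqrt n / N ≤ K0) (i : Fin N) :
    |DD n k l i| ≤ (K0 * (k+1) + k * (k+1)) * MM n (k+1) l * (1 + |xi n l i|)^(k+1) := by
  have hM := MM_one_le hN n (k+1) hl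
  have hw : 1 ≤ 1 + |xi n l i| := by have := abs_nonneg (xi n l i); linarith
  have hK0 : 0 ≤ K0 := le_trans (by positivity) hK
  unfold DD
  refine (abs_add_le _ _).trans ?_
  rw [add_mul, add_mul]
  have hv : ∀ s, |vt (1 / Real.sqrt n) s (xi n l i)| ≤ s * (1 + |xi n l i|)^s := fun s => vt_le hn s l i
  set w := 1 + |xi n l i|
  apply add_le_add
  · rw [abs_mul, abs_of_nonneg (by positivity)]
    have h1 := hv (k+1)
    push_cast at h1
    calc _ ≤ K0 * ((k+1) * w^(k+1)) := by gcongr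
      _ = K0 * (k+1) * 1 * w^(k+1) := by ring
      _ ≤ _ := by gcongr
  · refine (Finset.abs_sum_le_sum_abs _ _).trans ?_
    calc _ ≤ ∑ p ∈ antidiagonal k, k * MM n (k+1) l * w^(k+1) := by
          apply Finset.sum_le_sum
          rintro ⟨p, q⟩ hp
          rw [HasAntidiagonal.mem_antidiagonal] at hp
          simp only at hp ⊢
          have a1 := al_le n p hl
          have a2 := hv q
          have a4 := MM_mono n (show p ≤ k + 1 by omega) hl
          have a7 : (q:ℝ) ≤ k := by exact_mod_cast (by omega : q ≤ k)
          have a8 : w^q ≤ w^(k+1) := pow_le_pow_right₀ hw (by omega)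
          rw [abs_mul]
          calc _ ≤ MM n (k+1) l * (k * w^(k+1)) := by
                apply mul_le_mul (a1.trans a4) (a2.trans _) (abs_nonneg _) (by positivity)
                gcongr
            _ = _ := by ring
      _ = _ := by rw [Finset.sum_const, Finset.Nat.card_antidiagonal]; simp; ring

lemma Conv.al {N : ℕ → ℕ} (hN : ∀ n, 0 < N n) {c : ℝ}
    (hc : Tendsto (fun n : ℕ => Real.sqrt n / (N n : ℝ)) atTop (𝓝 c)) {K0 : ℝ} (hK : ∀ n : ℕ, Real.sqrt n / N n ≤ K0)
    (B : ℕ → Polynomial ℝ) (hB0 : B 0 = 1) (hBz : ∀ k, (B (k+1)).eval 0 = 0)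
    (hBd : ∀ k, Polynomial.derivative (B (k+1)) = Polynomial.C c * (Polynomial.C ((k+1 : ℕ):ℝ) * B k) +
      ∑ p ∈ antidiagonal k, B p.1 * (Polynomial.C (p.2:ℝ) * B (p.2 - 1))) (k : ℕ) :
    Conv N (fun n l => al n k l) (B k) := by
  induction k using Nat.strong_induction_on with
  | _ k ih =>
    cases k with
    | zero =>
      rw [hB0]
      exact (Conv.det hN (a := fun _ => (1:ℝ)) tendsto_const_nhds).congr (fun n _ l hl => (al_zero (hN n) n hl).symm)
    | succ k =>
      have kap : Dom N (fun n _ => Real.sqrt n / (N n : ℝ)) := Dom.const hN _ K0 (fun n _ => by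
        rw [abs_of_nonneg (by positivity)]; exact hK n)
      apply Conv.step hN (D := fun n l i => DD n k l i)
      · intro n _; rw [al_at_zero, hBz]
      · intro n hn l hl i hi
        exact al_upd (hN n) n k hn hl i hi
      · rw [hBd]
        refine Conv.congr ?_ (fun n _ l _ => (QQDD n k l).symm)
        apply Conv.add
        · exact Conv.mul hN hK (Conv.det hN hc) kap (Conv.QQvt hN hK (k+1) _ (ih k (by omega))) (Dom.QQvt _)
        · apply Conv.sum hN
          rintro ⟨p, q⟩ hp
          rw [HasAntidiagonal.mem_antidiagonal] at hp
          simp only at hp ⊢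
          exact Conv.mul hN hK (ih p (by omega)) (Dom.al _) (Conv.QQvt hN hK q _ (ih (q-1) (by omega))) (Dom.QQvt _)
      · have hK0 : 0 ≤ K0 := le_trans (by positivity) (hK 1)
        set A := (K0 * (k+1) + k * (k+1)) with hA
        have hA0 : 0 ≤ A := by positivity
        have D1 : Dom N (fun n l => (A^2) * (MM n (k+1) l * MM n (k+1) l * MM n (2*(k+1)) l)) :=
          Dom.mul hN (Dom.const hN (fun _ => A^2) (|A^2|) (by simp))
            (Dom.mul hN (Dom.mul hN (Dom.MM _) (Dom.MM _)) (Dom.MM _))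
        obtain ⟨C, _, hC⟩ := D1.bd hN hK
        refine ⟨C, fun n hn m hm => le_trans (EE_mono ?_) (hC n hn m hm)⟩
        intro l hl
        have hM := MM_one_le (hN n) n (k+1) hl
        rw [show (A^2) * (MM n (k+1) l * MM n (k+1) l * MM n (2*(k+1)) l) =
          (A * MM n (k+1) l)^2 * MM n (2*(k+1)) l by ring]
        nth_rewrite 2 [MM]
        rw [← QQ_smul]
        apply QQ_mono hl
        intro i
        rw [← sq_abs]
        refine (pow_le_pow_left₀ (abs_nonneg _) (DD_abs (hN n) hn k hl (hK n) i) 2).trans ?_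
        apply le_of_eq; ring

/-- content power sums -/
def Sk {N : ℕ} (n k : ℕ) (l : Fin N → ℕ) : ℝ :=
  (∑ i : Fin N, ∑ j ∈ Icc 1 (l i), (((j:ℝ) - ((i:ℕ) + 1 : ℕ)) / Real.sqrt n)^k) / n

lemma Conv.Sk {N : ℕ → ℕ} (hN : ∀ n, 0 < N n) {K0 : ℝ} (hK : ∀ n : ℕ, Real.sqrt n / N n ≤ K0)
    (k : ℕ) (φ ψ : Polynomial ℝ) (h : Conv N (fun n l => BLS.al n k l) ψ) (h0 : φ.eval 0 = 0)
    (hd : Polynomial.derivative φ = ψ) : Conv N (fun n l => BLS.Sk n k l) φ := by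
  apply Conv.step hN (D := fun n l i => xi n l i ^ k)
  · intro n _; rw [h0]; simp [BLS.Sk]
  · intro n hn l hl i _
    rw [BLS.Sk, BLS.Sk, ← add_div]
    congr 1
    rw [← Finset.add_sum_erase univ _ (mem_univ i), ← Finset.add_sum_erase univ (fun i : Fin (N n) => ∑ j ∈ Icc 1 (l i), (((j:ℝ) - ((i:ℕ) + 1 : ℕ)) / Real.sqrt n)^k) (mem_univ i), add_right_comm]
    congr 1
    · rw [upd, Function.update_self, Finset.sum_Icc_succ_top (by omega)]
      congr 3
      rw [XX]; push_cast; ring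
    · apply Finset.sum_congr rfl
      intro j hj
      rw [upd, Function.update_of_ne (Finset.ne_of_mem_erase hj)]
  · rw [hd]; exact h
  · obtain ⟨C, hC⟩ := MM_bd N hN K0 hK (2*k)
    refine ⟨C, fun n hn m hm => le_trans (EE_mono ?_) (hC n hn m hm)⟩
    intro l hl
    apply QQ_mono hl
    intro i
    rw [← pow_mul, mul_comm k 2, pow_mul, ← sq_abs, ← pow_mul]
    exact pow_le_pow_left₀ (abs_nonneg _) (by linarith) _

end BLS

namespace BLS
open Finset

def sc (l : ℕ) : ℝ := if Even l then (catalan (l/2) : ℝ) else 0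

lemma sc_odd {l : ℕ} (h : ¬ Even l) : sc l = 0 := by simp [sc, h]
lemma sc_even (m : ℕ) : sc (2*m) = catalan m := by simp [sc]
lemma sc_zero : sc 0 = 1 := by simp [sc]

lemma sc_rec (k : ℕ) : sc (k+2) = ∑ p ∈ antidiagonal k, sc p.1 * sc p.2 := by
  by_cases hk : Even k
  · obtain ⟨m, hm⟩ := hk
    have hm2 : k = 2 * m := by omega
    have : k + 2 = 2 * (m+1) := by omega
    rw [this, sc_even, catalan_succ', hm2]
    push_cast
    refine Finset.sum_of_injOn (fun p => (2 * p.1, 2 * p.2)) ?_ ?_ ?_ ?_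
    · rintro ⟨a, b⟩ _ ⟨a', b'⟩ _ h
      simp only [Prod.mk.injEq] at h ⊢
      omega
    · rintro ⟨a, b⟩ h
      simp only [mem_coe, HasAntidiagonal.mem_antidiagonal] at h ⊢
      omega
    · rintro ⟨a, b⟩ h h'
      rw [HasAntidiagonal.mem_antidiagonal] at h
      simp only at h
      by_cases ha : Even a
      · exfalso
        apply h'
        obtain ⟨a', ha'⟩ := ha
        refine ⟨(a', m - a'), ?_, ?_⟩
        · simp only [mem_coe, HasAntidiagonal.mem_antidiagonal]; omega
        · simp only [Prod.mk.injEq]; omega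
      · simp [sc_odd ha]
    · rintro ⟨a, b⟩ _
      simp only [sc_even]
  · rw [sc_odd (by rw [Nat.even_add]; simp [hk])]
    symm
    apply Finset.sum_eq_zero
    rintro ⟨a, b⟩ h
    rw [HasAntidiagonal.mem_antidiagonal] at h
    simp only at h ⊢
    by_cases ha : Even a
    · have hb : ¬ Even b := fun hb => hk (h ▸ ha.add hb)
      simp [sc_odd hb]
    · simp [sc_odd ha]

/-- Appell polynomials -/
def AP (a : ℕ → ℝ) (k : ℕ) (v : ℝ) : ℝ := ∑ l ∈ range (k+1), (k.choose l : ℝ) * v^(k-l) * a l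

lemma AP_zero (a : ℕ → ℝ) (k : ℕ) : AP a k 0 = a k := by
  rw [AP, Finset.sum_range_succ, Finset.sum_eq_zero]
  · simp
  · intro l hl
    rw [zero_pow (by have := Finset.mem_range.1 hl; omega)]; ring

lemma AP_der (a : ℕ → ℝ) (k : ℕ) : ∑ l ∈ range (k+1+1), ((k+1).choose l : ℝ) * (((k+1-l : ℕ) : ℝ) * v^(k+1-l-1)) * a l
    = (k+1) * AP a k v := by
  rw [Finset.sum_range_succ]
  simp only [Nat.sub_self, Nat.cast_zero, zero_mul, mul_zero, add_zero, AP, Finset.mul_sum]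
  apply Finset.sum_congr rfl
  intro l hl
  have hl : l ≤ k := by have := Finset.mem_range.1 hl; omega
  have h1 : (k+1).choose l * (k + 1 - l) = (k+1) * k.choose l := by
    have := Nat.choose_mul_succ_eq k l
    rw [← this]; ring
  have h2 : (((k+1).choose l : ℝ)) * ((k + 1 - l : ℕ) : ℝ) = (k+1) * (k.choose l : ℝ) := by exact_mod_cast h1
  rw [show k + 1 - l - 1 = k - l by omega, ← mul_assoc, h2]; ring

lemma AP_hasDeriv (a : ℕ → ℝ) (k : ℕ) (v : ℝ) : HasDerivAt (AP a (k+1)) ((k+1) * AP a k v) v := by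
  rw [← AP_der]
  unfold AP
  apply HasDerivAt.fun_sum
  intro l _
  apply HasDerivAt.mul_const
  apply HasDerivAt.const_mul
  exact hasDerivAt_pow _ v

lemma AP0 (a : ℕ → ℝ) (v : ℝ) : AP a 0 v = a 0 := by simp [AP]

def ta (t : ℝ) (l : ℕ) : ℝ := t^(l/2) * sc l
def td (t : ℝ) (l : ℕ) : ℝ := ((l/2 : ℕ) : ℝ) * t^(l/2 - 1) * sc l

lemma conv_der (t : ℝ) (k : ℕ) (v : ℝ) :
    HasDerivAt (fun v => ∑ p ∈ antidiagonal (k+1), AP (ta t) p.1 v * AP (ta t) p.2 v)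
      ((k+2) * ∑ p ∈ antidiagonal k, AP (ta t) p.1 v * AP (ta t) p.2 v) v := by
  have h0 : ∀ k, HasDerivAt (AP (ta t) k) (k * AP (ta t) (k-1) v) v := by
    intro k
    cases k with
    | zero =>
      have : AP (ta t) 0 = fun _ => ta t 0 := by funext v; exact AP0 _ _
      rw [this]; simpa using hasDerivAt_const v (ta t 0)
    | succ k => simpa using AP_hasDeriv (ta t) k v
  have h1 := HasDerivAt.fun_sum (u := antidiagonal (k+1)) (fun p _ => (h0 p.1).mul (h0 p.2))
  refine HasDerivAt.congr_deriv h1 (Eq.symm ?_)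
  rw [Finset.sum_add_distrib]
  have e1 : ∑ p ∈ antidiagonal (k+1), (p.1 : ℝ) * AP (ta t) (p.1 - 1) v * AP (ta t) p.2 v =
      ∑ p ∈ antidiagonal k, ((p.1:ℝ)+1) * (AP (ta t) p.1 v * AP (ta t) p.2 v) := by
    rw [Finset.Nat.sum_antidiagonal_succ]
    simp [mul_assoc]
  have e2 : ∑ p ∈ antidiagonal (k+1), AP (ta t) p.1 v * ((p.2 : ℝ) * AP (ta t) (p.2 - 1) v) =
      ∑ p ∈ antidiagonal k, ((p.2:ℝ)+1) * (AP (ta t) p.1 v * AP (ta t) p.2 v) := by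
    rw [Finset.Nat.sum_antidiagonal_succ']
    simp [mul_left_comm]
  rw [e1, e2, ← Finset.sum_add_distrib, Finset.mul_sum]
  apply Finset.sum_congr rfl
  rintro ⟨a, b⟩ h
  rw [HasAntidiagonal.mem_antidiagonal] at h
  simp only at h ⊢
  rw [← h]; push_cast; ring

lemma td_rec (t : ℝ) (k : ℕ) : td t (k+2) = ((k:ℝ)+2)/2 * ∑ p ∈ antidiagonal k, ta t p.1 * ta t p.2 := by
  have e : ∑ p ∈ antidiagonal k, ta t p.1 * ta t p.2 = t^(k/2) * sc (k+2) := by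
    rw [sc_rec, Finset.mul_sum]
    apply Finset.sum_congr rfl
    rintro ⟨a, b⟩ h
    rw [HasAntidiagonal.mem_antidiagonal] at h
    simp only at h ⊢
    by_cases ha : Even a
    · by_cases hb : Even b
      · obtain ⟨a', rfl⟩ := ha
        obtain ⟨b', rfl⟩ := hb
        have : k / 2 = (a' + a')/2 + (b' + b')/2 := by omega
        rw [this, ta, ta, pow_add]; ring
      · simp [ta, sc_odd hb]
    · simp [ta, sc_odd ha]
  rw [e, td]
  by_cases hk : Even k
  · obtain ⟨m, rfl⟩ := hk
    have h1 : (m + m + 2)/2 = m + 1 := by omega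
    have h2 : (m + m)/2 = m := by omega
    rw [h1, h2, Nat.add_sub_cancel]; push_cast; ring
  · rw [sc_odd (by rw [Nat.even_add]; simp [hk])]; ring

lemma AP_ode (t : ℝ) (k : ℕ) : ∀ v, AP (td t) (k+2) v =
    ((k:ℝ)+2)/2 * ∑ p ∈ antidiagonal k, AP (ta t) p.1 v * AP (ta t) p.2 v := by
  have const : ∀ f : ℝ → ℝ, (∀ v, HasDerivAt f 0 v) → f 0 = 0 → ∀ v, f v = 0 := by
    intro f hf h0 v
    rw [← h0]
    exact is_const_of_deriv_eq_zero (fun x => (hf x).differentiableAt) (fun x => (hf x).deriv) v 0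
  induction k with
  | zero =>
    have h1 : ∀ v, AP (td t) 1 v = 0 := by
      intro v; simp [AP, Finset.sum_range_succ, td]
    have := const (fun v => AP (td t) 2 v - 1) (fun v => by
      have := (AP_hasDeriv (td t) 1 v).sub_const 1
      rw [h1, mul_zero] at this; exact this) (by rw [AP_zero]; simp [td, sc])
    intro v
    have := this v
    simp [AP0, ta, sc_zero]
    linarith
  | succ k ih =>
    have := const (fun v => AP (td t) (k+1+2) v - (((k+1:ℕ):ℝ)+2)/2 * ∑ p ∈ antidiagonal (k+1), AP (ta t) p.1 v * AP (ta t) p.2 v)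
      (fun v => by
        have := (AP_hasDeriv (td t) (k+2) v).sub ((conv_der t k v).const_mul ((((k+1:ℕ):ℝ)+2)/2))
        refine HasDerivAt.congr_deriv this ?_
        rw [ih v]; push_cast; ring) (by
        simp only [AP_zero]
        rw [td_rec]; ring)
    intro v
    have := this v
    linarith

/-- the limiting moments -/
def BB (c : ℝ) (k : ℕ) : Polynomial ℝ := ∑ l ∈ range (k+1),
  Polynomial.C ((k.choose l : ℝ)) * (Polynomial.C c * Polynomial.X)^(k-l) * (Polynomial.X^(l/2) * Polynomial.C (sc l))

lemma BB_eval (c : ℝ) (k : ℕ) (t : ℝ) : (BB c k).eval t = AP (ta t) k (c*t) := by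
  simp [BB, AP, ta, Polynomial.eval_finsetSum, mul_comm (sc _)]

lemma BB_zero (c : ℝ) : BB c 0 = 1 := by simp [BB, sc_zero]

lemma BB_at_zero (c : ℝ) (k : ℕ) : (BB c (k+1)).eval 0 = 0 := by
  rw [BB_eval, mul_zero, AP_zero, ta]
  rcases k with _ | k
  · simp [sc]
  · rw [zero_pow (by omega)]; simp

lemma BB_deriv_eval (c : ℝ) (k : ℕ) (t : ℝ) : (Polynomial.derivative (BB c (k+1))).eval t =
    c * ((k+1) * AP (ta t) k (c*t)) + AP (td t) (k+1) (c*t) := by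
  have h1 := (BB c (k+1)).hasDerivAt t
  have h2 : HasDerivAt (fun t => (BB c (k+1)).eval t) (c * ((k+1) * AP (ta t) k (c*t)) + AP (td t) (k+1) (c*t)) t := by
    simp only [BB_eval]
    rw [← AP_der]
    unfold AP
    rw [Finset.mul_sum, ← Finset.sum_add_distrib]
    apply HasDerivAt.fun_sum
    intro l _
    have a1 : HasDerivAt (fun t : ℝ => ((k+1).choose l : ℝ) * (c*t)^(k+1-l))
        (((k+1).choose l : ℝ) * (((k+1-l : ℕ):ℝ) * (c*t)^(k+1-l-1) * c)) t := by
      apply HasDerivAt.const_mul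
      have : HasDerivAt (fun t : ℝ => c * t) c t := by simpa using (hasDerivAt_id t).const_mul c
      exact this.pow _
    have a2 : HasDerivAt (fun t : ℝ => ta t l) (td t l) t := by
      unfold ta td
      apply HasDerivAt.mul_const
      exact hasDerivAt_pow _ t
    refine HasDerivAt.congr_deriv (a1.mul a2) ?_
    ring
  exact h1.unique h2

lemma BB_deriv (c : ℝ) (k : ℕ) : Polynomial.derivative (BB c (k+1)) = Polynomial.C c * (Polynomial.C ((k+1 : ℕ):ℝ) * BB c k) +
      ∑ p ∈ antidiagonal k, BB c p.1 * (Polynomial.C (p.2:ℝ) * BB c (p.2 - 1)) := by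
  apply Polynomial.funext
  intro t
  rw [BB_deriv_eval]
  simp only [Polynomial.eval_add, Polynomial.eval_mul, Polynomial.eval_C, Polynomial.eval_finsetSum, BB_eval]
  push_cast
  congr 1
  cases k with
  | zero => simp [AP, Finset.sum_range_succ, td]
  | succ k =>
    rw [AP_ode, Finset.Nat.sum_antidiagonal_succ']
    simp only [Nat.cast_zero, zero_mul, mul_zero, zero_add, Nat.add_sub_cancel]
    set P := fun i => AP (ta t) i (c*t)
    have e1 : ∑ p ∈ antidiagonal k, P p.1 * (((p.2 + 1 : ℕ):ℝ) * P p.2) =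
        ∑ p ∈ antidiagonal k, P p.2 * (((p.1 + 1 : ℕ):ℝ) * P p.1) :=
      (Finset.Nat.sum_antidiagonal_swap (n := k) (f := fun p => P p.2 * (((p.1 + 1 : ℕ):ℝ) * P p.1)))
    have e2 : ((k:ℝ)+2) * ∑ p ∈ antidiagonal k, P p.1 * P p.2 =
        ∑ p ∈ antidiagonal k, P p.1 * (((p.2 + 1 : ℕ):ℝ) * P p.2) + ∑ p ∈ antidiagonal k, P p.2 * (((p.1 + 1 : ℕ):ℝ) * P p.1) := by
      rw [← Finset.sum_add_distrib, Finset.mul_sum]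
      apply Finset.sum_congr rfl
      rintro ⟨a, b⟩ h
      rw [HasAntidiagonal.mem_antidiagonal] at h
      simp only at h ⊢
      rw [← h]; push_cast; ring
    change ((k:ℝ)+2)/2 * ∑ p ∈ antidiagonal k, P p.1 * P p.2 = ∑ p ∈ antidiagonal k, P p.1 * (((p.2 + 1 : ℕ):ℝ) * P p.2)
    try simp only [zero_add]
    linarith

lemma poly_prim (ψ : Polynomial ℝ) : ∃ φ : Polynomial ℝ, φ.eval 0 = 0 ∧ Polynomial.derivative φ = ψ := by
  induction ψ using Polynomial.induction_on' with
  | add p q hp hq =>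
    obtain ⟨f, h1, h2⟩ := hp
    obtain ⟨g, h3, h4⟩ := hq
    exact ⟨f + g, by simp [h1, h3], by simp [h2, h4]⟩
  | monomial n a =>
    refine ⟨Polynomial.monomial (n+1) (a/(n+1)), by simp, ?_⟩
    rw [Polynomial.derivative_monomial]
    congr 1
    have : (n:ℝ) + 1 ≠ 0 := by positivity
    push_cast; field_simp

/-- LLN for content moments -/
theorem lln {N : ℕ → ℕ} (hN : ∀ n, 0 < N n) {c : ℝ}
    (hc : Tendsto (fun n : ℕ => Real.sqrt n / (N n : ℝ)) atTop (𝓝 c)) (k : ℕ) :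
    ∃ δ : ℕ → ℝ, Tendsto δ atTop (𝓝 0) ∧ ∀ n ≥ 1,
      EE (N n) n (fun l => (Sk n k l - ∫ t in (0:ℝ)..1, (BB c k).eval t)^2) ≤ δ n := by
  obtain ⟨K0, hK0⟩ := hc.bddAbove_range
  have hK : ∀ n : ℕ, Real.sqrt n / N n ≤ K0 := fun n => hK0 ⟨n, rfl⟩
  obtain ⟨φ, h1, h2⟩ := poly_prim (BB c k)
  have h3 := Conv.al hN hc hK (BB c) (BB_zero c) (BB_at_zero c) (BB_deriv c) k
  obtain ⟨δ, hδ, h4⟩ := Conv.Sk hN hK k φ _ h3 h1 h2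
  refine ⟨δ, hδ, fun n hn => ?_⟩
  have h5 := h4 n hn n le_rfl
  have e : ∫ t in (0:ℝ)..1, (BB c k).eval t = φ.eval 1 := by
    rw [intervalIntegral.integral_eq_sub_of_hasDerivAt (f := fun t => φ.eval t) (fun t _ => by
      rw [← h2]; exact φ.hasDerivAt t) ((BB c k).continuous.intervalIntegrable _ _), h1, sub_zero]
  rw [div_self (by have : (0:ℝ) < n := by exact_mod_cast hn
                   exact this.ne')] at h5
  rw [e]; exact h5

end BLS

namespace BLS
open Finset

lemma sc_step (m : ℕ) : ((m:ℝ)+2) * sc (2*(m+1)) = 2 * (2*m+1) * sc (2*m) := by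
  rw [sc_even, sc_even]
  have h1 := succ_mul_catalan_eq_centralBinom m
  have h2 := succ_mul_catalan_eq_centralBinom (m+1)
  have h3 := Nat.succ_mul_centralBinom_succ m
  rw [← h1, ← h2] at h3
  have h4 : ((m:ℝ)+1) * ((m+1+1) * catalan (m+1)) = 2 * (2*m+1) * ((m+1) * catalan m) := by exact_mod_cast h3
  have h5 : (m:ℝ)+1 ≠ 0 := by positivity
  apply mul_left_cancel₀ h5
  linarith

lemma semi_zero : ∫ s in (-2:ℝ)..2, Real.sqrt (4 - s^2) = 2 * π := by
  have h := integral_sqrt_one_sub_sq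
  have h2 := intervalIntegral.integral_comp_mul_left (a := -1) (b := 1) (fun s => Real.sqrt (4 - s^2)) (c := 2) (by norm_num)
  have e : ∀ x : ℝ, Real.sqrt (4 - (2*x)^2) = 2 * Real.sqrt (1 - x^2) := by
    intro x
    rw [show 4 - (2*x)^2 = 2^2 * (1 - x^2) by ring, Real.sqrt_mul (by norm_num), Real.sqrt_sq (by norm_num)]
  simp only [e, intervalIntegral.integral_const_mul, h] at h2
  norm_num at h2
  linarith

lemma semi_step (m : ℕ) : ((m:ℝ)+2) * ∫ s in (-2:ℝ)..2, s^(2*(m+1)) * Real.sqrt (4 - s^2) =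
    2 * (2*m+1) * ∫ s in (-2:ℝ)..2, s^(2*m) * Real.sqrt (4 - s^2) := by
  have key : ∫ s in (-2:ℝ)..2, (4 * (2*m+1) * (s^(2*m) * Real.sqrt (4-s^2)) - (2*m+4) * (s^(2*(m+1)) * Real.sqrt (4-s^2))) =
      (2:ℝ)^(2*m+1) * ((4-2^2) * Real.sqrt (4 - 2^2)) - (-2:ℝ)^(2*m+1) * ((4-(-2)^2) * Real.sqrt (4 - (-2)^2)) := by
    apply intervalIntegral.integral_eq_sub_of_hasDerivAt_of_le (f := fun s : ℝ => s^(2*m+1) * ((4-s^2) * Real.sqrt (4 - s^2))) (by norm_num)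
    · fun_prop
    · intro s hs
      have hpos : 0 < 4 - s^2 := by nlinarith [hs.1, hs.2]
      have d0 : HasDerivAt (fun s : ℝ => 4 - s^2) (-(2*s)) s := by
        simpa using (hasDerivAt_pow 2 s).const_sub 4
      have d1 := d0.sqrt hpos.ne'
      have d2 := (hasDerivAt_pow (2*m+1) s).mul (d0.mul d1)
      refine HasDerivAt.congr_deriv d2 ?_
      have hsq : Real.sqrt (4-s^2) ^ 2 = 4 - s^2 := Real.sq_sqrt hpos.le
      have hne : Real.sqrt (4-s^2) ≠ 0 := (Real.sqrt_pos.2 hpos).ne'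
      simp only [Nat.add_sub_cancel, Pi.mul_apply]
      have e : (4 - s^2) * (-(2*s) / (2 * Real.sqrt (4-s^2))) = - s * Real.sqrt (4-s^2) := by
        rw [mul_div_assoc', div_eq_iff (by positivity)]
        linear_combination (2 * s) * hsq
      rw [e]; push_cast; ring
    · apply Continuous.intervalIntegrable; fun_prop
  rw [intervalIntegral.integral_sub, intervalIntegral.integral_const_mul, intervalIntegral.integral_const_mul] at key
  · norm_num at key
    linarith
  · apply Continuous.intervalIntegrable; fun_prop
  · apply Continuous.intervalIntegrable; fun_prop

lemma semi_even (m : ℕ) : ∫ s in (-2:ℝ)..2, s^(2*m) * Real.sqrt (4 - s^2) = 2 * π * sc (2*m) := by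
  induction m with
  | zero => simp [semi_zero, sc_zero]
  | succ m ih =>
    have h1 := semi_step m
    have h2 := sc_step m
    rw [ih] at h1
    have h5 : (m:ℝ)+2 ≠ 0 := by positivity
    apply mul_left_cancel₀ h5
    rw [h1]
    linear_combination -(2 * π) * h2

lemma semi (l : ℕ) : ∫ s in (-2:ℝ)..2, s^l * Real.sqrt (4 - s^2) = 2 * π * sc l := by
  by_cases hl : Even l
  · obtain ⟨m, hm⟩ := hl
    rw [show l = 2 * m by omega]; exact semi_even m
  · rw [sc_odd hl]
    have := intervalIntegral.integral_comp_neg (a := -2) (b := 2) (fun s : ℝ => s^l * Real.sqrt (4 - s^2))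
    simp only [(Nat.not_even_iff_odd.1 hl).neg_pow, neg_sq, neg_mul, intervalIntegral.integral_neg, neg_neg] at this
    linarith

lemma semi_full (k : ℕ) (a v : ℝ) : ∫ s, (a * s + v)^k * Real.sqrt (4 - s^2) =
    2 * π * ∑ l ∈ range (k+1), (k.choose l : ℝ) * v^(k-l) * (a^l * sc l) := by
  have h1 : ∫ s, (a * s + v)^k * Real.sqrt (4 - s^2) = ∫ s in (-2:ℝ)..2, (a * s + v)^k * Real.sqrt (4 - s^2) := by
    rw [intervalIntegral.integral_of_le (by norm_num), setIntegral_eq_integral_of_forall_compl_eq_zero]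
    intro s hs
    rw [Real.sqrt_eq_zero_of_nonpos, mul_zero]
    simp only [Set.mem_Ioc, not_and_or, not_lt, not_le] at hs
    rcases hs with h | h <;> nlinarith
  rw [h1]
  simp only [add_pow, Finset.sum_mul]
  rw [intervalIntegral.integral_finsetSum, Finset.mul_sum]
  · apply Finset.sum_congr rfl
    intro l _
    have : ∀ s : ℝ, (a*s)^l * v^(k-l) * (k.choose l : ℝ) * Real.sqrt (4-s^2) = (a^l * v^(k-l) * (k.choose l : ℝ)) * (s^l * Real.sqrt (4-s^2)) := by
      intro s; ring
    simp only [this, intervalIntegral.integral_const_mul, semi]; ring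
  · intro l _; apply Continuous.intervalIntegrable; fun_prop

def ker (c t u : ℝ) : ℝ := Real.sqrt (4*t - (u - c*t)^2) / (2 * π * t)
def gi (c u : ℝ) : ℝ := ∫ t in (0:ℝ)..1, ker c t u

lemma ker_mom (c : ℝ) (k : ℕ) {t : ℝ} (ht : 0 < t) : ∫ u, u^k * ker c t u = (BB c k).eval t := by
  have hs : 0 < Real.sqrt t := Real.sqrt_pos.2 ht
  have hs2 : Real.sqrt t ^ 2 = t := Real.sq_sqrt ht.le
  set r := Real.sqrt t with hr
  have h1 : ∫ u, u^k * ker c t u = ∫ u, (u + c*t)^k * ker c t (u + c*t) :=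
    (integral_add_right_eq_self (fun u => u^k * ker c t u) (c*t)).symm
  have h2 := Measure.integral_comp_mul_left (fun u => (u + c*t)^k * ker c t (u + c*t)) r
  have h3 : ∀ s, (r * s + c*t)^k * ker c t (r*s + c*t) = (1/(2*π*r)) * ((r * s + c*t)^k * Real.sqrt (4-s^2)) := by
    intro s
    have : Real.sqrt (4 * t - (r * s + c*t - c*t)^2) = r * Real.sqrt (4-s^2) := by
      rw [show 4 * t - (r * s + c*t - c*t)^2 = r^2 * (4-s^2) by rw [← hs2]; ring, Real.sqrt_mul (by positivity), Real.sqrt_sq hs.le]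
    rw [ker, this]
    have hpi := Real.pi_pos
    have e : r * Real.sqrt (4-s^2) / (2*π*t) = 1/(2*π*r) * Real.sqrt (4-s^2) := by
      rw [div_mul_eq_mul_div, div_eq_div_iff (by positivity) (by positivity)]
      linear_combination (2 * π * Real.sqrt (4-s^2)) * hs2
    rw [e]; ring
  simp only [h3] at h2
  rw [integral_const_mul, semi_full] at h2
  rw [h1]
  rw [abs_of_pos (by positivity), smul_eq_mul] at h2
  have hpi := Real.pi_pos
  have h4 : ∫ u, (u + c*t)^k * ker c t (u + c*t) = ∑ l ∈ range (k+1), (k.choose l : ℝ) * (c*t)^(k-l) * (r^l * sc l) := by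
    field_simp at h2
    rw [← h2]
    apply Finset.sum_congr rfl
    intro l _; ring
  rw [h4, BB_eval, AP]
  apply Finset.sum_congr rfl
  intro l _
  congr 1
  by_cases hl : Even l
  · obtain ⟨m, rfl⟩ := hl
    rw [ta, show (m+m)/2 = m by omega, ← hs2]; ring
  · simp [ta, sc_odd hl]

lemma ker_nonneg (c u : ℝ) {t : ℝ} (ht : 0 ≤ t) : 0 ≤ ker c t u := by
  unfold ker; positivity

lemma ker_le (c u : ℝ) {t : ℝ} (ht : 0 < t) : ker c t u ≤ t^(-(1/2):ℝ) := by
  have hs : 0 < Real.sqrt t := Real.sqrt_pos.2 ht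
  have hs2 : Real.sqrt t ^ 2 = t := Real.sq_sqrt ht.le
  rw [Real.rpow_neg ht.le, ← Real.sqrt_eq_rpow]
  have h1 : Real.sqrt (4*t - (u-c*t)^2) ≤ 2 * Real.sqrt t := by
    rw [Real.sqrt_le_left (by positivity)]
    nlinarith [sq_nonneg (u-c*t)]
  rw [ker, div_le_iff₀ (by positivity)]
  refine h1.trans ?_
  have : (Real.sqrt t)⁻¹ * (2*π*t) = 2 * π * Real.sqrt t := by
    nth_rewrite 2 [← hs2]; field_simp
  rw [this]
  have := Real.pi_gt_three
  nlinarith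

lemma ker_zero {c : ℝ} (hc : 0 ≤ c) {u t : ℝ} (ht : 0 < t) (ht1 : t ≤ 1) (hu : c + 2 ≤ |u|) : ker c t u = 0 := by
  rw [ker, Real.sqrt_eq_zero_of_nonpos, zero_div]
  have h1 : 2 ≤ |u - c*t| := by
    have : |u| ≤ |u - c*t| + |c*t| := by
      have := abs_add_le (u - c*t) (c*t); simpa using this
    rw [abs_of_nonneg (by positivity : 0 ≤ c*t)] at this
    nlinarith
  have : 2^2 ≤ (u-c*t)^2 := by rw [← sq_abs (u-c*t)]; exact pow_le_pow_left₀ (by norm_num) h1 2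
  linarith

lemma rpow_int : IntervalIntegrable (fun t : ℝ => t^(-(1/2):ℝ)) volume 0 1 :=
  intervalIntegral.intervalIntegrable_rpow' (by norm_num)

lemma ker_meas (c : ℝ) : Measurable (fun p : ℝ × ℝ => ker c p.1 p.2) := by
  unfold ker; fun_prop

lemma gi_cont (c : ℝ) : Continuous (gi c) := by
  unfold gi
  apply intervalIntegral.continuous_of_dominated_interval (bound := fun t => t^(-(1/2):ℝ))
  · intro u
    exact ((ker_meas c).comp (measurable_id.prodMk measurable_const)).aestronglyMeasurable
  · intro u
    refine Eventually.of_forall (fun t ht => ?_)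
    rw [Set.uIoc_of_le zero_le_one] at ht
    rw [Real.norm_of_nonneg (ker_nonneg c u ht.1.le)]
    exact ker_le c u ht.1
  · exact rpow_int
  · refine Eventually.of_forall (fun _ _ => ?_)
    unfold ker; fun_prop

lemma gi_nonneg (c u : ℝ) : 0 ≤ gi c u :=
  intervalIntegral.integral_nonneg zero_le_one (fun t ht => ker_nonneg c u ht.1)

lemma gi_zero {c : ℝ} (hc : 0 ≤ c) {u : ℝ} (hu : c + 2 ≤ |u|) : gi c u = 0 := by
  rw [gi, intervalIntegral.integral_of_le zero_le_one, setIntegral_congr_fun (g := fun _ => 0) measurableSet_Ioc]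
  · simp
  · intro t ht; exact ker_zero hc ht.1 ht.2 hu

lemma gi_mom {c : ℝ} (hc : 0 ≤ c) (k : ℕ) : ∫ u, u^k * gi c u = ∫ t in (0:ℝ)..1, (BB c k).eval t := by
  have h1 : ∀ u, u^k * gi c u = ∫ t in Set.Ioc (0:ℝ) 1, u^k * ker c t u := by
    intro u
    rw [integral_const_mul, gi, intervalIntegral.integral_of_le zero_le_one]
  simp only [h1]
  rw [integral_integral_swap, intervalIntegral.integral_of_le zero_le_one]
  · apply setIntegral_congr_fun measurableSet_Ioc
    intro t ht
    exact ker_mom c k ht.1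
  · have hI : Integrable (fun p : ℝ × ℝ => (Set.indicator (Set.Icc (-(c+2)) (c+2)) (fun _ => (c+2)^k) p.1) * p.2^(-(1/2):ℝ))
        (volume.prod (volume.restrict (Set.Ioc (0:ℝ) 1))) := by
      refine Integrable.mul_prod (f := Set.indicator (Set.Icc (-(c+2)) (c+2)) (fun _ => (c+2)^k)) (g := fun t : ℝ => t^(-(1/2):ℝ)) ?_ ?_
      · rw [integrable_indicator_iff measurableSet_Icc]
        exact integrableOn_const (by simp)
      · have := rpow_int
        rw [intervalIntegrable_iff_integrableOn_Ioc_of_le zero_le_one] at this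
        exact this
    refine hI.mono' ?_ ?_
    · apply Measurable.aestronglyMeasurable
      have h1 : Measurable (fun p : ℝ × ℝ => p.1^k) := by fun_prop
      have h2 : Measurable (fun p : ℝ × ℝ => ker c p.2 p.1) := (ker_meas c).comp measurable_swap
      exact h1.mul h2
    · have : (volume : Measure ℝ).prod (volume.restrict (Set.Ioc (0:ℝ) 1)) = ((volume : Measure ℝ).prod (volume : Measure ℝ)).restrict (Set.univ ×ˢ Set.Ioc (0:ℝ) 1) := by
        rw [← Measure.prod_restrict, Measure.restrict_univ]
      rw [this, ae_restrict_iff' (MeasurableSet.univ.prod measurableSet_Ioc)]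
      refine Eventually.of_forall ?_
      rintro ⟨u, t⟩ ht
      simp only [Set.mem_prod, Set.mem_univ, true_and] at ht
      simp only [Function.uncurry]
      rw [norm_mul, norm_pow, Real.norm_of_nonneg (ker_nonneg c u ht.1.le)]
      by_cases hu : u ∈ Set.Icc (-(c+2)) (c+2)
      · rw [Set.indicator_of_mem hu]
        have : ‖u‖ ≤ c + 2 := abs_le.2 hu
        have := ker_le c u ht.1
        have := ker_nonneg c u ht.1.le
        gcongr
      · rw [Set.indicator_of_notMem hu, ker_zero hc ht.1 ht.2]
        · simp
        · by_contra h
          exact hu (abs_le.1 (not_le.1 h).le)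

end BLS

namespace BLS

lemma hd_arcsin {f : ℝ → ℝ} {f' x w : ℝ} (hf : HasDerivAt f f' x) (hw : 0 < w) (h : 1 - f x ^ 2 = w^2) :
    HasDerivAt (fun t => Real.arcsin (f t)) (f' / w) x := by
  have h1 : f x ≠ -1 := by intro e; rw [e] at h; nlinarith [pow_pos hw 2]
  have h2 : f x ≠ 1 := by intro e; rw [e] at h; nlinarith [pow_pos hw 2]
  have := (Real.hasDerivAt_arcsin h1 h2).comp x hf
  refine HasDerivAt.congr_deriv this ?_
  rw [h, Real.sqrt_sq hw.le]; ring

lemma hd_arccos {f : ℝ → ℝ} {f' x w : ℝ} (hf : HasDerivAt f f' x) (hw : 0 < w) (h : 1 - f x ^ 2 = w^2) :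
    HasDerivAt (fun t => Real.arccos (f t)) (-f' / w) x := by
  have h1 : f x ≠ -1 := by intro e; rw [e] at h; nlinarith [pow_pos hw 2]
  have h2 : f x ≠ 1 := by intro e; rw [e] at h; nlinarith [pow_pos hw 2]
  have := (Real.hasDerivAt_arccos h1 h2).comp x hf
  refine HasDerivAt.congr_deriv this ?_
  rw [h, Real.sqrt_sq hw.le]; ring

lemma ker_int (c u : ℝ) {a b : ℝ} (ha : 0 ≤ a) (hab : a ≤ b) :
    IntervalIntegrable (fun t => ker c t u) volume a b := by
  have h1 : IntervalIntegrable (fun t : ℝ => t^(-(1/2):ℝ)) volume a b :=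
    intervalIntegral.intervalIntegrable_rpow' (by norm_num)
  refine h1.mono_fun ?_ ?_
  · have : Measurable (fun t : ℝ => ker c t u) := by unfold ker; fun_prop
    exact this.aestronglyMeasurable
  · rw [EventuallyLE, ae_restrict_iff' measurableSet_uIoc]
    refine Eventually.of_forall (fun t ht => ?_)
    rw [Set.uIoc_of_le hab] at ht
    have ht0 : 0 < t := lt_of_le_of_lt ha ht.1
    rw [Real.norm_of_nonneg (ker_nonneg c u ht0.le), Real.norm_of_nonneg (by positivity)]
    exact ker_le c u ht0

lemma ker_q0 {c t u : ℝ} (h : 4*t - (u - c*t)^2 ≤ 0) : ker c t u = 0 := by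
  rw [ker, Real.sqrt_eq_zero_of_nonpos h, zero_div]

/-- antiderivative, with `2 s c = p^2 - 1` -/
def HH (c s p t : ℝ) : ℝ := (2/π) * (s * Real.arcsin ((2*s+c*t)/(2*Real.sqrt t * p))
      + (1/(2*c)) * Real.arccos ((1+p^2-c^2*t)/(2*p))
      + (1/4) * Real.sqrt (4*t-(2*s-c*t)^2))

lemma HH_deriv {c s p t : ℝ} (hc : 0 < c) (hp : 0 < p) (hs : 2*s*c = p^2-1) (ht : 0 < t)
    (hQ : 0 < 4*t - (2*s-c*t)^2) : HasDerivAt (HH c s p) (ker c t (2*s)) t := by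
  have hr : 0 < Real.sqrt t := Real.sqrt_pos.2 ht
  have hr2 : Real.sqrt t ^ 2 = t := Real.sq_sqrt ht.le
  have hR : 0 < Real.sqrt (4*t-(2*s-c*t)^2) := Real.sqrt_pos.2 hQ
  have hR2 : Real.sqrt (4*t-(2*s-c*t)^2) ^ 2 = 4*t-(2*s-c*t)^2 := Real.sq_sqrt hQ.le
  have dr : HasDerivAt (fun t => Real.sqrt t) (1/(2*Real.sqrt t)) t := Real.hasDerivAt_sqrt ht.ne'
  have dq : HasDerivAt (fun t : ℝ => 4*t-(2*s-c*t)^2) (4 + 2*c*(2*s-c*t)) t := by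
    have h1 : HasDerivAt (fun t : ℝ => 2*s-c*t) (-c) t := by
      simpa using ((hasDerivAt_id t).const_mul c).const_sub (2*s)
    have h2 : HasDerivAt (fun t : ℝ => 4*t) 4 t := by simpa using (hasDerivAt_id t).const_mul (4:ℝ)
    refine HasDerivAt.congr_deriv (h2.sub (h1.pow 2)) ?_
    push_cast; ring
  have dR := dq.sqrt hQ.ne'
  have dnum : HasDerivAt (fun t : ℝ => 2*s+c*t) c t := by
    simpa using ((hasDerivAt_id t).const_mul c).const_add (2*s)
  have dden : HasDerivAt (fun t : ℝ => 2*Real.sqrt t * p) (p/Real.sqrt t) t := by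
    refine HasDerivAt.congr_deriv ((dr.const_mul 2).mul_const p) ?_
    field_simp
  set r := Real.sqrt t with hrdef
  set R := Real.sqrt (4*t-(2*s-c*t)^2) with hRdef
  have dA := dnum.div dden (by positivity)
  have dB : HasDerivAt (fun t : ℝ => (1+p^2-c^2*t)/(2*p)) (-c^2/(2*p)) t := by
    have : HasDerivAt (fun t : ℝ => 1+p^2-c^2*t) (-c^2) t := by
      simpa using ((hasDerivAt_id t).const_mul (c^2)).const_sub (1+p^2)
    exact this.div_const _
  have d1 := hd_arcsin (w := R/(2*r*p)) dA (by positivity) (by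
    simp only [Pi.div_apply]
    rw [div_pow, div_pow, ← hrdef, hR2, one_sub_div (by positivity)]
    congr 1
    rw [mul_pow, mul_pow, hr2]
    linear_combination (-4*t) * hs)
  have d2 := hd_arccos (w := c*R/(2*p)) dB (by positivity) (by
    rw [div_pow, div_pow, mul_pow c, hR2, one_sub_div (by positivity)]
    congr 1
    have e : p^2 = 1 + 2*s*c := by linarith
    rw [mul_pow, e]; ring)
  have := (((d1.const_mul s).add (d2.const_mul (1/(2*c)))).add (dR.const_mul (1/4))).const_mul (2/π)
  refine HasDerivAt.congr_deriv this ?_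
  rw [ker, ← hRdef, ← hrdef]
  have e1 : (c * (2 * r * p) - (2 * s + c * t) * (p / r)) / (2 * r * p) ^ 2 / (R / (2 * r * p)) = (c*t-2*s)/(2*t*R) := by
    rw [← hr2]; field_simp; ring
  have e2 : -(-c ^ 2 / (2 * p)) / (c * R / (2 * p)) = c / R := by field_simp
  rw [e1, e2]
  have hpi := Real.pi_pos
  have e3 : R / (2*π*t) = (4*t - (2*s-c*t)^2)/(2*π*t*R) := by rw [← hR2]; field_simp
  rw [e3]; field_simp; ring

lemma HH_cont {c s p a b : ℝ} (hp : 0 < p) (h : s = 0 ∨ 0 < a) : ContinuousOn (HH c s p) (Set.Icc a b) := by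
  unfold HH
  have hA : ContinuousOn (fun t => s * Real.arcsin ((2*s+c*t)/(2*Real.sqrt t * p))) (Set.Icc a b) := by
    rcases h with h | h
    · simp only [h, zero_mul]; exact continuousOn_const
    · apply ContinuousOn.mul continuousOn_const
      apply Real.continuous_arcsin.comp_continuousOn
      apply ContinuousOn.div (by fun_prop) (by fun_prop)
      intro t ht
      have : 0 < Real.sqrt t := Real.sqrt_pos.2 (lt_of_lt_of_le h ht.1)
      positivity
  have hB : Continuous (fun t : ℝ => Real.arccos ((1+p^2-c^2*t)/(2*p))) := by
    apply Real.continuous_arccos.comp; fun_prop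
  have hC : Continuous (fun t : ℝ => Real.sqrt (4*t-(2*s-c*t)^2)) := by fun_prop
  exact ((hA.add (continuousOn_const.mul hB.continuousOn)).add (continuousOn_const.mul hC.continuousOn)).const_smul (2/π)

lemma HH_t1 {c s p : ℝ} (hc : 0 < c) (hp : 0 < p) (hs : 2*s*c = p^2-1) : HH c s p (((1-p)/c)^2) = |s| := by
  have hs' : s = (p^2-1)/(2*c) := by field_simp; linarith
  have hpi := Real.pi_pos
  have e1 : (1+p^2-c^2*((1-p)/c)^2)/(2*p) = 1 := by field_simp; ring
  have e2 : 4*((1-p)/c)^2 - (2*s-c*((1-p)/c)^2)^2 = 0 := by rw [hs']; field_simp; ring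
  have e3 : 2*s + c*((1-p)/c)^2 = 2*p*(p-1)/c := by rw [hs']; field_simp; ring
  rw [HH, e1, e2, e3, Real.sqrt_sq_eq_abs, Real.arccos_one, Real.sqrt_zero]
  rcases lt_trichotomy p 1 with h | h | h
  · have h1 : 0 < 1 - p := by linarith
    rw [abs_of_pos (by positivity), abs_of_nonpos]
    · have : 2 * p * (p - 1) / c / (2 * ((1 - p) / c) * p) = -1 := by field_simp; ring
      rw [this, Real.arcsin_neg_one]; field_simp; ring
    · rw [hs']; apply div_nonpos_of_nonpos_of_nonneg <;> nlinarith
  · have : s = 0 := by rw [hs', h]; simp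
    rw [this]; simp
  · have h1 : 0 < p - 1 := by linarith
    have h2 : |(1-p)/c| = (p-1)/c := by rw [abs_of_neg]; · ring
                                        · apply div_neg_of_neg_of_pos <;> linarith
    rw [h2, abs_of_nonneg]
    · have : 2 * p * (p - 1) / c / (2 * ((p-1) / c) * p) = 1 := by field_simp
      rw [this, Real.arcsin_one]; field_simp; ring
    · rw [hs']; apply div_nonneg <;> nlinarith

lemma HH_t2 {c s p : ℝ} (hc : 0 < c) (hp : 0 < p) (hs : 2*s*c = p^2-1) : HH c s p (((1+p)/c)^2) = s+1/c := by
  have hs' : s = (p^2-1)/(2*c) := by field_simp; linarith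
  have hpi := Real.pi_pos
  have e1 : (1+p^2-c^2*((1+p)/c)^2)/(2*p) = -1 := by field_simp; ring
  have e2 : 4*((1+p)/c)^2 - (2*s-c*((1+p)/c)^2)^2 = 0 := by rw [hs']; field_simp; ring
  have e3 : 2*s + c*((1+p)/c)^2 = 2*p*(p+1)/c := by rw [hs']; field_simp; ring
  rw [HH, e1, e2, e3, Real.sqrt_sq_eq_abs, Real.arccos_neg_one, Real.sqrt_zero, abs_of_pos (by positivity)]
  have : 2 * p * (p + 1) / c / (2 * ((1 + p) / c) * p) = 1 := by field_simp; ring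
  rw [this, Real.arcsin_one]; field_simp; ring

lemma Q_fac {c s p t : ℝ} (hs : 2*s*c = p^2-1) :
    c^2 * (4*t - (2*s-c*t)^2) = (c^2*t - (1-p)^2) * ((1+p)^2 - c^2*t) := by
  have : (c^2*t - (1-p)^2) * ((1+p)^2 - c^2*t) = 4*p^2*1 - (1+p^2-c^2*t)^2 := by ring
  have e : p^2 = 1 + 2*s*c := by linarith
  rw [this, e]; ring

lemma int_zero {c u a b : ℝ} (hab : a ≤ b) (h : ∀ t, a < t → t ≤ b → 4*t - (u-c*t)^2 ≤ 0) :
    ∫ t in a..b, ker c t u = 0 := by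
  rw [intervalIntegral.integral_of_le hab, setIntegral_congr_fun (g := fun _ => 0) measurableSet_Ioc]
  · simp
  · intro t ht; exact ker_q0 (h t ht.1 ht.2)

lemma int_mid {c s p T : ℝ} (hc : 0 < c) (hp : 0 < p) (hs : 2*s*c = p^2-1)
    (h1 : ((1-p)/c)^2 ≤ T) (h2 : T ≤ ((1+p)/c)^2) :
    ∫ t in (0:ℝ)..T, ker c t (2*s) = HH c s p T - |s| := by
  have h0 : (0:ℝ) ≤ ((1-p)/c)^2 := by positivity
  rw [← intervalIntegral.integral_add_adjacent_intervals (ker_int c (2*s) le_rfl h0) (ker_int c (2*s) h0 h1)]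
  have hc2 : 0 < c^2 := by positivity
  rw [int_zero h0, zero_add, ← HH_t1 hc hp hs]
  · apply intervalIntegral.integral_eq_sub_of_hasDerivAt_of_le h1
    · apply HH_cont hp
      by_cases h : p = 1
      · left; rw [h] at hs
        have : s * c = 0 := by nlinarith
        rcases mul_eq_zero.1 this with h | h
        · exact h
        · exact absurd h hc.ne'
      · right
        have : (1-p)/c ≠ 0 := div_ne_zero (sub_ne_zero.2 (Ne.symm h)) hc.ne'
        positivity
    · intro t ht
      have ht0 : 0 < t := lt_of_le_of_lt h0 ht.1
      apply HH_deriv hc hp hs ht0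
      have a1 := ht.1
      have a2 := lt_of_lt_of_le ht.2 h2
      rw [div_pow, div_lt_iff₀ hc2] at a1
      rw [div_pow, lt_div_iff₀ hc2] at a2
      have := Q_fac (t := t) hs
      have h3 : 0 < (c^2*t - (1-p)^2) * ((1+p)^2 - c^2*t) := mul_pos (by linarith) (by linarith)
      rw [← this] at h3
      exact pos_of_mul_pos_right h3 hc2.le
    · exact ker_int c (2*s) h0 h1
  · intro t ht0 ht
    rw [div_pow, le_div_iff₀ hc2] at ht
    have := Q_fac (t := t) hs
    have h3 : (c^2*t - (1-p)^2) * ((1+p)^2 - c^2*t) ≤ 0 := mul_nonpos_of_nonpos_of_nonneg (by linarith) (by nlinarith)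
    rw [← this] at h3
    exact nonpos_of_mul_nonpos_right h3 hc2

lemma gi_a {c s p : ℝ} (hc : 0 < c) (hp : 0 < p) (hs : 2*s*c = p^2-1) (h1 : 1 ≤ ((1-p)/c)^2) : gi c (2*s) = 0 := by
  rw [gi]; apply int_zero zero_le_one
  intro t ht0 ht
  have hc2 : 0 < c^2 := by positivity
  rw [div_pow, le_div_iff₀ hc2] at h1
  have := Q_fac (t := t) hs
  have h3 : (c^2*t - (1-p)^2) * ((1+p)^2 - c^2*t) ≤ 0 := mul_nonpos_of_nonpos_of_nonneg (by nlinarith) (by nlinarith)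
  rw [← this] at h3
  exact nonpos_of_mul_nonpos_right h3 hc2

lemma gi_c {c s p : ℝ} (hc : 0 < c) (hp : 0 < p) (hs : 2*s*c = p^2-1) (h1 : ((1+p)/c)^2 ≤ 1) :
    gi c (2*s) = s + 1/c - |s| := by
  have h0 : (0:ℝ) ≤ ((1+p)/c)^2 := by positivity
  have hc2 : 0 < c^2 := by positivity
  rw [gi, ← intervalIntegral.integral_add_adjacent_intervals (ker_int c (2*s) le_rfl h0) (ker_int c (2*s) h0 h1)]
  rw [int_mid hc hp hs _ le_rfl, HH_t2 hc hp hs, int_zero h1, add_zero]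
  · intro t ht _
    rw [div_pow, div_lt_iff₀ hc2] at ht
    have := Q_fac (t := t) hs
    have h3 : (c^2*t - (1-p)^2) * ((1+p)^2 - c^2*t) ≤ 0 := mul_nonpos_of_nonneg_of_nonpos (by nlinarith) (by linarith)
    rw [← this] at h3
    exact nonpos_of_mul_nonpos_right h3 hc2
  · rw [div_pow, div_pow]; gcongr ?_ / _; nlinarith

lemma gi_b {c s p : ℝ} (hc : 0 < c) (hp : 0 < p) (hs : 2*s*c = p^2-1) (h1 : ((1-p)/c)^2 ≤ 1) (h2 : 1 ≤ ((1+p)/c)^2) :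
    gi c (2*s) = hshape c s - |s| := by
  rw [gi, int_mid hc hp hs h1 h2, HH, hshape, if_neg hc.ne']
  have e : 1 + 2*s*c = p^2 := by linarith
  rw [show 2+2*s*c-c^2 = 1+p^2-c^2 by linarith, e, Real.sqrt_sq hp.le]
  simp

lemma Omega_pos {c : ℝ} (hc : 0 < c) (s : ℝ) : Omega c s = |s| + gi c (2*s) := by
  rcases le_or_gt (1+2*s*c) 0 with hD | hD
  · have hg : gi c (2*s) = 0 := by
      rw [gi]; apply int_zero zero_le_one
      intro t _ _
      have e : c^2 * (4*t - (2*s-c*t)^2) = 4*(1+2*s*c) - (2+2*s*c-c^2*t)^2 := by ring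
      have hc2 : 0 < c^2 := by positivity
      have : c^2 * (4*t - (2*s-c*t)^2) ≤ 0 := by rw [e]; nlinarith [sq_nonneg (2+2*s*c-c^2*t)]
      exact nonpos_of_mul_nonpos_right this hc2
    rw [hg, add_zero]
    have hsn : s ≤ 0 := by nlinarith
    have h3 : c - 2 ≤ 2*s → c = 1 := by
      intro h
      have : (c-1)^2 ≤ 0 := by nlinarith
      nlinarith [sq_nonneg (c-1), pow_eq_zero_iff (two_ne_zero) |>.1 (le_antisymm this (sq_nonneg (c-1)))]
    unfold Omega
    split_ifs with g1 g2 g3 g4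
    · have hc1 := h3 g2.1
      subst hc1
      have : s = -(1/2) := by linarith [g2.1]
      subst this
      have hpi := Real.pi_pos
      norm_num [hshape, abs_of_neg]
      field_simp
    · rfl
    · have : s = -(1/(2*c)) := by
        have h5 : 2*s ≤ -(1/c) := by
          rw [← neg_div, le_div_iff₀ hc]; linarith
        have : 1/(2*c) = (1/c)/2 := by field_simp
        linarith [g3.1]
      rw [abs_of_nonpos hsn, this]; field_simp; ring
    · exact absurd (h3 g4.1) (by linarith)
    · rfl
  · obtain ⟨p, hp, hp2⟩ : ∃ p : ℝ, 0 < p ∧ p^2 = 1+2*s*c := ⟨_, Real.sqrt_pos.2 hD, Real.sq_sqrt hD.le⟩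
    have hs : 2*s*c = p^2-1 := by linarith
    have hc2 : 0 < c^2 := by positivity
    have q1 : c - 2 ≤ 2*s ↔ (c-1)^2 ≤ p^2 := by
      have e : c * (2*s - (c-2)) = p^2 - (c-1)^2 := by linear_combination hs
      constructor
      · intro h; nlinarith [mul_nonneg hc.le (sub_nonneg.2 h)]
      · intro h
        have : 0 ≤ c * (2*s - (c-2)) := by linarith
        linarith [nonneg_of_mul_nonneg_right this hc]
    have q2 : 2*s ≤ c + 2 ↔ p ≤ c + 1 := by
      have e : c * (c+2 - 2*s) = (c+1)^2 - p^2 := by linear_combination - hs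
      constructor
      · intro h; have := mul_nonneg hc.le (sub_nonneg.2 h)
        exact (abs_le_of_sq_le_sq (show p^2 ≤ (c+1)^2 by linarith) (by linarith) |> le_trans (le_abs_self p))
      · intro h
        have : 0 ≤ c * (c+2-2*s) := by rw [e]; nlinarith
        linarith [nonneg_of_mul_nonneg_right this hc]
    have ta : 1 ≤ ((1-p)/c)^2 ↔ c^2 ≤ (1-p)^2 := by rw [div_pow, le_div_iff₀ hc2, one_mul]
    have ta' : ((1-p)/c)^2 ≤ 1 ↔ (1-p)^2 ≤ c^2 := by rw [div_pow, div_le_iff₀ hc2, one_mul]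
    have tc : ((1+p)/c)^2 ≤ 1 ↔ (1+p)^2 ≤ c^2 := by rw [div_pow, div_le_iff₀ hc2, one_mul]
    have tc' : 1 ≤ ((1+p)/c)^2 ↔ c^2 ≤ (1+p)^2 := by rw [div_pow, le_div_iff₀ hc2, one_mul]
    have hmid : (c - 2 ≤ 2*s ∧ 2*s ≤ c+2) → hshape c s = |s| + gi c (2*s) := by
      rintro ⟨a, b⟩
      rw [q1] at a; rw [q2] at b
      have a' := abs_le_of_sq_le_sq' a hp.le
      rw [gi_b hc hp hs (ta'.2 (by nlinarith)) (tc'.2 (by nlinarith))]; ring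
    unfold Omega
    split_ifs with g1 g2 g3 g4
    · exact hmid g2
    · rw [q1, q2, not_and_or, not_le, not_le] at g2
      rw [gi_a hc hp hs, add_zero]
      rw [ta]
      rcases g2 with g | g
      · have := (le_abs_self p).trans_lt (abs_lt_of_sq_lt_sq (show p^2 < (1-c)^2 by linarith [show (1-c)^2 = (c-1)^2 by ring]) (by linarith))
        nlinarith
      · nlinarith
    · have g := g3.2
      have e : c * (2*s - (c-2)) = p^2 - (c-1)^2 := by linear_combination hs
      have : p^2 ≤ (c-1)^2 := by nlinarith [mul_nonneg hc.le (sub_nonneg.2 g)]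
      have := (abs_le_of_sq_le_sq this (by linarith)) |> le_trans (le_abs_self p)
      rw [gi_c hc hp hs (tc.2 (by nlinarith))]; ring
    · exact hmid g4
    · have g0 : -(1/c) ≤ 2*s := by
        rw [← neg_div, div_le_iff₀ hc]; linarith
      have g : ¬ (2*s ≤ c-2) := fun h => g3 ⟨g0, h⟩
      have g' : ¬ (2*s ≤ c+2) := fun h => g4 ⟨by linarith, h⟩
      rw [q2, not_le] at g'
      rw [gi_a hc hp hs (ta.2 (by nlinarith)), add_zero]

def H0 (s t : ℝ) : ℝ := (2/π) * (s * Real.arcsin (s/Real.sqrt t) + Real.sqrt (t-s^2))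

lemma H0_deriv {s t : ℝ} (hQ : 0 < t - s^2) : HasDerivAt (H0 s) (ker 0 t (2*s)) t := by
  have ht : 0 < t := by nlinarith [sq_nonneg s]
  have hr : 0 < Real.sqrt t := Real.sqrt_pos.2 ht
  have hr2 : Real.sqrt t ^ 2 = t := Real.sq_sqrt ht.le
  have hR : 0 < Real.sqrt (t-s^2) := Real.sqrt_pos.2 hQ
  have hR2 : Real.sqrt (t-s^2) ^ 2 = t-s^2 := Real.sq_sqrt hQ.le
  have dr : HasDerivAt (fun t => Real.sqrt t) (1/(2*Real.sqrt t)) t := Real.hasDerivAt_sqrt ht.ne'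
  have dR := ((hasDerivAt_id t).sub_const (s^2)).sqrt hQ.ne'
  have dA := (hasDerivAt_const t s).div dr hr.ne'
  have hker : ker 0 t (2*s) = (t-s^2)/(π * t * Real.sqrt (t-s^2)) := by
    rw [ker, show 4*t-(2*s-0*t)^2 = 2^2*(t-s^2) by ring, Real.sqrt_mul (by norm_num), Real.sqrt_sq (by norm_num)]
    have hpi := Real.pi_pos
    rw [div_eq_div_iff (by positivity) (by positivity)]
    linear_combination (2*π*t)*hR2
  rw [hker]
  set r := Real.sqrt t with hrdef
  set R := Real.sqrt (t-s^2) with hRdef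
  have d1 := hd_arcsin (w := R/r) dA (by positivity) (by
    simp only [Pi.div_apply]
    rw [div_pow, div_pow, ← hrdef, hR2, one_sub_div (by positivity), hr2])
  have := ((d1.const_mul s).add dR).const_mul (2/π)
  refine HasDerivAt.congr_deriv this ?_
  have hpi := Real.pi_pos
  simp only [id]
  rw [← hRdef]
  have e1 : (0 * r - s * (1 / (2 * r))) / r ^ 2 / (R / r) = -s/(2*t*R) := by
    rw [← hr2]; field_simp; ring
  rw [e1]; field_simp; ring

lemma Omega_zero (s : ℝ) : Omega 0 s = |s| + gi 0 (2*s) := by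
  have hpi := Real.pi_pos
  unfold Omega
  rw [if_pos zero_le_one]
  split_ifs with h
  · have hs1 : |s| ≤ 1 := abs_le.2 ⟨by linarith [h.1], by linarith [h.2]⟩
    have h1 : s^2 ≤ 1 := by rw [← sq_abs]; nlinarith [abs_nonneg s]
    have h0 := sq_nonneg s
    have e1 : H0 s (s^2) = |s| := by
      rw [H0, Real.sqrt_sq_eq_abs, sub_self, Real.sqrt_zero]
      rcases lt_trichotomy s 0 with g | g | g
      · rw [abs_of_neg g, div_neg, div_self g.ne, Real.arcsin_neg_one]; field_simp; ring
      · simp [g]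
      · rw [abs_of_pos g, div_self g.ne', Real.arcsin_one]; field_simp; ring
    have e2 : gi 0 (2*s) = H0 s 1 - H0 s (s^2) := by
      rw [gi, ← intervalIntegral.integral_add_adjacent_intervals (ker_int 0 (2*s) le_rfl h0) (ker_int 0 (2*s) h0 h1), int_zero h0, zero_add]
      · apply intervalIntegral.integral_eq_sub_of_hasDerivAt_of_le h1
        · unfold H0
          have hA : ContinuousOn (fun t => s * Real.arcsin (s/Real.sqrt t)) (Set.Icc (s^2) 1) := by
            by_cases hs : s = 0
            · simp only [hs, zero_mul]; exact continuousOn_const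
            · apply ContinuousOn.mul continuousOn_const
              apply Real.continuous_arcsin.comp_continuousOn
              apply ContinuousOn.div (by fun_prop) (by fun_prop)
              intro t ht
              have h5 : 0 < s^2 := by positivity
              exact (Real.sqrt_pos.2 (lt_of_lt_of_le h5 ht.1)).ne'
          have hC : Continuous (fun t : ℝ => Real.sqrt (t-s^2)) := by fun_prop
          exact (hA.add hC.continuousOn).const_smul (2/π)
        · intro t ht; exact H0_deriv (by linarith [ht.1])
        · exact ker_int 0 (2*s) h0 h1
      · intro t _ ht; nlinarith
    rw [e2, e1, H0, hshape, if_pos rfl]; simp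
  · rw [gi, int_zero zero_le_one, add_zero]
    intro t _ ht
    have : 1 ≤ s^2 := by
      by_contra hh
      have := abs_lt_of_sq_lt_sq (show s^2 < 1^2 by linarith) (by norm_num)
      rw [abs_lt] at this
      exact h ⟨by linarith, by linarith⟩
    nlinarith

lemma Omega_eq {c : ℝ} (hc : 0 ≤ c) (s : ℝ) : Omega c s = |s| + gi c (2*s) := by
  rcases hc.eq_or_lt with h | h
  · rw [← h]; exact Omega_zero s
  · exact Omega_pos h s

end BLS

namespace BLS
open Finset

lemma mem_cells {n : ℕ} {lam : Nat.Partition n} {i j : ℕ} :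
    (i, j) ∈ cellsOf lam ↔ 1 ≤ i ∧ 1 ≤ j ∧ j ≤ rowLen lam i := by
  simp only [cellsOf, mem_filter, mem_product, mem_Icc]
  constructor
  · rintro ⟨⟨h1, h2⟩, h3⟩; exact ⟨h1.1, h2.1, h3⟩
  · rintro ⟨h1, h2, h3⟩
    exact ⟨⟨⟨h1, (rowLen_pos_le lam (by omega)).trans (card_le lam)⟩, h2, h3.trans (rowLen_le lam i)⟩, h3⟩

lemma cells_down {n : ℕ} {lam : Nat.Partition n} {i j i' j' : ℕ} (h : (i, j) ∈ cellsOf lam)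
    (hi : i' ≤ i) (hj : j' ≤ j) (hi1 : 1 ≤ i') (hj1 : 1 ≤ j') : (i', j') ∈ cellsOf lam := by
  rw [mem_cells] at *
  exact ⟨hi1, hj1, hj.trans (h.2.2.trans (rowLen_anti lam hi))⟩

lemma cells_card {n : ℕ} (lam : Nat.Partition n) : (cellsOf lam).card = n := by
  have h := sum_cells lam (card_le lam) (fun _ _ => 1)
  have h2 := (mem_SS.1 (rows_mem (card_le lam))).2
  simp at h
  have h3 : ((∑ i, rows n lam i : ℕ) : ℝ) = n := by rw [h2]
  push_cast at h3
  rw [h3] at h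
  exact_mod_cast h

def nd {n : ℕ} (lam : Nat.Partition n) (d : ℤ) : ℕ :=
  ((cellsOf lam).filter (fun p => (p.2 : ℤ) - p.1 = d)).card

lemma down_Icc (S : Finset ℕ) (h0 : ∀ m ∈ S, 1 ≤ m) (h : ∀ m ∈ S, ∀ m', 1 ≤ m' → m' ≤ m → m' ∈ S) :
    S = Icc 1 S.card := by
  apply Finset.eq_of_subset_of_card_le
  · intro m hm
    rw [mem_Icc]
    refine ⟨h0 m hm, ?_⟩
    have : Icc 1 m ⊆ S := fun m' hm' => h m hm m' (mem_Icc.1 hm').1 (mem_Icc.1 hm').2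
    simpa using card_le_card this
  · simp

lemma nd_iff {n : ℕ} (lam : Nat.Partition n) (d : ℤ) {m : ℕ} (hm : 1 ≤ m) :
    (m + (-d).toNat, m + d.toNat) ∈ cellsOf lam ↔ m ≤ nd lam d := by
  set S := ((cellsOf lam).filter (fun p => (p.2 : ℤ) - p.1 = d)).image (fun p => min p.1 p.2) with hS
  have hmem : ∀ m, m ∈ S ↔ 1 ≤ m ∧ (m + (-d).toNat, m + d.toNat) ∈ cellsOf lam := by
    intro m
    rw [hS, Finset.mem_image]
    constructor
    · rintro ⟨⟨i, j⟩, hp, rfl⟩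
      rw [mem_filter] at hp
      obtain ⟨h1, h2⟩ := hp
      have h3 := mem_cells.1 h1
      simp only at h2 ⊢
      refine ⟨by omega, ?_⟩
      rw [show min i j + (-d).toNat = i by omega, show min i j + d.toNat = j by omega]
      exact h1
    · rintro ⟨h1, h2⟩
      refine ⟨_, mem_filter.2 ⟨h2, ?_⟩, ?_⟩
      · simp only; omega
      · simp only; omega
  have hcard : S.card = nd lam d := by
    rw [hS, nd, Finset.card_image_of_injOn]
    rintro ⟨i, j⟩ h ⟨i', j'⟩ h' he
    simp only [coe_filter, Set.mem_ofPred_eq] at h h' he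
    ext <;> simp only <;> omega
  have := down_Icc S (fun m hm => ((hmem m).1 hm).1) (by
    intro m hm m' h1 h2
    rw [hmem] at *
    exact ⟨h1, cells_down hm.2 (by omega) (by omega) (by omega) (by omega)⟩)
  have h2 : m ∈ S ↔ m ∈ Icc 1 S.card := by rw [← this]
  rw [hmem, mem_Icc, hcard] at h2
  tauto

lemma nd_cell {n : ℕ} {lam : Nat.Partition n} {i j : ℕ} (h : (i,j) ∈ cellsOf lam) :
    min i j ≤ nd lam ((j:ℤ) - i) := by
  have h3 := mem_cells.1 h
  rw [← nd_iff lam _ (by omega)]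
  rw [show min i j + (-((j:ℤ)-i)).toNat = i by omega, show min i j + ((j:ℤ)-i).toNat = j by omega]
  exact h

lemma nd_of {n : ℕ} (lam : Nat.Partition n) {d : ℤ} {i j : ℕ} (hd : (j:ℤ) - i = d) (h : (i,j) ∈ cellsOf lam) :
    min i j ≤ nd lam d := hd ▸ nd_cell h

lemma nd_succ {n : ℕ} (lam : Nat.Partition n) (d : ℤ) : nd lam (d+1) ≤ nd lam d + 1 := by
  by_contra hc
  have h1 := (nd_iff lam (d+1) (m := nd lam (d+1)) (by omega)).2 le_rfl
  have h2 : (nd lam (d+1) - 1 + (-d).toNat, nd lam (d+1) - 1 + d.toNat) ∈ cellsOf lam :=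
    cells_down h1 (by omega) (by omega) (by omega) (by omega)
  rw [nd_iff lam d (by omega)] at h2
  omega

lemma nd_pred {n : ℕ} (lam : Nat.Partition n) (d : ℤ) : nd lam d ≤ nd lam (d+1) + 1 := by
  by_contra hc
  have h1 := (nd_iff lam d (m := nd lam d) (by omega)).2 le_rfl
  have h2 : (nd lam d - 1 + (-(d+1)).toNat, nd lam d - 1 + (d+1).toNat) ∈ cellsOf lam :=
    cells_down h1 (by omega) (by omega) (by omega) (by omega)
  rw [nd_iff lam (d+1) (by omega)] at h2
  omega

lemma nd_mono {n : ℕ} (lam : Nat.Partition n) {d e : ℤ} (h : (0 ≤ d ∧ d ≤ e) ∨ (e ≤ d ∧ d ≤ 0)) : nd lam e ≤ nd lam d := by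
  by_contra hc
  have h1 := (nd_iff lam e (m := nd lam e) (by omega)).2 le_rfl
  have h2 : (nd lam e + (-d).toNat, nd lam e + d.toNat) ∈ cellsOf lam :=
    cells_down h1 (by omega) (by omega) (by omega) (by omega)
  rw [nd_iff lam d (by omega)] at h2
  omega

lemma nd_lip {n : ℕ} (lam : Nat.Partition n) (d : ℤ) (k : ℕ) : |(nd lam (d+k) : ℤ) - nd lam d| ≤ k := by
  induction k with
  | zero => simp
  | succ k ih =>
    have h1 := nd_succ lam (d+k)
    have h2 := nd_pred lam (d+k)
    push_cast
    rw [← add_assoc]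
    rw [abs_le] at *
    omega

lemma nd_lip' {n : ℕ} (lam : Nat.Partition n) (d e : ℤ) : |(nd lam e : ℝ) - nd lam d| ≤ |(e:ℝ) - d| := by
  rcases le_total d e with h | h
  · have := nd_lip lam d (e-d).toNat
    rw [show d + ((e-d).toNat : ℤ) = e by omega] at this
    rw [show (((e-d).toNat : ℕ):ℤ) = |e-d| by rw [abs_of_nonneg] <;> omega] at this
    exact_mod_cast this
  · have := nd_lip lam e (d-e).toNat
    rw [show e + ((d-e).toNat : ℤ) = d by omega] at this
    rw [show (((d-e).toNat : ℕ):ℤ) = |d-e| by rw [abs_of_nonneg] <;> omega] at this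
    rw [abs_sub_comm, abs_sub_comm (e:ℝ)]
    exact_mod_cast this

def GG {n : ℕ} (lam : Nat.Partition n) (u : ℝ) : ℝ := nd lam ⌊u * Real.sqrt n⌋ / Real.sqrt n

lemma floor_diff (x y : ℝ) : |((⌊x⌋:ℤ):ℝ) - (⌊y⌋:ℤ)| ≤ |x - y| + 1 := by
  have h1 := Int.floor_le x
  have h2 := Int.lt_floor_add_one x
  have h3 := Int.floor_le y
  have h4 := Int.lt_floor_add_one y
  have := le_abs_self (x-y)
  have := neg_abs_le (x-y)
  rw [abs_le]; constructor <;> linarith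

lemma GG_lip {n : ℕ} (hn : 1 ≤ n) (lam : Nat.Partition n) (u v : ℝ) :
    |GG lam u - GG lam v| ≤ |u - v| + 1 / Real.sqrt n := by
  have hq : 0 < Real.sqrt n := Real.sqrt_pos.2 (by exact_mod_cast hn)
  rw [GG, GG, ← sub_div, abs_div, abs_of_pos hq, div_le_iff₀ hq, add_mul, div_mul_cancel₀ _ hq.ne']
  refine (nd_lip' lam _ _).trans ((floor_diff _ _).trans ?_)
  rw [← sub_mul, abs_mul, abs_of_pos hq]

lemma GG_nonneg {n : ℕ} (lam : Nat.Partition n) (u : ℝ) : 0 ≤ GG lam u := by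
  unfold GG; positivity

lemma GG_mono {n : ℕ} (lam : Nat.Partition n) {u v : ℝ} (hu : 0 ≤ u) (huv : u ≤ v) : GG lam v ≤ GG lam u := by
  unfold GG
  apply div_le_div_of_nonneg_right _ (Real.sqrt_nonneg _)
  norm_cast
  apply nd_mono
  left
  exact ⟨Int.floor_nonneg.2 (by positivity), Int.floor_le_floor (by gcongr)⟩

lemma GG_mono' {n : ℕ} (lam : Nat.Partition n) {u v : ℝ} (hu : u ≤ 0) (huv : v ≤ u) : GG lam v ≤ GG lam u := by
  unfold GG
  apply div_le_div_of_nonneg_right _ (Real.sqrt_nonneg _)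
  norm_cast
  apply nd_mono
  right
  refine ⟨Int.floor_le_floor (by gcongr), ?_⟩
  have : ((⌊u * Real.sqrt n⌋ : ℤ) : ℝ) ≤ 0 := (Int.floor_le _).trans (mul_nonpos_of_nonpos_of_nonneg hu (Real.sqrt_nonneg _))
  exact_mod_cast this

lemma profile {n : ℕ} (hn : 1 ≤ n) (lam : Nat.Partition n) (X : ℝ) :
    |Lprofile n lam X - (|X| + GG lam (2*X))| ≤ 2 / Real.sqrt n := by
  have hq : 0 < Real.sqrt n := Real.sqrt_pos.2 (by exact_mod_cast hn)
  have h2 : 0 < Real.sqrt 2 := by positivity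
  have h22 : Real.sqrt 2 ^ 2 = 2 := Real.sq_sqrt (by norm_num)
  have hT : Real.sqrt (2*n) = Real.sqrt 2 * Real.sqrt n := Real.sqrt_mul (by norm_num) _
  have hTp : 0 < Real.sqrt 2 * Real.sqrt n := by positivity
  set q := Real.sqrt n with hqd
  set d : ℤ := ⌊2*X*q⌋ with hd
  have hd1 : (d:ℝ) ≤ 2*X*q := Int.floor_le _
  have hd2 : 2*X*q < d + 1 := Int.lt_floor_add_one _
  have habs : |2*X*q| = 2 * |X| * q := by rw [abs_mul, abs_mul, abs_of_pos hq, abs_of_pos (by norm_num : (0:ℝ)<2)]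
  have hGG : GG lam (2*X) = nd lam d / q := rfl
  have hda : |((|d| : ℤ) : ℝ) - 2 * |X| * q| ≤ 1 := by
    rw [← habs, Int.cast_abs]
    refine (abs_abs_sub_abs_le_abs_sub _ _).trans ?_
    rw [abs_le]; constructor <;> linarith
  rw [abs_le] at hda
  have hub : ∀ Y ∈ {Y : ℝ | ∃ x y : ℝ,
    (∃ i j : ℕ, 1 ≤ i ∧ 1 ≤ j ∧ j ≤ rowLen lam i ∧
      ((j:ℝ)-1)/Real.sqrt (2*n) ≤ x ∧ x ≤ (j:ℝ)/Real.sqrt (2*n) ∧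
      ((i:ℝ)-1)/Real.sqrt (2*n) ≤ y ∧ y ≤ (i:ℝ)/Real.sqrt (2*n)) ∧
    X = (x - y)/Real.sqrt 2 ∧ Y = (x + y)/Real.sqrt 2}, Y ≤ |X| + GG lam (2*X) + 2 / q := by
    rintro Y ⟨x, y, ⟨i, j, hi, hj, hij, x1, x2, y1, y2⟩, hX, hY⟩
    rw [hT] at x1 x2 y1 y2
    rw [div_le_iff₀ hTp] at x1 y1
    rw [le_div_iff₀ hTp] at x2 y2
    have hXq : 2*X*q = x * (Real.sqrt 2 * q) - y * (Real.sqrt 2 * q) := by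
      rw [hX]; field_simp; rw [h22]; ring
    have hYq : 2*Y*q = x * (Real.sqrt 2 * q) + y * (Real.sqrt 2 * q) := by
      rw [hY]; field_simp; rw [h22]; ring
    have hc : (i,j) ∈ cellsOf lam := mem_cells.2 ⟨hi, hj, hij⟩
    have e1 : (d:ℝ) < ((j:ℤ) - i : ℤ) + 1 + 1 := by push_cast; linarith
    have e2 : (((j:ℤ) - i : ℤ) : ℝ) - 1 < d + 1 := by push_cast; linarith
    have e1' : d < (j:ℤ) - i + 1 + 1 := by exact_mod_cast e1
    have e2' : ((j:ℤ) - i) - 1 < d + 1 := by exact_mod_cast e2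
    have hm : min i j ≤ nd lam d + 1 := by
      have h0 := nd_cell hc
      have hcase : (j:ℤ) - i = d + 1 ∨ (j:ℤ) - i = d ∨ d = (j:ℤ) - i + 1 := by omega
      rcases hcase with g | g | g
      · rw [g] at h0; exact h0.trans (nd_succ lam d)
      · rw [g] at h0; omega
      · rw [g]; exact h0.trans (nd_pred lam _)
    have hij2 : (i:ℤ) + j ≤ |d| + 2 * nd lam d + 3 := by
      have := le_abs_self d
      have := neg_abs_le d
      omega
    have hij3 : (i:ℝ) + j ≤ ((|d|:ℤ):ℝ) + 2 * nd lam d + 3 := by exact_mod_cast hij2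
    have : 2*Y*q ≤ 2 * (|X| * q + nd lam d + 2) := by linarith
    rw [hGG]
    rw [← mul_le_mul_iff_left₀ hq]
    rw [show (|X| + nd lam d / q + 2/q) * q = |X| * q + nd lam d + 2 by field_simp]
    linarith
  have hG0 : 0 ≤ GG lam (2*X) := GG_nonneg _ _
  have h2q : 0 < 2/q := by positivity
  rw [abs_le]
  constructor
  · unfold Lprofile
    rcases Nat.eq_zero_or_pos (nd lam d) with h0 | h0
    · have : GG lam (2*X) = 0 := by rw [hGG, h0]; simp
      linarith [le_max_left |X| (sSup {Y : ℝ | ∃ x y : ℝ,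
    (∃ i j : ℕ, 1 ≤ i ∧ 1 ≤ j ∧ j ≤ rowLen lam i ∧
      ((j:ℝ)-1)/Real.sqrt (2*n) ≤ x ∧ x ≤ (j:ℝ)/Real.sqrt (2*n) ∧
      ((i:ℝ)-1)/Real.sqrt (2*n) ≤ y ∧ y ≤ (i:ℝ)/Real.sqrt (2*n)) ∧
    X = (x - y)/Real.sqrt 2 ∧ Y = (x + y)/Real.sqrt 2})]
    · have hc := (nd_iff lam d h0).2 le_rfl
      obtain ⟨i, j, hi, hj⟩ : ∃ i j : ℕ, i = nd lam d + (-d).toNat ∧ j = nd lam d + d.toNat := ⟨_, _, rfl, rfl⟩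
      rw [← hi, ← hj] at hc
      have hc' := mem_cells.1 hc
      have hji : ((j:ℝ)) - i = d := by
        have : (j:ℤ) - i = d := by omega
        exact_mod_cast this
      have hsum : (i:ℝ) + j = ((|d|:ℤ):ℝ) + 2 * nd lam d := by
        have : (i:ℤ) + j = |d| + 2 * nd lam d := by
          rcases abs_cases d with g | g <;> omega
        exact_mod_cast this
      set θ := 2*X*q - d with hθ
      set Y := ((i:ℝ) + j - 2 + θ) / (2 * q) with hY
      have hle : Y ≤ sSup {Y : ℝ | ∃ x y : ℝ,
    (∃ i j : ℕ, 1 ≤ i ∧ 1 ≤ j ∧ j ≤ rowLen lam i ∧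
      ((j:ℝ)-1)/Real.sqrt (2*n) ≤ x ∧ x ≤ (j:ℝ)/Real.sqrt (2*n) ∧
      ((i:ℝ)-1)/Real.sqrt (2*n) ≤ y ∧ y ≤ (i:ℝ)/Real.sqrt (2*n)) ∧
    X = (x - y)/Real.sqrt 2 ∧ Y = (x + y)/Real.sqrt 2} := by
        apply le_csSup ⟨_, hub⟩
        refine ⟨((j:ℝ)-1+θ)/(Real.sqrt 2 * q), ((i:ℝ)-1)/(Real.sqrt 2 * q), ⟨i, j, hc'.1, hc'.2.1, hc'.2.2, ?_, ?_, ?_, ?_⟩, ?_, ?_⟩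
        · rw [hT]; gcongr; linarith
        · rw [hT]; gcongr; linarith
        · rw [hT]
        · rw [hT]; gcongr; linarith
        · rw [← sub_div, div_div, eq_div_iff (by positivity)]
          rw [hθ]; linear_combination (X * q) * h22 - hji
        · rw [← add_div, div_div, hY, div_eq_div_iff (by positivity) (by positivity)]
          linear_combination (((i:ℝ) + j - 2 + θ) * q) * h22
      have h5 : |X| + GG lam (2*X) - 2/q ≤ Y := by
        rw [hGG, hY, le_div_iff₀ (by positivity)]
        rw [show (|X| + nd lam d / q - 2/q) * (2*q) = 2 * |X| * q + 2*nd lam d - 4 by field_simp; ring]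
        linarith
      have := hle.trans (le_max_right |X| _)
      linarith
  · unfold Lprofile
    have : max |X| (sSup {Y : ℝ | ∃ x y : ℝ,
    (∃ i j : ℕ, 1 ≤ i ∧ 1 ≤ j ∧ j ≤ rowLen lam i ∧
      ((j:ℝ)-1)/Real.sqrt (2*n) ≤ x ∧ x ≤ (j:ℝ)/Real.sqrt (2*n) ∧
      ((i:ℝ)-1)/Real.sqrt (2*n) ≤ y ∧ y ≤ (i:ℝ)/Real.sqrt (2*n)) ∧
    X = (x - y)/Real.sqrt 2 ∧ Y = (x + y)/Real.sqrt 2}) ≤ |X| + GG lam (2*X) + 2/q := by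
      apply max_le
      · linarith
      · apply Real.sSup_le hub
        positivity
    linarith

end BLS

namespace BLS
open Finset

def nu {N : ℕ} (n : ℕ) (l : Fin N → ℕ) (f : ℝ → ℝ) : ℝ :=
  (∑ i : Fin N, ∑ j ∈ Icc 1 (l i), f (((j:ℝ) - ((i:ℕ) + 1 : ℕ)) / Real.sqrt n)) / n

lemma nu_add {N : ℕ} (n : ℕ) (l : Fin N → ℕ) (f g : ℝ → ℝ) :
    nu n l (fun u => f u + g u) = nu n l f + nu n l g := by
  simp only [nu, Finset.sum_add_distrib, add_div]

lemma nu_smul {N : ℕ} (n : ℕ) (l : Fin N → ℕ) (a : ℝ) (f : ℝ → ℝ) :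
    nu n l (fun u => a * f u) = a * nu n l f := by
  simp only [nu, ← Finset.mul_sum, mul_div_assoc]

lemma nu_mono {N : ℕ} (n : ℕ) (l : Fin N → ℕ) {f g : ℝ → ℝ} (h : ∀ u, f u ≤ g u) : nu n l f ≤ nu n l g := by
  unfold nu
  apply div_le_div_of_nonneg_right _ (Nat.cast_nonneg n)
  exact Finset.sum_le_sum (fun i _ => Finset.sum_le_sum (fun j _ => h _))

lemma nu_abs {N : ℕ} (n : ℕ) (l : Fin N → ℕ) {f p q : ℝ → ℝ} (h : ∀ u, |f u - p u| ≤ q u) :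
    |nu n l f - nu n l p| ≤ nu n l q := by
  have h1 : nu n l f ≤ nu n l (fun u => p u + q u) := nu_mono n l (fun u => by linarith [(abs_le.1 (h u)).2])
  have h2 : nu n l p ≤ nu n l (fun u => f u + q u) := nu_mono n l (fun u => by linarith [(abs_le.1 (h u)).1])
  rw [nu_add] at h1 h2
  rw [abs_le]; constructor <;> linarith

def L2 (N : ℕ → ℕ) (F : ∀ n, (Fin (N n) → ℕ) → ℝ) : Prop :=
  Tendsto (fun n => EE (N n) n (fun l => F n l ^ 2)) atTop (𝓝 0)

lemma L2.smul {N : ℕ → ℕ} {F : ∀ n, (Fin (N n) → ℕ) → ℝ} (h : L2 N F) (a : ℝ) : L2 N (fun n l => a * F n l) := by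
  unfold L2 at *
  simp only [mul_pow, EE_smul]
  simpa using h.const_mul (a^2)

lemma L2.absadd {N : ℕ → ℕ} {F G H : ∀ n, (Fin (N n) → ℕ) → ℝ} (h : L2 N F) (h' : L2 N G)
    (hH : ∀ n l, |H n l| ≤ |F n l| + |G n l|) : L2 N H := by
  unfold L2 at *
  have h3 := (h.const_mul 2).add (h'.const_mul 2)
  simp only [mul_zero, add_zero] at h3
  refine squeeze_zero (fun n => EE_nonneg (fun l _ => sq_nonneg _)) (fun n => ?_) h3
  rw [← EE_smul, ← EE_smul, ← EE_add]
  apply EE_mono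
  intro l _
  have := hH n l
  rw [← sq_abs (H n l), ← sq_abs (F n l), ← sq_abs (G n l)]
  nlinarith [abs_nonneg (H n l), sq_nonneg (|F n l| - |G n l|)]

lemma L2.approx {N : ℕ → ℕ} (hN : ∀ n, 0 < N n) {F : ∀ n, (Fin (N n) → ℕ) → ℝ}
    (h : ∀ η > 0, ∃ G : ∀ n, (Fin (N n) → ℕ) → ℝ, L2 N G ∧ ∀ n l, |F n l| ≤ |G n l| + η) : L2 N F := by
  rw [L2, Metric.tendsto_atTop]
  intro ε hε
  obtain ⟨G, hG, hF⟩ := h (Real.sqrt (ε/4)) (Real.sqrt_pos.2 (by linarith))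
  have hs : Real.sqrt (ε/4) ^ 2 = ε/4 := Real.sq_sqrt (by linarith)
  rw [L2, Metric.tendsto_atTop] at hG
  obtain ⟨n0, hn0⟩ := hG (ε/4) (by linarith)
  refine ⟨n0, fun n hn => ?_⟩
  have h1 := hn0 n hn
  rw [Real.dist_0_eq_abs, abs_of_nonneg (EE_nonneg (fun l _ => sq_nonneg _))] at *
  have h2 : EE (N n) n (fun l => F n l ^ 2) ≤ EE (N n) n (fun l => 2 * G n l ^2 + 2 * (ε/4)) := by
    apply EE_mono
    intro l _
    have := hF n l
    rw [← sq_abs (F n l), ← sq_abs (G n l), ← hs]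
    nlinarith [abs_nonneg (F n l), sq_nonneg (|G n l| - Real.sqrt (ε/4))]
  rw [EE_add, EE_smul, EE_const (hN n)] at h2
  linarith

lemma gi_integrable {c : ℝ} (hc : 0 ≤ c) {f : ℝ → ℝ} (hf : Continuous f) : Integrable (fun u => f u * gi c u) := by
  apply Continuous.integrable_of_hasCompactSupport (hf.mul (gi_cont c))
  apply HasCompactSupport.intro (isCompact_Icc (a := -(c+2)) (b := c+2))
  intro u hu
  rw [Pi.mul_apply, gi_zero hc, mul_zero]
  by_contra h
  exact hu (abs_le.1 (not_le.1 h).le)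

def FF (c : ℝ) (f : ℝ → ℝ) {N : ℕ} (n : ℕ) (l : Fin N → ℕ) : ℝ := nu n l f - ∫ u, f u * gi c u

lemma FF_poly {N : ℕ → ℕ} (hN : ∀ n, 0 < N n) {c : ℝ} (hc0 : 0 ≤ c)
    (hc : Tendsto (fun n : ℕ => Real.sqrt n / (N n : ℝ)) atTop (𝓝 c)) (P : Polynomial ℝ) :
    L2 N (fun n l => FF c (fun u => P.eval u) n l) := by
  induction P using Polynomial.induction_on' with
  | add p q hp hq =>
    refine hp.absadd hq (fun n l => ?_)
    refine le_of_eq_of_le ?_ (abs_add_le _ _)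
    congr 1
    simp only [FF, Polynomial.eval_add, nu_add, add_mul]
    rw [integral_add (gi_integrable hc0 p.continuous) (gi_integrable hc0 q.continuous)]
    ring
  | monomial k a =>
    have h1 : L2 N (fun n l => FF c (fun u => u^k) n l) := by
      obtain ⟨δ, hδ, hb⟩ := lln hN hc k
      refine squeeze_zero' (Eventually.of_forall (fun n => EE_nonneg (fun l _ => sq_nonneg _))) ?_ hδ
      filter_upwards [eventually_ge_atTop 1] with n hn
      refine le_trans (le_of_eq ?_) (hb n hn)
      simp only [FF, gi_mom hc0]
      rfl
    have h2 := h1.smul a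
    convert h2 using 3 with n l
    simp only [FF, Polynomial.eval_monomial, nu_smul, mul_assoc, integral_const_mul]
    ring

lemma poly_growth (P : Polynomial ℝ) : ∃ C > 0, ∀ u : ℝ, 1 ≤ |u| → |P.eval u| ≤ C * |u|^P.natDegree := by
  refine ⟨∑ i ∈ range (P.natDegree+1), |P.coeff i| + 1, by positivity, fun u hu => ?_⟩
  rw [Polynomial.eval_eq_sum_range]
  refine (Finset.abs_sum_le_sum_abs _ _).trans ?_
  rw [add_mul, Finset.sum_mul]
  have : ∑ i ∈ range (P.natDegree+1), |P.coeff i * u^i| ≤ ∑ i ∈ range (P.natDegree+1), |P.coeff i| * |u|^P.natDegree := by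
    apply Finset.sum_le_sum
    intro i hi
    rw [abs_mul, abs_pow]
    have := pow_le_pow_right₀ hu (Nat.lt_succ_iff.1 (mem_range.1 hi))
    gcongr
  have : 0 ≤ 1 * |u|^P.natDegree := by positivity
  linarith

lemma tail_approx {f : ℝ → ℝ} (hf : Continuous f) {R : ℝ} (hR : 1 ≤ R) (h0 : ∀ u, 2*R ≤ |u| → f u = 0)
    {η : ℝ} (hη : 0 < η) : ∃ P : Polynomial ℝ, ∃ K : ℕ, ∀ u, |f u - P.eval u| ≤ η * (1 + (u/R)^(2*K)) := by
  obtain ⟨P, hP⟩ := exists_polynomial_near_of_continuousOn (-(2*R)) (2*R) f hf.continuousOn η hη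
  obtain ⟨C, hC, hPC⟩ := poly_growth P
  set D := P.natDegree
  obtain ⟨k, hk⟩ := pow_unbounded_of_one_lt (C * R^D / η) (by norm_num : (1:ℝ) < 2)
  refine ⟨P, k + D, fun u => ?_⟩
  have hev : 0 ≤ (u/R)^(2*(k+D)) := Even.pow_nonneg (even_two_mul _) _
  rcases le_or_gt |u| (2*R) with h | h
  · rw [abs_sub_comm]
    have := hP u (abs_le.1 h)
    nlinarith
  · rw [h0 u h.le, zero_sub, abs_neg]
    refine (hPC u (by linarith)).trans ?_
    have hR0 : 0 < R := by linarith
    obtain ⟨y, hy, hy2⟩ : ∃ y, |u| = R * y ∧ 2 ≤ y := ⟨|u|/R, by field_simp, by rw [le_div_iff₀ hR0]; linarith⟩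
    have h1 : (u/R)^(2*(k+D)) = y^(2*(k+D)) := by
      rw [← Even.pow_abs (even_two_mul _) (u/R), abs_div, abs_of_pos hR0, hy]; congr 1; field_simp
    rw [h1, hy, mul_pow]
    rw [div_lt_iff₀ hη] at hk
    have h2 : (2:ℝ)^k * y^D ≤ y^(2*(k+D)) := by
      calc (2:ℝ)^k * y^D ≤ y^k * y^D := by gcongr
        _ = y^(k+D) := (pow_add _ _ _).symm
        _ ≤ y^(2*(k+D)) := pow_le_pow_right₀ (by linarith) (by omega)
    have hyD : 0 ≤ y^D := by positivity
    calc C * (R^D * y^D) = (C * R^D) * y^D := by ring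
      _ ≤ (2^k * η) * y^D := by gcongr
      _ = η * (2^k * y^D) := by ring
      _ ≤ η * (1 + y^(2*(k+D))) := by gcongr; linarith

lemma FF_cpt {N : ℕ → ℕ} (hN : ∀ n, 0 < N n) {c : ℝ} (hc0 : 0 ≤ c)
    (hc : Tendsto (fun n : ℕ => Real.sqrt n / (N n : ℝ)) atTop (𝓝 c)) {f : ℝ → ℝ} (hf : Continuous f)
    {A : ℝ} (hA : ∀ u, A ≤ |u| → f u = 0) : L2 N (fun n l => FF c f n l) := by
  apply L2.approx hN
  intro η hη
  set R := max (c+2) A with hR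
  have hR1 : c + 2 ≤ R := le_max_left _ _
  have hR2 : A ≤ R := le_max_right _ _
  have hR0 : 0 < R := by linarith
  set m := ∫ u, gi c u with hm
  have hm0 : 0 ≤ m := integral_nonneg (fun u => gi_nonneg c u)
  obtain ⟨P, K, hPK⟩ := tail_approx hf (R := R) (by linarith) (fun u hu => hA u (by linarith)) (η := η/(4*m+1)) (by positivity)
  set η' := η/(4*m+1) with hη'
  have hη0 : 0 < η' := by positivity
  set Q : Polynomial ℝ := 1 + Polynomial.C ((1/R)^(2*K)) * Polynomial.X^(2*K) with hQ
  have hQe : ∀ u, Q.eval u = 1 + (u/R)^(2*K) := by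
    intro u; rw [hQ]; simp only [Polynomial.eval_add, Polynomial.eval_one, Polynomial.eval_mul, Polynomial.eval_C, Polynomial.eval_pow, Polynomial.eval_X]; rw [← mul_pow, one_div_mul_eq_div]
  refine ⟨fun n l => |FF c (fun u => P.eval u) n l| + |η' * FF c (fun u => Q.eval u) n l|, ?_, ?_⟩
  · refine (FF_poly hN hc0 hc P).absadd ((FF_poly hN hc0 hc Q).smul η') (fun n l => ?_)
    rw [abs_of_nonneg (by positivity)]
  · intro n l
    rw [abs_of_nonneg (a := |FF c (fun u => P.eval u) n l| + |η' * FF c (fun u => Q.eval u) n l|) (by positivity)]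
    have i1 : |nu n l f - nu n l (fun u => P.eval u)| ≤ nu n l (fun u => η' * Q.eval u) :=
      nu_abs n l (fun u => by rw [hQe]; exact hPK u)
    rw [nu_smul] at i1
    have hint : ∫ u, Q.eval u * gi c u ≤ 2 * m := by
      rw [hm, ← integral_const_mul]
      apply integral_mono (gi_integrable hc0 Q.continuous)
      · simpa using gi_integrable hc0 (f := fun _ => 2) continuous_const
      · intro u
        simp only
        have hg := gi_nonneg c u
        rcases le_or_gt (c+2) |u| with h | h
        · rw [gi_zero hc0 h]; simp
        · have : (u/R)^(2*K) ≤ 1 := by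
            rw [← Even.pow_abs (even_two_mul _) (u/R), abs_div, abs_of_pos hR0]
            apply pow_le_one₀ (by positivity)
            rw [div_le_one hR0]; linarith
          rw [hQe]; gcongr; linarith
    have i2 : |(∫ u, f u * gi c u) - ∫ u, P.eval u * gi c u| ≤ η' * ∫ u, Q.eval u * gi c u := by
      rw [← integral_sub (gi_integrable hc0 hf) (gi_integrable hc0 P.continuous), ← integral_const_mul]
      refine (abs_integral_le_integral_abs).trans ?_
      apply integral_mono
      · exact ((gi_integrable hc0 hf).sub (gi_integrable hc0 P.continuous)).abs
      · exact (gi_integrable hc0 Q.continuous).const_mul _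
      · intro u
        simp only
        rw [← sub_mul, abs_mul, abs_of_nonneg (gi_nonneg c u), ← mul_assoc]
        have := hPK u
        rw [← hQe] at this
        have := gi_nonneg c u
        gcongr
    have i3 : η' * FF c (fun u => Q.eval u) n l ≤ |η' * FF c (fun u => Q.eval u) n l| := le_abs_self _
    have i4 : η' * (4 * m) ≤ η := by
      rw [hη', div_mul_eq_mul_div, div_le_iff₀ (by positivity)]; nlinarith
    have i5 : η' * ∫ u, Q.eval u * gi c u ≤ η' * (2*m) := by gcongr
    have i6 : |FF c f n l| ≤ |FF c (fun u => P.eval u) n l| + |nu n l f - nu n l (fun u => P.eval u)| + |(∫ u, f u * gi c u) - ∫ u, P.eval u * gi c u| := by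
      have e : FF c f n l = FF c (fun u => P.eval u) n l + (nu n l f - nu n l (fun u => P.eval u)) - ((∫ u, f u * gi c u) - ∫ u, P.eval u * gi c u) := by
        unfold FF; ring
      rw [e]
      exact (abs_sub _ _).trans (add_le_add_left (abs_add_le _ _) _)
    have i7 : nu n l (fun u => Q.eval u) = FF c (fun u => Q.eval u) n l + ∫ u, Q.eval u * gi c u := by unfold FF; ring
    rw [i7, mul_add] at i1
    linarith

end BLS

namespace BLS
open Finset

def tent (v r u : ℝ) : ℝ := max 0 (r - |u - v|)

lemma tent_cont (v r : ℝ) : Continuous (tent v r) := by unfold tent; fun_prop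
lemma tent_nonneg (v r u : ℝ) : 0 ≤ tent v r u := le_max_left _ _
lemma tent_zero {v r u : ℝ} (h : r ≤ |u - v|) : tent v r u = 0 := max_eq_left (by linarith)
lemma tent_zero' {v r u : ℝ} (h : |v| + r ≤ |u|) : tent v r u = 0 := by
  apply tent_zero
  have := abs_add_le (u - v) v
  rw [sub_add_cancel] at this
  linarith

lemma tent_lip (v r u w : ℝ) : |tent v r u - tent v r w| ≤ |u - w| := by
  unfold tent
  refine (abs_max_sub_max_le_max _ _ _ _).trans ?_
  apply max_le
  · simp
  · rw [show r - |u-v| - (r - |w-v|) = |w-v| - |u-v| by ring]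
    refine (abs_abs_sub_abs_le_abs_sub _ _).trans (le_of_eq ?_)
    rw [show w - v - (u - v) = -(u-w) by ring, abs_neg]

lemma tent_supp (v r : ℝ) : HasCompactSupport (tent v r) := by
  apply HasCompactSupport.intro (isCompact_Icc (a := v-r) (b := v+r))
  intro u hu
  apply tent_zero
  by_contra h
  have := abs_lt.1 (not_le.1 h)
  exact hu ⟨by linarith, by linarith⟩

lemma tent_integrable (v r : ℝ) : Integrable (tent v r) :=
  (tent_cont v r).integrable_of_hasCompactSupport (tent_supp v r)

lemma tent_integral (v r : ℝ) : ∫ u, tent v r u = ∫ u, tent 0 r u := by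
  rw [← integral_add_right_eq_self (tent v r) v]
  simp [tent]

lemma tent_pos {r : ℝ} (hr : 0 < r) : 0 < ∫ u, tent 0 r u := by
  apply Continuous.integral_pos_of_hasCompactSupport_nonneg_nonzero (x := 0) (tent_cont 0 r) (tent_supp 0 r)
  · exact fun u => tent_nonneg 0 r u
  · simp [tent, hr]

lemma GG_eq {n : ℕ} (hn : 1 ≤ n) (lam : Nat.Partition n) (f : ℝ → ℝ) (u : ℝ) :
    f u * GG lam u = ∑ p ∈ cellsOf lam, (1/Real.sqrt n) *
      (Set.Ico (((p.2:ℝ)-p.1)/Real.sqrt n) (((p.2:ℝ)-p.1+1)/Real.sqrt n)).indicator f u := by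
  have hq : 0 < Real.sqrt n := Real.sqrt_pos.2 (by exact_mod_cast hn)
  rw [GG, nd, Finset.card_filter, ← Finset.mul_sum]
  push_cast
  rw [mul_div_assoc', mul_comm, mul_comm (1/Real.sqrt n), mul_one_div, Finset.sum_mul]
  congr 1
  apply Finset.sum_congr rfl
  intro p _
  rw [Set.indicator_apply]
  have : ((p.2:ℤ) - p.1 = ⌊u * Real.sqrt n⌋) ↔ u ∈ Set.Ico (((p.2:ℝ)-p.1)/Real.sqrt n) (((p.2:ℝ)-p.1+1)/Real.sqrt n) := by
    rw [eq_comm, Int.floor_eq_iff, Set.mem_Ico, div_le_iff₀ hq, lt_div_iff₀ hq]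
    push_cast; rfl
  simp only [this]
  split_ifs <;> simp

lemma GG_integrable {n : ℕ} (hn : 1 ≤ n) (lam : Nat.Partition n) (v r : ℝ) :
    Integrable (fun u => tent v r u * GG lam u) := by
  simp only [GG_eq hn lam (tent v r)]
  apply integrable_finsetSum
  intro p _
  exact ((tent_integrable v r).indicator measurableSet_Ico).const_mul _

lemma nu_rows {n N : ℕ} (lam : Nat.Partition n) (h : lam.parts.card ≤ N) (f : ℝ → ℝ) :
    nu n (rows N lam) f = (∑ p ∈ cellsOf lam, f (((p.2:ℝ) - p.1)/Real.sqrt n)) / n := by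
  rw [nu, sum_cells lam h (fun a b => f (((b:ℝ) - a)/Real.sqrt n))]

lemma nu_GG {n N : ℕ} (hn : 1 ≤ n) (lam : Nat.Partition n) (h : lam.parts.card ≤ N) (v r : ℝ) :
    |(∫ u, tent v r u * GG lam u) - nu n (rows N lam) (tent v r)| ≤ 1 / Real.sqrt n := by
  have hn' : (0:ℝ) < n := by exact_mod_cast hn
  have hq : 0 < Real.sqrt n := Real.sqrt_pos.2 hn'
  have hq2 : Real.sqrt n * Real.sqrt n = n := Real.mul_self_sqrt hn'.le
  rw [nu_rows lam h]
  simp only [GG_eq hn lam (tent v r)]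
  rw [integral_finsetSum _ (fun p _ => ((tent_integrable v r).indicator measurableSet_Ico).const_mul _), Finset.sum_div, ← Finset.sum_sub_distrib]
  refine (Finset.abs_sum_le_sum_abs _ _).trans ?_
  have key : ∀ p ∈ cellsOf lam, |(∫ u, (1/Real.sqrt n) * (Set.Ico (((p.2:ℝ)-p.1)/Real.sqrt n) (((p.2:ℝ)-p.1+1)/Real.sqrt n)).indicator (tent v r) u) - tent v r (((p.2:ℝ) - p.1)/Real.sqrt n) / n| ≤ 1/(n * Real.sqrt n) := by
    intro p _
    set a := ((p.2:ℝ)-p.1)/Real.sqrt n with ha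
    have hb : ((p.2:ℝ)-p.1+1)/Real.sqrt n = a + 1/Real.sqrt n := by rw [ha, add_div]
    rw [hb, integral_const_mul, integral_indicator measurableSet_Ico]
    have hv : volume.real (Set.Ico a (a + 1/Real.sqrt n)) = 1/Real.sqrt n := by
      rw [Real.volume_real_Ico_of_le (by linarith [show 0 < 1/Real.sqrt n by positivity])]; ring
    have hfin : volume (Set.Ico a (a + 1/Real.sqrt n)) < ⊤ := by simp
    have h1 : ∫ u in Set.Ico a (a + 1/Real.sqrt n), (tent v r u - tent v r a) = (∫ u in Set.Ico a (a + 1/Real.sqrt n), tent v r u) - (1/Real.sqrt n) * tent v r a := by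
      rw [integral_sub (tent_integrable v r).integrableOn (integrableOn_const hfin.ne), setIntegral_const, hv, smul_eq_mul]
    have h2 := norm_setIntegral_le_of_norm_le_const (μ := volume) (s := Set.Ico a (a + 1/Real.sqrt n)) (f := fun u => tent v r u - tent v r a) (C := 1/Real.sqrt n) hfin (by
      intro u hu
      refine (tent_lip v r u a).trans ?_
      rw [abs_of_nonneg (by linarith [hu.1])]
      linarith [hu.2])
    rw [h1, hv, Real.norm_eq_abs] at h2
    have e : 1 / Real.sqrt n * (∫ u in Set.Ico a (a + 1/Real.sqrt n), tent v r u) - tent v r a / n = (1/Real.sqrt n) * ((∫ u in Set.Ico a (a + 1/Real.sqrt n), tent v r u) - (1/Real.sqrt n) * tent v r a) := by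
      rw [mul_sub, ← mul_assoc]
      rw [show 1/Real.sqrt n * (1/Real.sqrt n) = 1/n by rw [one_div_mul_one_div, hq2]]
      ring
    rw [e, abs_mul, abs_of_pos (by positivity : 0 < 1/Real.sqrt n)]
    calc 1/Real.sqrt n * _ ≤ 1/Real.sqrt n * (1/Real.sqrt n * (1/Real.sqrt n)) := by gcongr
      _ = 1/(n*Real.sqrt n) := by rw [one_div_mul_one_div, hq2, one_div_mul_one_div, mul_comm]
  refine (Finset.sum_le_sum key).trans ?_
  rw [Finset.sum_const, cells_card, nsmul_eq_mul]
  apply le_of_eq; field_simp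

lemma local_close {c : ℝ} (hc : 0 ≤ c) {n N : ℕ} (hn : 1 ≤ n) (lam : Nat.Partition n) (h : lam.parts.card ≤ N)
    {v r u0 ε δ : ℝ} (hr : 0 < r) (hu0 : |u0 - v| ≤ r) (hrε : 2*r + 1/Real.sqrt n ≤ ε/4)
    (hgi : ∀ u w, |u - w| ≤ 2*r → |gi c u - gi c w| ≤ ε/4)
    (hF : |FF c (tent v r) n (rows N lam)| ≤ δ) (hδ : δ + 1/Real.sqrt n ≤ (ε/2) * ∫ u, tent 0 r u) :
    |GG lam u0 - gi c u0| ≤ ε := by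
  have hκ := tent_pos hr
  set κ := ∫ u, tent 0 r u with hκd
  have i1 := GG_integrable hn lam v r
  have i2 := gi_integrable hc (tent_cont v r)
  have i3 := tent_integrable v r
  have b1 := nu_GG hn lam h v r
  have b2 : |(∫ u, tent v r u * GG lam u) - ∫ u, tent v r u * gi c u| ≤ δ + 1/Real.sqrt n := by
    unfold FF at hF
    rw [abs_le] at *
    constructor <;> linarith
  have pt : ∀ u, |(tent v r u * GG lam u - tent v r u * gi c u) - tent v r u * (GG lam u0 - gi c u0)| ≤ tent v r u * (ε/2) := by
    intro u
    rw [← mul_sub, ← mul_sub, abs_mul, abs_of_nonneg (tent_nonneg v r u)]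
    rcases le_or_gt r |u - v| with g | g
    · rw [tent_zero g]; simp
    · have huu : |u - u0| ≤ 2*r := by
        rw [abs_le] at *; rw [abs_lt] at g
        constructor <;> linarith
      have g1 := GG_lip hn lam u u0
      have g2 := hgi u u0 huu
      apply mul_le_mul_of_nonneg_left _ (tent_nonneg v r u)
      rw [abs_le] at g2 ⊢
      have g3 := abs_le.1 (g1.trans (by linarith : |u - u0| + 1/Real.sqrt n ≤ ε/4))
      constructor <;> linarith
  have b3 : |((∫ u, tent v r u * GG lam u) - ∫ u, tent v r u * gi c u) - κ * (GG lam u0 - gi c u0)| ≤ κ * (ε/2) := by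
    have e1 : ((∫ u, tent v r u * GG lam u) - ∫ u, tent v r u * gi c u) - κ * (GG lam u0 - gi c u0) =
        ∫ u, ((tent v r u * GG lam u - tent v r u * gi c u) - tent v r u * (GG lam u0 - gi c u0)) := by
      have i12 : Integrable (fun u => tent v r u * GG lam u - tent v r u * gi c u) := i1.sub i2
      have i4 : Integrable (fun u => tent v r u * (GG lam u0 - gi c u0)) := i3.mul_const _
      rw [integral_sub i12 i4, integral_sub i1 i2, integral_mul_const, tent_integral]
    have e2 : κ * (ε/2) = ∫ u, tent v r u * (ε/2) := by rw [integral_mul_const, tent_integral]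
    rw [e1, e2]
    refine abs_integral_le_integral_abs.trans ?_
    apply integral_mono ((i1.sub i2).sub (i3.mul_const _)).abs (i3.mul_const _)
    exact pt
  have b4 : κ * |GG lam u0 - gi c u0| ≤ κ * ε := by
    rw [← abs_of_pos hκ, ← abs_mul, abs_of_pos hκ]
    rw [abs_le] at *
    constructor <;> linarith
  exact le_of_mul_le_mul_left b4 hκ

lemma global_close {c : ℝ} (hc : 0 ≤ c) {n : ℕ} (lam : Nat.Partition n) {ε : ℝ}
    (h : ∀ u, |u| ≤ c + 2 → |GG lam u - gi c u| ≤ ε) (u : ℝ) : |GG lam u - gi c u| ≤ ε := by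
  rcases le_or_gt |u| (c+2) with g | g
  · exact h u g
  · rw [gi_zero hc g.le, sub_zero, abs_of_nonneg (GG_nonneg _ _)]
    have hp : (0:ℝ) ≤ c + 2 := by linarith
    rcases lt_abs.1 g with g' | g'
    · refine (GG_mono lam hp g'.le).trans ?_
      have h1 := h (c+2) (by rw [abs_of_nonneg hp])
      rw [gi_zero hc (by rw [abs_of_nonneg hp]), sub_zero] at h1
      exact (le_abs_self _).trans h1
    · refine (GG_mono' lam (u := -(c+2)) (by linarith) (by linarith)).trans ?_
      have h1 := h (-(c+2)) (by rw [abs_neg, abs_of_nonneg hp])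
      rw [gi_zero hc (by rw [abs_neg, abs_of_nonneg hp]), sub_zero] at h1
      exact (le_abs_self _).trans h1

lemma gi_unif {c : ℝ} (hc : 0 ≤ c) {ε : ℝ} (hε : 0 < ε) : ∃ r0 > 0, ∀ u w, |u - w| < r0 → |gi c u - gi c w| < ε := by
  have hs : HasCompactSupport (gi c) := by
    apply HasCompactSupport.intro (isCompact_Icc (a := -(c+2)) (b := c+2))
    intro u hu
    apply gi_zero hc
    by_contra h
    exact hu (abs_le.1 (not_le.1 h).le)
  have := hs.uniformContinuous_of_continuous (gi_cont c)
  rw [Metric.uniformContinuous_iff] at this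
  obtain ⟨r0, h0, h⟩ := this ε hε
  exact ⟨r0, h0, fun u w huw => h huw⟩

lemma EE_sum {N n : ℕ} {ι : Type*} (s : Finset ι) (F : ι → (Fin N → ℕ) → ℝ) :
    EE N n (fun l => ∑ k ∈ s, F k l) = ∑ k ∈ s, EE N n (F k) := by
  simp only [EE, Finset.mul_sum]
  rw [Finset.sum_comm]

lemma PNN_nonneg {n N : ℕ} {lam : Nat.Partition n} (h : lam ∈ YNN n N) : 0 ≤ PNN n N lam := by
  simp only [YNN, mem_filter, mem_univ, true_and] at h
  rw [PNN_eq lam h]; exact WW_nonneg _ _ _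

theorem main (c : ℝ) (hc0 : 0 ≤ c) (N : ℕ → ℕ) (hN : ∀ n, 0 < N n)
    (hc : Tendsto (fun n : ℕ => Real.sqrt n / (N n : ℝ)) atTop (𝓝 c)) (ε : ℝ) (hε : 0 < ε) :
    Tendsto (fun n => ∑ lam ∈ (YNN n (N n)).filter (fun lam => ∀ X : ℝ, |Lprofile n lam X - Omega c X| ≤ ε),
      PNN n (N n) lam) atTop (𝓝 1) := by
  obtain ⟨r0, hr0, hgi⟩ := gi_unif hc0 (ε := (ε/2)/4) (by positivity)
  set r := min (r0/4) (ε/32) with hr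
  have hrp : 0 < r := lt_min (by positivity) (by positivity)
  have hr1 : r ≤ r0/4 := min_le_left _ _
  have hr2 : r ≤ ε/32 := min_le_right _ _
  have hκ := tent_pos hrp
  set κ := ∫ u, tent 0 r u with hκd
  set δ := ε/8 * κ with hδ
  have hδp : 0 < δ := by positivity
  set M : ℤ := ⌈(c+2)/r⌉ + 1 with hM
  set V := Finset.Icc (-M) M with hV
  set Z : ∀ n, (Fin (N n) → ℕ) → ℝ := fun n l => ∑ k ∈ V, FF c (tent (r*(k:ℝ)) r) n l ^ 2 with hZ
  have hZ0 : ∀ n l, 0 ≤ Z n l := fun n l => Finset.sum_nonneg (fun k _ => sq_nonneg _)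
  have hS : Tendsto (fun n => EE (N n) n (Z n)) atTop (𝓝 0) := by
    simp only [hZ, EE_sum]
    rw [← Finset.sum_const_zero (s := V)]
    apply tendsto_finsetSum
    intro k _
    exact FF_cpt hN hc0 hc (tent_cont _ _) (A := |r*(k:ℝ)| + r) (fun u hu => tent_zero' hu)
  have hinv : Tendsto (fun n : ℕ => 1 / Real.sqrt n) atTop (𝓝 0) := by
    simp only [one_div]
    exact tendsto_inv_atTop_zero.comp (Real.tendsto_sqrt_atTop.comp tendsto_natCast_atTop_atTop)
  have hlow : Tendsto (fun n => 1 - (1/δ^2) * EE (N n) n (Z n)) atTop (𝓝 1) := by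
    have := (hS.const_mul (1/δ^2)).const_sub 1
    rw [mul_zero, sub_zero] at this
    exact this
  refine tendsto_of_tendsto_of_tendsto_of_le_of_le' hlow tendsto_const_nhds ?_ ?_
  · have ev := hinv.eventually_lt_const (show 0 < min (ε/16) δ by positivity)
    filter_upwards [ev, eventually_ge_atTop 1] with n hev hn
    have hq1 : 1/Real.sqrt n < ε/16 := hev.trans_le (min_le_left _ _)
    have hq2 : 1/Real.sqrt n < δ := hev.trans_le (min_le_right _ _)
    have hsub : ∀ lam : Nat.Partition n, lam.parts.card ≤ N n → Z n (rows (N n) lam) ≤ δ^2 →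
        ∀ X : ℝ, |Lprofile n lam X - Omega c X| ≤ ε := by
      intro lam hlam hz X
      have hcl : ∀ u, |GG lam u - gi c u| ≤ ε/2 := by
        apply global_close hc0
        intro u hu
        set k : ℤ := ⌊u/r⌋ with hk
        have k1 : (k:ℝ) ≤ u/r := Int.floor_le _
        have k2 : u/r < k+1 := Int.lt_floor_add_one _
        rw [le_div_iff₀ hrp] at k1
        rw [div_lt_iff₀ hrp] at k2
        have hkV : k ∈ V := by
          rw [hV, Finset.mem_Icc]
          have hceil := Int.le_ceil ((c+2)/r)
          have hu' := abs_le.1 hu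
          constructor
          · have : (-M : ℝ) < (k:ℝ) + 1 := by
              have a1 : -((c+2)/r) ≤ u/r := by rw [← neg_div]; gcongr; exact hu'.1
              have a2 : u/r < k+1 := Int.lt_floor_add_one _
              rw [hM]; push_cast; linarith
            have : -M < k + 1 := by exact_mod_cast this
            omega
          · have : (k : ℝ) ≤ M := by
              have a1 : u/r ≤ (c+2)/r := by gcongr; exact hu'.2
              have a2 : (k:ℝ) ≤ u/r := Int.floor_le _
              rw [hM]; push_cast; linarith
            exact_mod_cast this
        have hF : |FF c (tent (r*(k:ℝ)) r) n (rows (N n) lam)| ≤ δ := by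
          apply abs_le_of_sq_le_sq _ hδp.le
          refine le_trans ?_ hz
          exact Finset.single_le_sum (f := fun k : ℤ => FF c (tent (r*(k:ℝ)) r) n (rows (N n) lam) ^ 2) (fun _ _ => sq_nonneg _) hkV
        refine local_close hc0 hn lam hlam hrp ?_ ?_ ?_ hF ?_
        · rw [abs_of_nonneg (by linarith)]; linarith
        · linarith
        · intro a b hab; exact (hgi a b (by linarith)).le
        · rw [← hκd]; linarith
      have h1 := profile hn lam X
      have h2 := hcl (2*X)
      rw [Omega_eq hc0]
      have h3 : 2/Real.sqrt n = 2 * (1/Real.sqrt n) := by ring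
      rw [abs_le] at *
      constructor <;> linarith
    calc 1 - (1/δ^2) * EE (N n) n (Z n) = EE (N n) n (fun l => 1 + (-(1/δ^2)) * Z n l) := by
          rw [EE_add, EE_smul, EE_one (hN n)]; ring
      _ ≤ EE (N n) n (fun l => if Z n l ≤ δ^2 then 1 else 0) := by
          apply EE_mono
          intro l _
          have hz := hZ0 n l
          split_ifs with g
          · have : 0 ≤ 1/δ^2 * Z n l := by positivity
            linarith
          · have : 1 ≤ 1/δ^2 * Z n l := by
              rw [one_div_mul_eq_div, le_div_iff₀ (by positivity)]; linarith
            linarith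
      _ = ∑ lam ∈ (YNN n (N n)).filter (fun lam => Z n (rows (N n) lam) ≤ δ^2), PNN n (N n) lam :=
          (sum_PNN _ _ (fun lam _ => Iff.rfl)).symm
      _ ≤ _ := by
          apply Finset.sum_le_sum_of_subset_of_nonneg
          · intro lam hl
            rw [mem_filter] at *
            refine ⟨hl.1, hsub lam ?_ hl.2⟩
            have := hl.1
            simpa [YNN] using this
          · intro lam hl _
            exact PNN_nonneg (mem_filter.1 hl).1
  · refine Eventually.of_forall (fun n => ?_)
    calc _ ≤ ∑ lam ∈ (YNN n (N n)).filter (fun _ => True), PNN n (N n) lam := by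
          apply Finset.sum_le_sum_of_subset_of_nonneg
          · intro lam hl
            rw [mem_filter] at *
            exact ⟨hl.1, trivial⟩
          · intro lam hl _
            exact PNN_nonneg (mem_filter.1 hl).1
      _ = EE (N n) n (fun _ => 1) := by
          have hT := sum_PNN (n := n) (N := N n) (fun _ => True) (fun _ => True) (fun lam _ => Iff.rfl)
          simp only [if_true] at hT
          rw [← hT]
          congr 1
          ext lam
          simp
      _ = 1 := EE_one (hN n) n

end BLS

/-- **Biane's limit-shape theorem.** If `c ∈ [0,∞)` and `N(n)` is a
sequence of positive integers with `√n/N(n) → c`, then for every `ε > 0` the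
`ℙ_{N(n)}^n`-probability that `|L_λ(X) − Ω_c(X)| ≤ ε` for all `X` tends to `1`. -/
theorem biane_limit_shape :
    ∀ c : ℝ, 0 ≤ c → ∀ N : ℕ → ℕ, (∀ n, 0 < N n) →
      Tendsto (fun n : ℕ => Real.sqrt n / (N n : ℝ)) atTop (𝓝 c) →
      ∀ ε : ℝ, 0 < ε →
        Tendsto (fun n : ℕ =>
            ∑ lam ∈ (YNN n (N n)).filter (fun lam =>
                ∀ X : ℝ, |Lprofile n lam X - Omega c X| ≤ ε),
              PNN n (N n) lam)
          atTop (𝓝 1) := by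
  intro c hc N hN hlim ε hε
  exact BLS.main c hc N hN hlim ε hε
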